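/- There exists a function h : [0,1] × [0,1] → ℝ with the following two properties. (i) For every fixed pair of reals 0 ≤ u < v ≤ 1, H(x, x^u, x^v)/x converges to h(u, v) as x → ∞. (ii) There is an absolute constant C > 0 such that for all reals x, y, z with 3 ≤ y < z ≤ √x, one has |H(x, y, z) − x · h(log y / log x, log z / log x)| ≤ C · x / ((log y)^δ · (log log y)^{3/2 − δ}). -/

import Mathlib

open Filter

/-- `Hcnt x y z` is the number of integers `n` with `1 ≤ n ≤ x` having a divisor `d`
with `y < d < z`. -/
noncomputable def Hcnt (x y z : ℝ) : ℕ :=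
  {n : ℕ | 1 ≤ n ∧ (n : ℝ) ≤ x ∧ ∃ d : ℕ, d ∣ n ∧ y < (d : ℝ) ∧ (d : ℝ) < z}.ncard

/-- The Erdős constant `δ = 1 - (1 + log log 2)/log 2`. -/
noncomputable def erdosDelta : ℝ := 1 - (1 + Real.log (Real.log 2)) / Real.log 2

namespace Erd
open Finset

/-- Mertens-type sum. -/
noncomputable def Mert (n : ℕ) : ℝ := ∑ p ∈ Nat.primesLE n, Real.log p / p

lemma log_fact_eq (n : ℕ) : Real.log (n.factorial : ℝ) =
    ∑ p ∈ Nat.primesLE n, (n.factorial.factorization p : ℝ) * Real.log p := by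
  rw [Real.log_nat_eq_sum_factorization]
  unfold Finsupp.sum
  apply Finset.sum_subset
  · intro p hp
    simp only [Nat.support_factorization, Nat.mem_primeFactors] at hp
    rw [Nat.mem_primesLE]
    exact ⟨(hp.1.dvd_factorial).1 hp.2.1, hp.1⟩
  · intro p _ hp
    rw [Finsupp.notMem_support_iff] at hp
    simp [hp]

lemma fact_v_lower {p n : ℕ} (hp : p.Prime) : n / p ≤ n.factorial.factorization p := by
  rw [Nat.factorization_factorial hp (b := Nat.log p n + 2) (by omega)]
  calc n / p = n / p ^ 1 := by simp
    _ ≤ _ := Finset.single_le_sum (f := fun i => n / p ^ i) (fun _ _ => Nat.zero_le _)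
        (by simp)

lemma fact_v_upper {p n : ℕ} (hp : p.Prime) : (p - 1) * n.factorial.factorization p ≤ n := by
  haveI : Fact p.Prime := ⟨hp⟩
  have := sub_one_mul_padicValNat_factorial (p := p) n
  rw [Nat.factorization_def _ hp]
  omega

lemma sum_log_div_sq_bdd : ∃ C : ℝ, 0 < C ∧ ∀ n : ℕ,
    ∑ p ∈ Nat.primesLE n, Real.log p / (p * (p - 1)) ≤ C := by
  have hs : Summable (fun n : ℕ => 4 * ((n : ℝ) ^ ((3 : ℝ) / 2))⁻¹) :=
    (Real.summable_nat_rpow_inv.2 (by norm_num)).mul_left 4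
  refine ⟨∑' n : ℕ, 4 * ((n : ℝ) ^ ((3 : ℝ) / 2))⁻¹ + 1, ?_, ?_⟩
  · have : 0 ≤ ∑' n : ℕ, 4 * ((n : ℝ) ^ ((3 : ℝ) / 2))⁻¹ := tsum_nonneg (fun n => by positivity)
    linarith
  · intro n
    have h1 : ∑ p ∈ Nat.primesLE n, Real.log p / (p * (p - 1)) ≤
        ∑ p ∈ Nat.primesLE n, 4 * ((p : ℝ) ^ ((3 : ℝ) / 2))⁻¹ := by
      apply Finset.sum_le_sum
      intro p hp
      have hp2 : (2 : ℝ) ≤ p := by exact_mod_cast Nat.two_le_of_mem_primesLE hp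
      have hlog : Real.log p ≤ 2 * (p : ℝ) ^ ((1 : ℝ) / 2) := by
        have := Real.log_le_rpow_div (x := (p : ℝ)) (by linarith) (ε := 1 / 2) (by norm_num)
        linarith
      have he : (p : ℝ) ^ (2 : ℕ) = (p : ℝ) ^ ((3 : ℝ) / 2) * (p : ℝ) ^ ((1 : ℝ) / 2) := by
        rw [← Real.rpow_add (by linarith), ← Real.rpow_natCast]; norm_num
      have hA : 0 < (p : ℝ) ^ ((3 : ℝ) / 2) := by positivity
      have hB : 0 < (p : ℝ) ^ ((1 : ℝ) / 2) := by positivity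
      rw [div_le_iff₀ (by nlinarith)]
      have : (p : ℝ) ^ 2 / 2 ≤ p * (p - 1) := by nlinarith
      calc Real.log p ≤ 2 * (p : ℝ) ^ ((1 : ℝ) / 2) := hlog
        _ = 4 * ((p : ℝ) ^ ((3 : ℝ) / 2))⁻¹ * ((p : ℝ) ^ 2 / 2) := by
          rw [he]; field_simp; norm_num
        _ ≤ _ := by gcongr
    have h2 := hs.sum_le_tsum (Nat.primesLE n) (fun i _ => by positivity)
    linarith

lemma theta_nat_le (n : ℕ) : ∑ p ∈ Nat.primesLE n, Real.log p ≤ 2 * n := by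
  rw [← Chebyshev.theta_eq_sum_primesLE_log]
  have := Chebyshev.theta_le_log4_mul_x (x := (n : ℝ)) (by positivity)
  have h4 : Real.log 4 ≤ 2 := by
    rw [show (4 : ℝ) = 2 ^ 2 by norm_num, Real.log_pow]
    have := Real.log_two_lt_d9; push_cast; linarith
  nlinarith [Nat.cast_nonneg (α := ℝ) n]

lemma log_fact_le (n : ℕ) : Real.log (n.factorial : ℝ) ≤ n * Real.log n := by
  rw [← Real.log_pow]
  apply Real.log_le_log (by positivity)
  exact_mod_cast Nat.factorial_le_pow n

lemma le_log_fact (n : ℕ) : n * Real.log n - n ≤ Real.log (n.factorial : ℝ) := by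
  rcases Nat.eq_zero_or_pos n with h | h
  · subst h; simp
  · have hn : (0 : ℝ) < n := by exact_mod_cast h
    have h1 : ((n : ℝ) ^ n) / n.factorial ≤ Real.exp n :=
      Real.pow_div_factorial_le_exp _ (by positivity) n
    have h2 := Real.log_le_log (by positivity) h1
    rw [Real.log_exp, Real.log_div (by positivity) (by positivity), Real.log_pow] at h2
    linarith

lemma log_p_nonneg (n : ℕ) : 0 ≤ Real.log (n : ℝ) := Real.log_natCast_nonneg n

lemma mert_bound_nat : ∃ C : ℝ, 0 < C ∧ ∀ n : ℕ, 1 ≤ n → |Mert n - Real.log n| ≤ C := by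
  obtain ⟨C, hC, hCb⟩ := sum_log_div_sq_bdd
  refine ⟨C + 2, by linarith, fun n hn => ?_⟩
  have hn' : (0 : ℝ) < n := by exact_mod_cast hn
  rw [abs_le]
  constructor
  · -- lower bound
    have h1 : Real.log (n.factorial : ℝ) ≤ n * (Mert n + C) := by
      rw [log_fact_eq]
      calc _ ≤ ∑ p ∈ Nat.primesLE n, n * (Real.log p / p + Real.log p / (p * (p - 1))) := by
            apply Finset.sum_le_sum
            intro p hp
            have hp' := Nat.prime_of_mem_primesLE hp
            have hp2 : (2 : ℝ) ≤ p := by exact_mod_cast hp'.two_le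
            have hv := fact_v_upper (n := n) hp'
            have hv' : ((p : ℝ) - 1) * n.factorial.factorization p ≤ n := by
              have : (((p - 1) * n.factorial.factorization p : ℕ) : ℝ) ≤ n := by exact_mod_cast hv
              rwa [Nat.cast_mul, Nat.cast_sub hp'.one_lt.le, Nat.cast_one] at this
            have hv2 : (n.factorial.factorization p : ℝ) ≤ n / (p - 1) := by
              rw [le_div_iff₀ (by linarith)]; linarith
            have e : (n : ℝ) * (Real.log p / p + Real.log p / (p * (p - 1))) =
                n / (p - 1) * Real.log p := by
              have : (p : ℝ) - 1 ≠ 0 := by linarith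
              field_simp; ring
            rw [e]
            exact mul_le_mul_of_nonneg_right hv2 (log_p_nonneg p)
        _ = n * (Mert n + ∑ p ∈ Nat.primesLE n, Real.log p / (p * (p - 1))) := by
            rw [← Finset.mul_sum, Finset.sum_add_distrib, Mert]
        _ ≤ _ := by gcongr; exact hCb n
    have h2 := le_log_fact n
    have : n * (Real.log n - 1) ≤ n * (Mert n + C) := by linarith
    have := le_of_mul_le_mul_left this hn'
    linarith
  · have h1 : n * Mert n - 2 * n ≤ Real.log (n.factorial : ℝ) := by
      have h3 := theta_nat_le n
      have : n * Mert n - ∑ p ∈ Nat.primesLE n, Real.log p ≤ Real.log (n.factorial : ℝ) := by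
        rw [log_fact_eq, Mert, Finset.mul_sum, ← Finset.sum_sub_distrib]
        apply Finset.sum_le_sum
        intro p hp
        have hp' := Nat.prime_of_mem_primesLE hp
        have hp2 : (2 : ℝ) ≤ p := by exact_mod_cast hp'.two_le
        have hv := fact_v_lower (n := n) hp'
        have hv' : (n : ℝ) / p - 1 ≤ n.factorial.factorization p := by
          have h5 : ((n / p : ℕ) : ℝ) ≤ n.factorial.factorization p := by exact_mod_cast hv
          have h6 : (n : ℝ) / p < (n / p : ℕ) + 1 := by
            rw [← Nat.floor_div_eq_div (K := ℝ)]; exact Nat.lt_floor_add_one _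
          linarith
        have := mul_le_mul_of_nonneg_right hv' (log_p_nonneg p)
        calc _ = ((n : ℝ) / p - 1) * Real.log p := by ring
          _ ≤ _ := this
      linarith
    have h2 := log_fact_le n
    have : n * (Mert n - 2) ≤ n * Real.log n := by linarith
    have := le_of_mul_le_mul_left this hn'
    linarith

/-- Sum of prime-power remainder. -/
noncomputable def remLog (m : ℕ) : ℝ := Real.log m - ∑ p ∈ m.primeFactors, Real.log p

lemma sum_primeFactors_log_le (m : ℕ) (hm : m ≠ 0) :
    ∑ p ∈ m.primeFactors, Real.log p ≤ Real.log m := by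
  rw [Real.log_nat_eq_sum_factorization]
  unfold Finsupp.sum
  rw [Nat.support_factorization]
  apply Finset.sum_le_sum
  intro p hp
  have : 1 ≤ m.factorization p := by
    have := (Nat.mem_primeFactors.1 hp)
    exact (this.1.dvd_iff_one_le_factorization hm).1 this.2.1
  have h : (1 : ℝ) ≤ m.factorization p := by exact_mod_cast this
  nlinarith [log_p_nonneg p]

lemma remLog_nonneg (m : ℕ) (hm : m ≠ 0) : 0 ≤ remLog m := by
  have := sum_primeFactors_log_le m hm; unfold remLog; linarith

lemma sum_log_Icc (n : ℕ) : ∑ m ∈ Icc 1 n, Real.log m = Real.log (n.factorial : ℝ) := by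
  induction n with
  | zero => simp
  | succ n ih =>
    rw [Finset.sum_Icc_succ_top (by omega), ih, Nat.factorial_succ]
    push_cast
    rw [Real.log_mul (by positivity) (by positivity)]; ring

lemma sum_primeFactors_swap (n : ℕ) (f : ℕ → ℕ → ℝ) :
    ∑ m ∈ Icc 1 n, ∑ p ∈ m.primeFactors, f p m =
      ∑ p ∈ Nat.primesLE n, ∑ k ∈ Icc 1 (n / p), f p (p * k) := by
  have h1 : ∀ m ∈ Icc 1 n, ∑ p ∈ m.primeFactors, f p m =
      ∑ p ∈ Nat.primesLE n, if p ∣ m then f p m else 0 := by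
    intro m hm
    rw [Finset.mem_Icc] at hm
    rw [← Finset.sum_filter]
    apply Finset.sum_congr _ (fun _ _ => rfl)
    ext p
    simp only [Nat.mem_primeFactors, mem_filter, Nat.mem_primesLE]
    constructor
    · rintro ⟨a, b, c⟩; exact ⟨⟨(Nat.le_of_dvd (by omega) b).trans hm.2, a⟩, b⟩
    · rintro ⟨⟨a, b⟩, c⟩; exact ⟨b, c, by omega⟩
  rw [Finset.sum_congr rfl h1, Finset.sum_comm]
  apply Finset.sum_congr rfl
  intro p hp
  have hp' := (Nat.prime_of_mem_primesLE hp).pos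
  rw [← Finset.sum_filter]
  symm
  apply Finset.sum_bij (fun k _ => p * k)
  · intro k hk
    rw [Finset.mem_Icc] at hk
    simp only [mem_filter, Finset.mem_Icc, dvd_mul_right, and_true]
    exact ⟨Nat.mul_pos hp' hk.1, by rw [mul_comm]; exact (Nat.le_div_iff_mul_le hp').1 hk.2⟩
  · intro a _ b _ h; exact Nat.eq_of_mul_eq_mul_left hp' h
  · intro m hm
    simp only [mem_filter, Finset.mem_Icc] at hm
    obtain ⟨⟨h1, h2⟩, k, rfl⟩ := hm
    refine ⟨k, ?_, rfl⟩
    rw [Finset.mem_Icc]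
    exact ⟨Nat.pos_of_ne_zero (by rintro rfl; simp at h1), (Nat.le_div_iff_mul_le hp').2 (by rw [mul_comm]; exact h2)⟩
  · intro _ _; rfl

lemma sum_remLog_le : ∃ C : ℝ, 0 < C ∧ ∀ n : ℕ, ∑ m ∈ Icc 1 n, remLog m ≤ C * n := by
  obtain ⟨C, hC, hCb⟩ := mert_bound_nat
  refine ⟨C + 2, by linarith, fun n => ?_⟩
  rcases Nat.eq_zero_or_pos n with h | h
  · subst h; simp
  have hn' : (0 : ℝ) < n := by exact_mod_cast h
  unfold remLog
  rw [Finset.sum_sub_distrib, sum_log_Icc, sum_primeFactors_swap n (fun p _ => Real.log p)]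
  have h1 := log_fact_le n
  have h2 : n * Mert n - 2 * n ≤ ∑ p ∈ Nat.primesLE n, ∑ k ∈ Icc 1 (n / p), Real.log p := by
    have h3 := theta_nat_le n
    have : n * Mert n - ∑ p ∈ Nat.primesLE n, Real.log p ≤ ∑ p ∈ Nat.primesLE n, ∑ k ∈ Icc 1 (n / p), Real.log p := by
      rw [Mert, Finset.mul_sum, ← Finset.sum_sub_distrib]
      apply Finset.sum_le_sum
      intro p hp
      rw [Finset.sum_const, nsmul_eq_mul, Nat.card_Icc, Nat.add_sub_cancel]
      have h6 : (n : ℝ) / p < (n / p : ℕ) + 1 := by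
        rw [← Nat.floor_div_eq_div (K := ℝ)]; exact Nat.lt_floor_add_one _
      have := mul_le_mul_of_nonneg_right (show (n : ℝ) / p - 1 ≤ (n / p : ℕ) by linarith) (log_p_nonneg p)
      calc _ = ((n : ℝ) / p - 1) * Real.log p := by ring
        _ ≤ _ := this
    linarith
  have h4 := abs_le.1 (hCb n h)
  nlinarith

end Erd

namespace Erd
open Finset

/-- Number of `1 ≤ m ≤ X` with `P m`. -/
noncomputable def cnt (P : ℕ → Prop) (X : ℝ) : ℝ :=
  open Classical in (((Icc 1 ⌊X⌋₊).filter P).card : ℝ)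

open Classical in
lemma cnt_eq_sum (P : ℕ → Prop) (X : ℝ) :
    cnt P X = ∑ m ∈ Icc 1 ⌊X⌋₊, if P m then (1 : ℝ) else 0 := by
  simp [cnt, Finset.sum_boole]

lemma cnt_nonneg (P : ℕ → Prop) (X : ℝ) : 0 ≤ cnt P X := by unfold cnt; positivity

lemma cnt_mono {P Q : ℕ → Prop} {X : ℝ} (h : ∀ m : ℕ, 1 ≤ m → (m : ℝ) ≤ X → P m → Q m) :
    cnt P X ≤ cnt Q X := by
  classical
  unfold cnt
  norm_cast
  apply Finset.card_le_card
  intro m hm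
  simp only [mem_filter, Finset.mem_Icc] at hm ⊢
  refine ⟨hm.1, h m hm.1.1 ?_ hm.2⟩
  exact (Nat.le_floor_iff' (by omega)).1 hm.1.2

lemma cnt_congr {P Q : ℕ → Prop} {X : ℝ} (h : ∀ m : ℕ, 1 ≤ m → (m : ℝ) ≤ X → (P m ↔ Q m)) :
    cnt P X = cnt Q X :=
  le_antisymm (cnt_mono fun m a b => (h m a b).1) (cnt_mono fun m a b => (h m a b).2)

lemma cnt_le (P : ℕ → Prop) {X : ℝ} (hX : 0 ≤ X) : cnt P X ≤ X := by
  classical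
  unfold cnt
  calc (((Icc 1 ⌊X⌋₊).filter P).card : ℝ) ≤ ((Icc 1 ⌊X⌋₊).card : ℝ) := by
        exact_mod_cast Finset.card_filter_le _ _
    _ = ⌊X⌋₊ := by simp
    _ ≤ X := Nat.floor_le hX

lemma cnt_or_le (P Q : ℕ → Prop) (X : ℝ) : cnt (fun m => P m ∨ Q m) X ≤ cnt P X + cnt Q X := by
  classical
  rw [cnt_eq_sum, cnt_eq_sum, cnt_eq_sum, ← Finset.sum_add_distrib]
  apply Finset.sum_le_sum
  intro m _
  by_cases h1 : P m <;> by_cases h2 : Q m <;> simp [h1, h2]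

lemma cnt_mono_X (P : ℕ → Prop) {X Y : ℝ} (h : X ≤ Y) : cnt P X ≤ cnt P Y := by
  classical
  unfold cnt
  norm_cast
  apply Finset.card_le_card
  apply Finset.filter_subset_filter
  exact Finset.Icc_subset_Icc_right (Nat.floor_mono h)

lemma cnt_not (P : ℕ → Prop) (X : ℝ) : cnt (fun m => ¬ P m) X = ⌊X⌋₊ - cnt P X := by
  classical
  have : (⌊X⌋₊ : ℝ) = ∑ m ∈ Icc 1 ⌊X⌋₊, (1 : ℝ) := by simp
  rw [cnt_eq_sum, cnt_eq_sum, this, ← Finset.sum_sub_distrib]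
  apply Finset.sum_congr rfl
  intro m _
  by_cases h1 : P m <;> simp [h1]

/-- Recursion, lower. -/
lemma rec_lower (P : ℕ → Prop) (X : ℝ) :
    ∑ p ∈ Nat.primesLE ⌊X⌋₊, Real.log p * cnt (fun k => P (p * k)) (X / p) ≤
      Real.log X * cnt P X := by
  classical
  have h := sum_primeFactors_swap ⌊X⌋₊ (fun p m => if P m then Real.log p else 0)
  have h1 : ∀ p ∈ Nat.primesLE ⌊X⌋₊, Real.log p * cnt (fun k => P (p * k)) (X / p) =
      ∑ k ∈ Icc 1 (⌊X⌋₊ / p), if P (p * k) then Real.log p else 0 := by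
    intro p _
    rw [cnt_eq_sum, Nat.floor_div_natCast, Finset.mul_sum]
    apply Finset.sum_congr rfl
    intro k _; split_ifs <;> simp
  rw [Finset.sum_congr rfl h1, ← h, cnt_eq_sum, Finset.mul_sum]
  apply Finset.sum_le_sum
  intro m hm
  rw [Finset.mem_Icc] at hm
  split_ifs
  · rw [mul_one]
    refine (sum_primeFactors_log_le m (by omega)).trans ?_
    apply Real.log_le_log (by exact_mod_cast hm.1)
    exact (Nat.le_floor_iff' (by omega)).1 hm.2
  · simp

lemma rec_upper : ∃ C : ℝ, 0 < C ∧ ∀ (P : ℕ → Prop) (X : ℝ), 1 ≤ X →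
    Real.log X * cnt P X ≤
    ∑ p ∈ Nat.primesLE ⌊X⌋₊, Real.log p * cnt (fun k => P (p * k)) (X / p) + C * X := by
  classical
  obtain ⟨C, hC, hCb⟩ := sum_remLog_le
  refine ⟨C + 2, by linarith, fun P X hX => ?_⟩
  have h := sum_primeFactors_swap ⌊X⌋₊ (fun p m => if P m then Real.log p else 0)
  have h1 : ∀ p ∈ Nat.primesLE ⌊X⌋₊, Real.log p * cnt (fun k => P (p * k)) (X / p) =
      ∑ k ∈ Icc 1 (⌊X⌋₊ / p), if P (p * k) then Real.log p else 0 := by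
    intro p _
    rw [cnt_eq_sum, Nat.floor_div_natCast, Finset.mul_sum]
    apply Finset.sum_congr rfl
    intro k _; split_ifs <;> simp
  rw [Finset.sum_congr rfl h1, ← h, cnt_eq_sum, Finset.mul_sum]
  have hN : 1 ≤ ⌊X⌋₊ := Nat.one_le_floor_iff _ |>.2 hX
  have hN' : (1 : ℝ) ≤ ⌊X⌋₊ := by exact_mod_cast hN
  have hNX : (⌊X⌋₊ : ℝ) ≤ X := Nat.floor_le (by linarith)
  have hXN : X ≤ 2 * ⌊X⌋₊ := by have := Nat.lt_floor_add_one X; linarith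
  have key : ∑ m ∈ Icc 1 ⌊X⌋₊, (Real.log X * (if P m then (1 : ℝ) else 0)) ≤
      ∑ m ∈ Icc 1 ⌊X⌋₊, ((∑ p ∈ m.primeFactors, if P m then Real.log p else 0) + remLog m +
        (Real.log X - Real.log m)) := by
    apply Finset.sum_le_sum
    intro m hm
    rw [Finset.mem_Icc] at hm
    have a1 := remLog_nonneg m (by omega)
    have a2 : Real.log m ≤ Real.log X := by
      apply Real.log_le_log (by exact_mod_cast hm.1)
      exact (Nat.le_floor_iff' (by omega)).1 hm.2
    split_ifs
    · unfold remLog; linarith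
    · simp; linarith
  refine key.trans ?_
  rw [Finset.sum_add_distrib, Finset.sum_add_distrib, Finset.sum_sub_distrib, sum_log_Icc]
  have b1 := hCb ⌊X⌋₊
  have b2 := le_log_fact ⌊X⌋₊
  simp only [sum_const, Nat.card_Icc, Nat.add_sub_cancel, nsmul_eq_mul]
  have b3 : Real.log X ≤ Real.log ⌊X⌋₊ + 1 := by
    have : Real.log X ≤ Real.log (2 * ⌊X⌋₊) := Real.log_le_log (by linarith) hXN
    rw [Real.log_mul (by norm_num) (by positivity)] at this
    have := Real.log_two_lt_d9
    linarith
  have b4 : (⌊X⌋₊ : ℝ) * Real.log X ≤ ⌊X⌋₊ * (Real.log ⌊X⌋₊ + 1) := by gcongr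
  nlinarith

lemma mert_succ (n : ℕ) : Mert (n + 1) = Mert n + (if (n + 1).Prime then Real.log ((n + 1 : ℕ) : ℝ) / ((n + 1 : ℕ) : ℝ) else 0) := by
  unfold Mert
  rw [Nat.primesLE_eq_filter_Icc_one, Nat.primesLE_eq_filter_Icc_one, Finset.sum_filter,
    Finset.sum_filter, Finset.sum_Icc_succ_top (by omega)]

lemma log_sub_log_ge {a b : ℝ} (ha : 0 < a) (hab : a ≤ b) : (b - a) / b ≤ Real.log b - Real.log a := by
  have hb : 0 < b := by linarith
  have := Real.log_le_sub_one_of_pos (x := a / b) (by positivity)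
  rw [Real.log_div ha.ne' hb.ne'] at this
  have e : (b - a) / b = 1 - a / b := by field_simp
  linarith

lemma recip_nat : ∃ C : ℝ, 0 < C ∧ ∀ U V : ℕ, 2 ≤ U → U ≤ V →
    ∑ p ∈ (Icc (U + 1) V).filter Nat.Prime, (1 : ℝ) / p ≤
      Real.log (Real.log V) - Real.log (Real.log U) + C / Real.log U := by
  obtain ⟨C, hC, hCb⟩ := mert_bound_nat
  refine ⟨2 * C, by linarith, fun U V hU hUV => ?_⟩
  have hU' : (2 : ℝ) ≤ U := by exact_mod_cast hU
  have hlogU : 0 < Real.log U := Real.log_pos (by linarith)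
  suffices h : ∑ p ∈ (Icc (U + 1) V).filter Nat.Prime, (1 : ℝ) / p ≤
      Real.log (Real.log V) - Real.log (Real.log U) + 2 * C / Real.log U +
        (Mert V - Real.log V - C) / Real.log V by
    have hV : (U : ℝ) ≤ V := by exact_mod_cast hUV
    have h1 := abs_le.1 (hCb V (by omega))
    have : (Mert V - Real.log V - C) / Real.log V ≤ 0 := by
      apply div_nonpos_of_nonpos_of_nonneg (by linarith) (Real.log_nonneg (by linarith))
    linarith
  induction V, hUV using Nat.le_induction with
  | base =>
    simp only [Finset.Icc_eq_empty (show ¬ (U + 1 ≤ U) by omega), filter_empty, sum_empty, sub_self, zero_add]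
    have h1 := abs_le.1 (hCb U (by omega))
    rw [← add_div]
    apply div_nonneg (by linarith) hlogU.le
  | succ V hUV ih =>
    have hV : (U : ℝ) ≤ V := by exact_mod_cast hUV
    have hlogV : 0 < Real.log V := Real.log_pos (by linarith)
    have hll : Real.log V ≤ Real.log ((V + 1 : ℕ) : ℝ) :=
      Real.log_le_log (by linarith) (by push_cast; linarith)
    have hlogV1 : 0 < Real.log ((V + 1 : ℕ) : ℝ) := by linarith
    rw [Finset.sum_filter, Finset.sum_Icc_succ_top (by omega), ← Finset.sum_filter]
    rw [mert_succ]
    set b := Real.log ((V + 1 : ℕ) : ℝ) with hb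
    set a := Real.log (V : ℝ) with ha
    have h1 := abs_le.1 (hCb V (by omega))
    have h2 := log_sub_log_ge hlogV hll
    have hVp : (0 : ℝ) < ((V + 1 : ℕ) : ℝ) := by positivity
    set t : ℝ := if (V + 1).Prime then (1 : ℝ) / ((V + 1 : ℕ) : ℝ) else 0 with ht
    have e : (if (V + 1).Prime then b / ((V + 1 : ℕ) : ℝ) else 0) = t * b := by
      rw [ht]; split_ifs
      · ring
      · simp
    rw [e]
    have e2 : (Mert V + t * b - b - C) / b = t + (Mert V - a - C) / b - (b - a) / b := by
      field_simp; ring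
    rw [e2]
    have h3 : (Mert V - a - C) / a ≤ (Mert V - a - C) / b := by
      rw [div_le_div_iff₀ hlogV hlogV1]
      nlinarith
    linarith

/-- primes in `(u, v]` -/
noncomputable def PI (u v : ℝ) : Finset ℕ := (Nat.primesLE ⌊v⌋₊).filter (fun p => u < (p : ℝ))

lemma mem_PI {u v : ℝ} {p : ℕ} : p ∈ PI u v ↔ p.Prime ∧ u < p ∧ (p : ℝ) ≤ v := by
  unfold PI
  rw [mem_filter, Nat.mem_primesLE]
  constructor
  · rintro ⟨⟨a, b⟩, c⟩
    exact ⟨b, c, (Nat.le_floor_iff' b.pos.ne').1 a⟩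
  · rintro ⟨a, b, c⟩
    exact ⟨⟨(Nat.le_floor_iff' a.pos.ne').2 c, a⟩, b⟩

lemma recip_real : ∃ C : ℝ, 0 < C ∧ ∀ u v : ℝ, 2 ≤ u → u ≤ v →
    ∑ p ∈ PI u v, (1 : ℝ) / p ≤
      Real.log (Real.log v) - Real.log (Real.log u) + C / Real.log u := by
  obtain ⟨C, hC, hCb⟩ := recip_nat
  refine ⟨2 * C + 2, by linarith, fun u v hu huv => ?_⟩
  have hU : 2 ≤ ⌊u⌋₊ := by rw [Nat.le_floor_iff (by linarith)]; exact_mod_cast hu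
  have hV : ⌊u⌋₊ ≤ ⌊v⌋₊ := Nat.floor_mono huv
  have h := hCb _ _ hU hV
  have hU' : (2 : ℝ) ≤ ⌊u⌋₊ := by exact_mod_cast hU
  have hV' : (⌊u⌋₊ : ℝ) ≤ ⌊v⌋₊ := by exact_mod_cast hV
  have hul := Nat.floor_le (show 0 ≤ u by linarith)
  have hvl := Nat.floor_le (show 0 ≤ v by linarith)
  have huu := Nat.lt_floor_add_one u
  have e : ∑ p ∈ PI u v, (1 : ℝ) / p ≤
      ∑ p ∈ (Icc (⌊u⌋₊ + 1) ⌊v⌋₊).filter Nat.Prime, (1 : ℝ) / p := by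
    apply Finset.sum_le_sum_of_subset_of_nonneg
    · intro p hp
      rw [mem_PI] at hp
      rw [mem_filter, Finset.mem_Icc]
      refine ⟨⟨?_, (Nat.le_floor_iff (by linarith)).2 hp.2.2⟩, hp.1⟩
      have : (⌊u⌋₊ : ℝ) < p := by linarith
      exact_mod_cast this
    · intros; positivity
  have l1 : 0 < Real.log ⌊u⌋₊ := Real.log_pos (by linarith)
  have l2 : Real.log u ≤ 2 * Real.log ⌊u⌋₊ := by
    have : Real.log u ≤ Real.log ((⌊u⌋₊ : ℝ) ^ 2) := Real.log_le_log (by linarith) (by nlinarith)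
    rw [Real.log_pow] at this; exact_mod_cast this
  have l0 : 0 < Real.log u := Real.log_pos (by linarith)
  have l3 : Real.log u ≤ Real.log ⌊u⌋₊ + 1 := by
    have : Real.log u ≤ Real.log (2 * ⌊u⌋₊) := Real.log_le_log (by linarith) (by linarith)
    rw [Real.log_mul (by norm_num) (by positivity)] at this
    have := Real.log_two_lt_d9
    linarith
  have l4 : Real.log (Real.log u) ≤ Real.log (Real.log ⌊u⌋₊) + 1 / Real.log ⌊u⌋₊ := by
    have := Real.log_le_sub_one_of_pos (x := Real.log u / Real.log ⌊u⌋₊) (by positivity)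
    rw [Real.log_div l0.ne' l1.ne'] at this
    have h5 : Real.log u / Real.log ⌊u⌋₊ ≤ 1 + 1 / Real.log ⌊u⌋₊ := by
      rw [div_le_iff₀ l1]; field_simp; linarith
    linarith
  have l5 : Real.log (Real.log ⌊v⌋₊) ≤ Real.log (Real.log v) := by
    apply Real.log_le_log (Real.log_pos (by linarith)) (Real.log_le_log (by linarith) hvl)
  have l6 : (C + 1) / Real.log ⌊u⌋₊ ≤ (2 * C + 2) / Real.log u := by
    rw [div_le_div_iff₀ l1 l0]; nlinarith
  have l7 : (C + 1) / Real.log ⌊u⌋₊ = C / Real.log ⌊u⌋₊ + 1 / Real.log ⌊u⌋₊ := by ring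
  linarith

lemma inv_one_sub_le {p : ℕ} (hp : p.Prime) :
    (1 - 1 / (p : ℝ))⁻¹ ≤ Real.exp (1 / p + 2 * (Real.log p / (p * (p - 1)))) := by
  have hp2 : (2 : ℝ) ≤ p := by exact_mod_cast hp.two_le
  have h1 : (1 - 1 / (p : ℝ))⁻¹ = 1 / (p - 1) + 1 := by
    have : (p : ℝ) - 1 ≠ 0 := by linarith
    have : 1 - 1 / (p : ℝ) = (p - 1) / p := by field_simp
    rw [this]; field_simp; ring
  rw [h1]
  refine (Real.add_one_le_exp _).trans ?_
  apply Real.exp_le_exp.2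
  have h2 : (1 : ℝ) / (p - 1) = 1 / p + 1 / (p * (p - 1)) := by
    have : (p : ℝ) - 1 ≠ 0 := by linarith
    field_simp; ring
  rw [h2]
  have h3 : (1 : ℝ) ≤ 2 * Real.log p := by
    have : Real.log 2 ≤ Real.log p := Real.log_le_log (by norm_num) hp2
    have := Real.log_two_gt_d9; linarith
  have h4 : (1 : ℝ) / (p * (p - 1)) ≤ 2 * (Real.log p / (p * (p - 1))) := by
    rw [← mul_div_assoc]
    apply div_le_div_of_nonneg_right h3
    nlinarith
  linarith

lemma one_sub_inv_pos {p : ℕ} (hp : p.Prime) : 0 < 1 - 1 / (p : ℝ) := by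
  have hp2 : (2 : ℝ) ≤ p := by exact_mod_cast hp.two_le
  have : 1 / (p : ℝ) ≤ 1 / 2 := by apply one_div_le_one_div_of_le <;> linarith
  linarith

lemma prod_PI_le : ∃ C : ℝ, 1 ≤ C ∧ ∀ u v : ℝ, 2 ≤ u → u ≤ v →
    ∏ p ∈ PI u v, (1 - 1 / (p : ℝ))⁻¹ ≤ C * (Real.log v / Real.log u) := by
  obtain ⟨C1, hC1, h1⟩ := recip_real
  obtain ⟨C2, hC2, h2⟩ := sum_log_div_sq_bdd
  refine ⟨Real.exp (2 * C1 + 2 * C2), Real.one_le_exp (by linarith), fun u v hu huv => ?_⟩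
  have lu : 0 < Real.log u := Real.log_pos (by linarith)
  have lv : 0 < Real.log v := Real.log_pos (by linarith)
  have lu2 : (1 : ℝ) / 2 ≤ Real.log u := by
    have : Real.log 2 ≤ Real.log u := Real.log_le_log (by norm_num) hu
    have := Real.log_two_gt_d9; linarith
  calc ∏ p ∈ PI u v, (1 - 1 / (p : ℝ))⁻¹
      ≤ ∏ p ∈ PI u v, Real.exp (1 / p + 2 * (Real.log p / (p * (p - 1)))) := by
        apply Finset.prod_le_prod
        · intro p hp; exact (inv_pos.2 (one_sub_inv_pos (mem_PI.1 hp).1)).le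
        · intro p hp; exact inv_one_sub_le (mem_PI.1 hp).1
    _ = Real.exp (∑ p ∈ PI u v, (1 : ℝ) / p + 2 * ∑ p ∈ PI u v, (Real.log p / (p * (p - 1)))) := by
        rw [← Real.exp_sum, Finset.sum_add_distrib, Finset.mul_sum]
    _ ≤ Real.exp ((2 * C1 + 2 * C2) + (Real.log (Real.log v) - Real.log (Real.log u))) := by
        apply Real.exp_le_exp.2
        have a1 := h1 u v hu huv
        have a2 : ∑ p ∈ PI u v, (Real.log p / ((p : ℝ) * (p - 1))) ≤ C2 := by
          refine le_trans ?_ (h2 ⌊v⌋₊)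
          apply Finset.sum_le_sum_of_subset_of_nonneg (Finset.filter_subset _ _)
          intro p hp _
          have : (2 : ℝ) ≤ p := by exact_mod_cast Nat.two_le_of_mem_primesLE hp
          apply div_nonneg (log_p_nonneg p); nlinarith
        have a3 : C1 / Real.log u ≤ 2 * C1 := by
          rw [div_le_iff₀ lu]; nlinarith
        linarith
    _ = _ := by
        rw [Real.exp_add, Real.exp_sub, Real.exp_log lv, Real.exp_log lu]

lemma prod_mono_set {s t : Finset ℕ} (f : ℕ → ℝ) (h : s ⊆ t) (h1 : ∀ i ∈ t, 1 ≤ f i) :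
    ∏ i ∈ s, f i ≤ ∏ i ∈ t, f i := by
  rw [← Finset.prod_sdiff h]
  have a : 1 ≤ ∏ i ∈ t \ s, f i := by
    rw [← Finset.prod_const_one (s := t \ s)]
    apply Finset.prod_le_prod
    · intros; norm_num
    · intro i hi; exact h1 i (Finset.sdiff_subset hi)
  have b : 0 ≤ ∏ i ∈ s, f i := Finset.prod_nonneg (fun i hi => by linarith [h1 i (h hi)])
  nlinarith

lemma one_le_inv_one_sub {p : ℕ} (hp : p.Prime) : 1 ≤ (1 - 1 / (p : ℝ))⁻¹ := by
  rw [one_le_inv₀ (one_sub_inv_pos hp)]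
  have : 0 ≤ 1 / (p : ℝ) := by positivity
  linarith

lemma prod_le : ∃ C : ℝ, 1 ≤ C ∧ ∀ v : ℝ, 2 ≤ v →
    ∏ p ∈ Nat.primesLE ⌊v⌋₊, (1 - 1 / (p : ℝ))⁻¹ ≤ C * Real.log v := by
  obtain ⟨C, hC, h⟩ := prod_PI_le
  refine ⟨C * 4, by linarith, fun v hv => ?_⟩
  have h2 := h 2 v le_rfl hv
  have lv : 0 < Real.log v := Real.log_pos (by linarith)
  have e : Nat.primesLE ⌊v⌋₊ ⊆ insert 2 (PI 2 v) := by
    intro p hp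
    rw [Nat.mem_primesLE] at hp
    rw [mem_insert, mem_PI]
    by_cases hp2 : p = 2
    · left; exact hp2
    · right
      refine ⟨hp.2, ?_, (Nat.le_floor_iff (by linarith)).1 hp.1⟩
      have := hp.2.two_le
      have : 2 < p := by omega
      exact_mod_cast this
  have hpr : ∀ p ∈ insert 2 (PI 2 v), p.Prime := by
    intro p hp
    rw [mem_insert] at hp
    rcases hp with rfl | hp
    · exact Nat.prime_two
    · exact (mem_PI.1 hp).1
  have h3 := prod_mono_set (fun p : ℕ => (1 - 1 / (p : ℝ))⁻¹) e
    (fun p hp => one_le_inv_one_sub (hpr p hp))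
  rw [Finset.prod_insert (by rw [mem_PI]; norm_num)] at h3
  have h4 : (1 - 1 / ((2 : ℕ) : ℝ))⁻¹ = 2 := by norm_num
  rw [h4] at h3
  have h5 : Real.log v / Real.log 2 ≤ 2 * Real.log v := by
    rw [div_le_iff₀ (Real.log_pos (by norm_num))]
    have := Real.log_two_gt_d9; nlinarith
  have h6 : C * (Real.log v / Real.log 2) ≤ C * (2 * Real.log v) := by gcongr
  linarith

/-- `n ↦ n^{-σ}` as a monoid hom. -/
noncomputable def powHom (σ : ℝ) : ℕ →* ℝ where
  toFun n := (n : ℝ) ^ (-σ)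
  map_one' := by simp
  map_mul' a b := by push_cast; exact Real.mul_rpow (by positivity) (by positivity)

lemma sum_le_euler {σ : ℝ} (hσ : 0 < σ) (s : Finset ℕ) (hs : ∀ p ∈ s, p.Prime)
    (F : Finset ℕ) (hF : ∀ m ∈ F, ∀ p, p.Prime → p ∣ m → p ∈ s) :
    ∑ m ∈ F, (m : ℝ) ^ (-σ) ≤ ∏ p ∈ s, (1 - (p : ℝ) ^ (-σ))⁻¹ := by
  have h := EulerProduct.summable_and_hasSum_factoredNumbers_prod_filter_prime_geometric
    (f := powHom σ) (by
      intro p hp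
      have : (1 : ℝ) < p := by exact_mod_cast hp.one_lt
      change ‖(p : ℝ) ^ (-σ)‖ < 1
      rw [Real.norm_of_nonneg (by positivity)]
      exact Real.rpow_lt_one_of_one_lt_of_neg this (by linarith)) s
  have hf : s.filter Nat.Prime = s := Finset.filter_true_of_mem hs
  rw [hf] at h
  have hmem : ∀ m ∈ F, m ∈ Nat.factoredNumbers s := by
    intro m hm
    rw [Nat.mem_factoredNumbers']
    exact hF m hm
  have h3 : ∑ m ∈ F, (Nat.factoredNumbers s).indicator (powHom σ) m ≤ _ :=
    sum_le_hasSum F (fun i _ => Set.indicator_nonneg (fun m _ => by change 0 ≤ (m : ℝ) ^ (-σ); positivity) i)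
      (hasSum_subtype_iff_indicator.1 h.2)
  refine le_trans (le_of_eq ?_) h3
  apply Finset.sum_congr rfl
  intro m hm
  rw [Set.indicator_of_mem (hmem m hm)]; rfl

end Erd

namespace Erd
open Finset

open Classical in
lemma sieve : ∃ C : ℝ, 0 < C ∧ ∀ (Q : ℕ → Prop) (X : ℝ), 2 ≤ X →
    cnt (fun n => ∀ p : ℕ, p.Prime → Q p → ¬ p ∣ n) X ≤ C * (X / Real.log X) *
      ∏ p ∈ (Nat.primesLE ⌊X⌋₊).filter (fun p => ¬ Q p), (1 - 1 / (p : ℝ))⁻¹ := by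
  obtain ⟨C, hC, h⟩ := rec_upper
  refine ⟨C + 2, by linarith, fun Q X hX => ?_⟩
  set P : ℕ → Prop := fun n => ∀ p, p.Prime → Q p → ¬ p ∣ n with hP
  set N := ⌊X⌋₊ with hN
  set Pp := ∏ p ∈ (Nat.primesLE N).filter (fun p => ¬ Q p), (1 - 1 / (p : ℝ))⁻¹ with hPp
  have hNX : (N : ℝ) ≤ X := Nat.floor_le (by linarith)
  have hlX : 0 < Real.log X := Real.log_pos (by linarith)
  have hPp1 : 1 ≤ Pp := by
    have := prod_mono_set (fun p : ℕ => (1 - 1 / (p : ℝ))⁻¹) (Finset.empty_subset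
      ((Nat.primesLE N).filter (fun p => ¬ Q p)))
      (fun p hp => one_le_inv_one_sub (Nat.prime_of_mem_primesLE (mem_filter.1 hp).1))
    rwa [Finset.prod_empty] at this
  have h1 := h P X (by linarith)
  have h2 : ∑ p ∈ Nat.primesLE N, Real.log p * cnt (fun k => P (p * k)) (X / p) ≤
      ∑ p ∈ Nat.primesLE N, ∑ k ∈ Icc 1 N, if p * k ≤ N ∧ P k then Real.log p else 0 := by
    apply Finset.sum_le_sum
    intro p hp
    have hp0 := (Nat.prime_of_mem_primesLE hp).pos
    rw [cnt_eq_sum, Nat.floor_div_natCast, Finset.mul_sum]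
    have hsub : Icc 1 (N / p) ⊆ Icc 1 N := Finset.Icc_subset_Icc_right (Nat.div_le_self _ _)
    refine le_trans ?_ (Finset.sum_le_sum_of_subset_of_nonneg hsub (fun k _ _ => by
      split_ifs
      · exact log_p_nonneg p
      · exact le_rfl))
    apply Finset.sum_le_sum
    intro k hk
    rw [Finset.mem_Icc] at hk
    have hk' : p * k ≤ N := by rw [mul_comm]; exact (Nat.le_div_iff_mul_le hp0).1 hk.2
    by_cases hPk : P (p * k)
    · have : P k := fun q hq hQ hd => hPk q hq hQ (Dvd.dvd.mul_left hd p)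
      simp [hPk, this, hk']
    · simp only [hPk, if_false, mul_zero]
      split_ifs
      · exact log_p_nonneg p
      · exact le_rfl
  rw [Finset.sum_comm] at h2
  have h3 : ∑ k ∈ Icc 1 N, ∑ p ∈ Nat.primesLE N, (if p * k ≤ N ∧ P k then Real.log p else 0) ≤
      ∑ k ∈ (Icc 1 N).filter P, 2 * N * ((k : ℝ) ^ (-(1 : ℝ))) := by
    rw [Finset.sum_filter]
    apply Finset.sum_le_sum
    intro k hk
    rw [Finset.mem_Icc] at hk
    have hk0 : (0 : ℝ) < k := by exact_mod_cast hk.1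
    by_cases hPk : P k
    · rw [if_pos hPk]
      simp only [hPk, and_true]
      rw [← Finset.sum_filter]
      have hle := theta_nat_le (N / k)
      have hs : (Nat.primesLE N).filter (fun p => p * k ≤ N) ⊆ Nat.primesLE (N / k) := by
        intro p hp
        rw [mem_filter, Nat.mem_primesLE] at hp
        rw [Nat.mem_primesLE]
        exact ⟨(Nat.le_div_iff_mul_le hk.1).2 hp.2, hp.1.2⟩
      have := Finset.sum_le_sum_of_subset_of_nonneg (f := fun p : ℕ => Real.log p) hs
        (fun p _ _ => log_p_nonneg p)
      have h5 : ((N / k : ℕ) : ℝ) ≤ N / k := Nat.cast_div_le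
      rw [Real.rpow_neg_one, mul_assoc, ← div_eq_mul_inv]
      linarith
    · rw [if_neg hPk]; simp [hPk]
  have h4 : ∑ k ∈ (Icc 1 N).filter P, ((k : ℝ) ^ (-(1 : ℝ))) ≤ Pp := by
    have := sum_le_euler (σ := 1) one_pos ((Nat.primesLE N).filter (fun p => ¬ Q p))
      (fun p hp => Nat.prime_of_mem_primesLE (mem_filter.1 hp).1) ((Icc 1 N).filter P) (by
        intro m hm p hp hd
        rw [mem_filter, Finset.mem_Icc] at hm
        rw [mem_filter, Nat.mem_primesLE]
        exact ⟨⟨(Nat.le_of_dvd (by omega) hd).trans hm.1.2, hp⟩, fun hQ => hm.2 p hp hQ hd⟩)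
    refine this.trans (le_of_eq ?_)
    apply Finset.prod_congr rfl
    intro p _
    rw [Real.rpow_neg_one, one_div]
  rw [← Finset.mul_sum] at h3
  have h6 : 2 * N * ∑ k ∈ (Icc 1 N).filter P, ((k : ℝ) ^ (-(1 : ℝ))) ≤ 2 * X * Pp := by
    have : 0 ≤ ∑ k ∈ (Icc 1 N).filter P, ((k : ℝ) ^ (-(1 : ℝ))) := Finset.sum_nonneg (fun k _ => by positivity)
    gcongr
  have h7 : Real.log X * cnt P X ≤ (C + 2) * X * Pp := by
    have : C * X ≤ C * X * Pp := le_mul_of_one_le_right (by positivity) hPp1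
    nlinarith
  calc cnt P X = (Real.log X * cnt P X) / Real.log X := by field_simp
    _ ≤ ((C + 2) * X * Pp) / Real.log X := by gcongr
    _ = _ := by ring

lemma rough_cnt : ∃ C : ℝ, 0 < C ∧ ∀ (y X : ℝ), 2 ≤ y → y ≤ X →
    cnt (fun n => ∀ p : ℕ, p.Prime → (p : ℝ) ≤ y → ¬ p ∣ n) X ≤ C * (X / Real.log y) := by
  obtain ⟨C, hC, h⟩ := sieve
  obtain ⟨C2, hC2, h2⟩ := prod_PI_le
  refine ⟨C * C2, by nlinarith, fun y X hy hyX => ?_⟩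
  have h1 := h (fun p => (p : ℝ) ≤ y) X (by linarith)
  have h3 := h2 y X hy hyX
  have ly : 0 < Real.log y := Real.log_pos (by linarith)
  have lX : 0 < Real.log X := Real.log_pos (by linarith)
  refine h1.trans ?_
  have e : (Nat.primesLE ⌊X⌋₊).filter (fun p : ℕ => ¬ (p : ℝ) ≤ y) = PI y X := by
    unfold PI
    apply Finset.filter_congr
    intro p _; exact not_le
  have e' : ∏ p ∈ (Nat.primesLE ⌊X⌋₊).filter (fun p : ℕ => ¬ (p : ℝ) ≤ y), (1 - 1 / (p : ℝ))⁻¹ =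
    ∏ p ∈ PI y X, (1 - 1 / (p : ℝ))⁻¹ := by rw [← e]
  calc _ = C * (X / Real.log X) * ∏ p ∈ PI y X, (1 - 1 / (p : ℝ))⁻¹ := by
        rw [← e']
    _ ≤ C * (X / Real.log X) * (C2 * (Real.log X / Real.log y)) := by
        have : 0 ≤ C * (X / Real.log X) := by have : 0 < X := by linarith
                                              positivity
        gcongr
    _ = _ := by field_simp

/-- Numbers up to `X` without prime factors in `(y,z]`. -/
lemma gap_cnt : ∃ C : ℝ, 0 < C ∧ ∀ (y z X : ℝ), 2 ≤ y → y ≤ z → z ≤ X →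
    cnt (fun n => ∀ p : ℕ, p.Prime → (y < p ∧ (p : ℝ) ≤ z) → ¬ p ∣ n) X ≤ C * X * (Real.log y / Real.log z) := by
  obtain ⟨C, hC, h⟩ := sieve
  obtain ⟨C2, hC2, h2⟩ := prod_PI_le
  obtain ⟨C3, hC3, h3⟩ := prod_le
  refine ⟨C * C2 * C3, by positivity, fun y z X hy hyz hzX => ?_⟩
  have h1 := h (fun p => y < p ∧ (p : ℝ) ≤ z) X (by linarith)
  have a2 := h2 z X (by linarith) hzX
  have a3 := h3 y hy
  have ly : 0 < Real.log y := Real.log_pos (by linarith)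
  have lz : 0 < Real.log z := Real.log_pos (by linarith)
  have lX : 0 < Real.log X := Real.log_pos (by linarith)
  have hX0 : 0 < X := by linarith
  refine h1.trans ?_
  have n1 : 0 ≤ ∏ p ∈ PI z X, (1 - 1 / (p : ℝ))⁻¹ :=
    Finset.prod_nonneg (fun p hp => by linarith [one_le_inv_one_sub (mem_PI.1 hp).1])
  have n2 : 0 ≤ ∏ p ∈ Nat.primesLE ⌊y⌋₊, (1 - 1 / (p : ℝ))⁻¹ :=
    Finset.prod_nonneg (fun p hp => by linarith [one_le_inv_one_sub (Nat.prime_of_mem_primesLE hp)])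
  classical
  have e : ∏ p ∈ (Nat.primesLE ⌊X⌋₊).filter (fun p : ℕ => ¬ (y < p ∧ (p : ℝ) ≤ z)), (1 - 1 / (p : ℝ))⁻¹ ≤
    (∏ p ∈ Nat.primesLE ⌊y⌋₊, (1 - 1 / (p : ℝ))⁻¹) * ∏ p ∈ PI z X, (1 - 1 / (p : ℝ))⁻¹ := by
    rw [← Finset.prod_union]
    · apply prod_mono_set
      · intro p hp
        rw [mem_filter, Nat.mem_primesLE] at hp
        rw [mem_union, Nat.mem_primesLE, mem_PI]
        by_cases hpy : (p : ℝ) ≤ y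
        · left; exact ⟨Nat.le_floor hpy, hp.1.2⟩
        · right
          push Not at hpy
          exact ⟨hp.1.2, by by_contra hh; exact hp.2 ⟨hpy, not_lt.1 hh⟩, (Nat.le_floor_iff (by linarith)).1 hp.1.1⟩
      · intro p hp
        rw [mem_union, Nat.mem_primesLE, mem_PI] at hp
        rcases hp with hp | hp
        · exact one_le_inv_one_sub hp.2
        · exact one_le_inv_one_sub hp.1
    · rw [Finset.disjoint_left]
      intro p hp hp'
      rw [Nat.mem_primesLE] at hp
      rw [mem_PI] at hp'
      have := (Nat.le_floor_iff (by linarith)).1 hp.1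
      linarith [hp'.2.1]
  calc _ ≤ C * (X / Real.log X) * ((∏ p ∈ Nat.primesLE ⌊y⌋₊, (1 - 1 / (p : ℝ))⁻¹) * ∏ p ∈ PI z X, (1 - 1 / (p : ℝ))⁻¹) := by
        apply mul_le_mul_of_nonneg_left _ (by positivity)
        refine le_trans (le_of_eq ?_) e
        congr!
    _ ≤ C * (X / Real.log X) * ((C3 * Real.log y) * (C2 * (Real.log X / Real.log z))) := by
        gcongr
    _ = _ := by field_simp

end Erd

namespace Erd
open Finset

/-- Ballot-type weights. -/
noncomputable def bal (γ : ℝ) (n k : ℕ) : ℝ :=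
  if k ≤ n then (k / n : ℝ) * (γ * n) ^ (n - k) / (n - k).factorial else 0

lemma bal_nonneg {γ : ℝ} (hγ : 0 ≤ γ) (n k : ℕ) : 0 ≤ bal γ n k := by
  unfold bal; split_ifs <;> positivity

lemma choose_sum1 (M : ℕ) (x : ℝ) :
    ∑ N ∈ range (M + 1), (M.choose N : ℝ) * x ^ (M - N) = (x + 1) ^ M := by
  rw [add_comm x 1, add_pow]
  apply Finset.sum_congr rfl
  intro N _
  simp; ring

lemma choose_sum2 (M : ℕ) (x : ℝ) :
    ∑ N ∈ range (M + 1), (M.choose N : ℝ) * x ^ (M - N) * ((M - N : ℕ) : ℝ) =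
      M * x * (x + 1) ^ (M - 1) := by
  rcases M with _ | M
  · simp
  · rw [Finset.sum_range_succ]
    simp only [Nat.sub_self, Nat.cast_zero, mul_zero, add_zero, Nat.add_sub_cancel]
    rw [← choose_sum1 M x, Finset.mul_sum]
    apply Finset.sum_congr rfl
    intro N hN
    have hN' : N ≤ M := by simp at hN; omega
    have h := Nat.choose_mul_succ_eq M N
    have h' : (M.choose N : ℝ) * (M + 1) = ((M + 1).choose N : ℝ) * ((M + 1 - N : ℕ) : ℝ) := by
      exact_mod_cast h
    have e : M + 1 - N = (M - N) + 1 := by omega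
    rw [e] at h' ⊢
    rw [pow_succ]
    push_cast at h' ⊢
    linear_combination (-(x ^ (M - N) * x)) * h'

lemma bal_rec {γ : ℝ} (hγ : 0 ≤ γ) (B n k : ℕ) (hn : 1 ≤ n) (hk : 1 ≤ k) :
    ∑ N ∈ range B, γ ^ N / N.factorial * bal γ n (k - 1 + N) ≤ bal γ (n + 1) k := by
  by_cases hkn : k ≤ n + 1
  swap
  · have : ∀ N ∈ range B, γ ^ N / N.factorial * bal γ n (k - 1 + N) = 0 := by
      intro N _
      unfold bal
      rw [if_neg (by omega), mul_zero]
    rw [Finset.sum_eq_zero this]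
    exact bal_nonneg hγ _ _
  obtain ⟨M, hM⟩ : ∃ M, n + 1 = k + M := ⟨n + 1 - k, by omega⟩
  have hn0 : (0 : ℝ) < n := by exact_mod_cast hn
  have h1 : ∑ N ∈ range B, γ ^ N / N.factorial * bal γ n (k - 1 + N) ≤
      ∑ N ∈ range (M + 1 + B), γ ^ N / N.factorial * bal γ n (k - 1 + N) := by
    apply Finset.sum_le_sum_of_subset_of_nonneg
    · intro x; simp; omega
    · intro N _ _
      have := bal_nonneg hγ n (k - 1 + N)
      positivity
  refine h1.trans (le_of_eq ?_)
  rw [Finset.sum_range_add]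
  have h2 : ∑ N ∈ range B, γ ^ (M + 1 + N) / (M + 1 + N).factorial * bal γ n (k - 1 + (M + 1 + N)) = 0 := by
    apply Finset.sum_eq_zero
    intro N _
    unfold bal
    rw [if_neg (by omega), mul_zero]
  rw [h2, add_zero]
  have h3 : ∀ N ∈ range (M + 1), γ ^ N / N.factorial * bal γ n (k - 1 + N) =
      γ ^ M / M.factorial * ((M.choose N : ℝ) * (n : ℝ) ^ (M - N) -
        (1 / n) * ((M.choose N : ℝ) * (n : ℝ) ^ (M - N) * ((M - N : ℕ) : ℝ))) := by
    intro N hN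
    have hN' : N ≤ M := by simp at hN; omega
    unfold bal
    rw [if_pos (by omega), show n - (k - 1 + N) = M - N by omega]
    have e1 : ((k - 1 + N : ℕ) : ℝ) = n - ((M - N : ℕ) : ℝ) := by
      rw [eq_sub_iff_add_eq]; norm_cast; omega
    rw [e1, Nat.cast_choose ℝ hN', mul_pow]
    have e2 : γ ^ M = γ ^ N * γ ^ (M - N) := by rw [← pow_add]; congr 1; omega
    rw [e2]
    have := Nat.factorial_pos M
    field_simp
  rw [Finset.sum_congr rfl h3, ← Finset.mul_sum, Finset.sum_sub_distrib, ← Finset.mul_sum,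
    choose_sum1, choose_sum2]
  unfold bal
  rw [if_pos hkn, show n + 1 - k = M by omega]
  have e1 : (k : ℝ) = (n + 1 : ℝ) - M := by
    rw [eq_sub_iff_add_eq]; exact_mod_cast hM.symm
  rw [e1, mul_pow]
  rcases M with _ | M
  · simp; field_simp
  · simp only [Nat.add_sub_cancel]
    push_cast
    field_simp
    ring

/-- walk predicate: ends at height exactly one. -/
def Wb (m : ℕ) : ℕ → ℕ → (ℕ → ℕ) → Prop
  | 0, k, _ => k = 1
  | n + 1, k, c => 1 ≤ k ∧ Wb m n (k - 1 + c (m + n)) c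

/-- walk predicate: stays at height at least one. -/
def St : ℕ → ℕ → (ℕ → ℕ) → Prop
  | 0, k, _ => 1 ≤ k
  | n + 1, k, c => 1 ≤ k ∧ St n (k - 1 + c n) c

lemma St_mono (c : ℕ → ℕ) : ∀ (n k k' : ℕ), k ≤ k' → St n k c → St n k' c
  | 0, k, k', h, hs => by simp only [St] at *; omega
  | n + 1, k, k', h, hs => by
    simp only [St] at *
    exact ⟨by omega, St_mono c n _ _ (by omega) hs.2⟩

lemma Wb_St (m : ℕ) (c : ℕ → ℕ) (hs : St m 1 c) : ∀ (n k : ℕ), Wb m n k c → St (m + n) k c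
  | 0, k, h => by simp only [Wb] at h; subst h; exact hs
  | n + 1, k, h => by
    simp only [Wb] at h
    exact ⟨h.1, Wb_St m c hs n _ h.2⟩

lemma exists_split (c : ℕ → ℕ) : ∀ v : ℕ, ∃ m n k, m + n = v ∧ 1 ≤ k ∧ k ≤ n + 1 ∧ Wb m n k c ∧ St m 1 c
  | 0 => ⟨0, 0, 1, rfl, le_rfl, by omega, rfl, le_rfl⟩
  | v + 1 => by
    obtain ⟨m, n, k, hv, hk1, hk2, hw, hs⟩ := exists_split c v
    by_cases h : c v ≤ k
    · refine ⟨m, n + 1, k + 1 - c v, by omega, by omega, by omega, ?_, hs⟩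
      refine ⟨by omega, ?_⟩
      rw [hv]
      have : k + 1 - c v - 1 + c v = k := by omega
      rw [this]; exact hw
    · refine ⟨v + 1, 0, 1, by omega, by omega, by omega, rfl, ?_⟩
      refine ⟨le_rfl, ?_⟩
      have h1 := Wb_St m c hs n k hw
      rw [hv] at h1
      exact St_mono c v _ _ (by omega) h1

lemma Wb_congr (m : ℕ) (c c' : ℕ → ℕ) : ∀ (n k : ℕ), (∀ i < m + n, c i = c' i) → (Wb m n k c ↔ Wb m n k c')
  | 0, k, _ => Iff.rfl
  | n + 1, k, h => by
    simp only [Wb]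
    rw [h (m + n) (by omega), Wb_congr m c c' n _ (fun i hi => h i (by omega))]

lemma St_congr (c c' : ℕ → ℕ) : ∀ (n k : ℕ), (∀ i < n, c i = c' i) → (St n k c ↔ St n k c')
  | 0, k, _ => Iff.rfl
  | n + 1, k, h => by
    simp only [St]
    rw [h n (by omega), St_congr c c' n _ (fun i hi => h i (by omega))]

/-- iterated block sum -/
noncomputable def SS (β : ℝ) (B : ℕ) : ℕ → ((ℕ → ℕ) → ℝ) → ℝ
  | 0, F => F (fun _ => 0)
  | v + 1, F => ∑ N ∈ range B, β ^ N / N.factorial * SS β B v (fun c => F (Function.update c v N))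

variable {β : ℝ} {B : ℕ}

lemma SS_mono (hβ : 0 ≤ β) : ∀ (v : ℕ) (F G : (ℕ → ℕ) → ℝ), (∀ c, F c ≤ G c) → SS β B v F ≤ SS β B v G
  | 0, F, G, h => h _
  | v + 1, F, G, h => by
    simp only [SS]
    apply Finset.sum_le_sum
    intro N _
    apply mul_le_mul_of_nonneg_left _ (by positivity)
    exact SS_mono hβ v _ _ (fun c => h _)

lemma SS_nonneg (hβ : 0 ≤ β) : ∀ (v : ℕ) (F : (ℕ → ℕ) → ℝ), (∀ c, 0 ≤ F c) → 0 ≤ SS β B v F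
  | 0, F, h => h _
  | v + 1, F, h => by
    simp only [SS]
    apply Finset.sum_nonneg
    intro N _
    exact mul_nonneg (by positivity) (SS_nonneg hβ v _ (fun c => h _))

lemma SS_mul : ∀ (v : ℕ) (a : ℝ) (F : (ℕ → ℕ) → ℝ), SS β B v (fun c => a * F c) = a * SS β B v F
  | 0, a, F => rfl
  | v + 1, a, F => by
    simp only [SS]
    rw [Finset.mul_sum]
    apply Finset.sum_congr rfl
    intro N _
    rw [SS_mul v a (fun c => F (Function.update c v N))]; ring

lemma SS_add : ∀ (v : ℕ) (F G : (ℕ → ℕ) → ℝ), SS β B v (fun c => F c + G c) = SS β B v F + SS β B v G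
  | 0, F, G => rfl
  | v + 1, F, G => by
    simp only [SS]
    rw [← Finset.sum_add_distrib]
    apply Finset.sum_congr rfl
    intro N _
    rw [SS_add v (fun c => F (Function.update c v N))]; ring

lemma SS_sum {ι : Type} (s : Finset ι) (v : ℕ) (F : ι → (ℕ → ℕ) → ℝ) :
    SS β B v (fun c => ∑ i ∈ s, F i c) = ∑ i ∈ s, SS β B v (F i) := by
  classical
  induction s using Finset.induction with
  | empty =>
    simp only [sum_empty]
    have := SS_mul (β := β) (B := B) v 0 (fun _ => 0)
    simpa using this
  | insert a s ha ih =>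
    simp only [sum_insert ha]
    rw [SS_add, ih]

open Classical in
lemma SS_top (hβ : 0 ≤ β) (m : ℕ) (G : (ℕ → ℕ) → ℝ) (hG0 : ∀ c, 0 ≤ G c)
    (hG : ∀ c c' : ℕ → ℕ, (∀ i < m, c i = c' i) → G c = G c') :
    ∀ n k : ℕ, SS β B (m + n) (fun c => if Wb m n k c then 2 ^ (∑ i ∈ Ico m (m + n), c i) * G c else 0) ≤
      bal (2 * β) (n + 1) k * SS β B m G
  | 0, k => by
    have h0 := SS_nonneg (B := B) hβ m G hG0
    by_cases hk : k = 1
    · subst hk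
      simp [Wb, bal]
    · have e : (fun c : ℕ → ℕ => if Wb m 0 k c then 2 ^ (∑ i ∈ Ico m (m + 0), c i) * G c else 0) =
          fun c => 0 * G c := by
        funext c; simp [Wb, hk]
      rw [e, SS_mul, zero_mul]
      exact mul_nonneg (bal_nonneg (by positivity) _ _) h0
  | n + 1, k => by
    have h0 := SS_nonneg (B := B) hβ m G hG0
    by_cases hk : 1 ≤ k
    swap
    · have e : (fun c : ℕ → ℕ => if Wb m (n + 1) k c then 2 ^ (∑ i ∈ Ico m (m + (n + 1)), c i) * G c else 0) =
          fun c => 0 * G c := by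
        funext c; simp [Wb, hk]
      rw [e, SS_mul, zero_mul]
      exact mul_nonneg (bal_nonneg (by positivity) _ _) h0
    have hr := bal_rec (γ := 2 * β) (by positivity) B (n + 1) k (by omega) hk
    refine le_trans ?_ (mul_le_mul_of_nonneg_right hr h0)
    rw [Finset.sum_mul]
    change SS β B (m + n + 1) _ ≤ _
    simp only [SS]
    apply Finset.sum_le_sum
    intro N _
    have ih := SS_top hβ m G hG0 hG n (k - 1 + N)
    have e : (fun c : ℕ → ℕ => if Wb m (n + 1) k (Function.update c (m + n) N) then
        (2 : ℝ) ^ (∑ i ∈ Ico m (m + (n + 1)), Function.update c (m + n) N i) * G (Function.update c (m + n) N) else 0) =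
        fun c => 2 ^ N * (if Wb m n (k - 1 + N) c then 2 ^ (∑ i ∈ Ico m (m + n), c i) * G c else 0) := by
      funext c
      have hc : ∀ i < m + n, Function.update c (m + n) N i = c i := by
        intro i hi; rw [Function.update_of_ne (by omega)]
      have w : Wb m (n + 1) k (Function.update c (m + n) N) ↔ Wb m n (k - 1 + N) c := by
        simp only [Wb, hk, true_and, Function.update_self]
        exact Wb_congr m _ _ n _ hc
      have g : G (Function.update c (m + n) N) = G c := hG _ _ (fun i hi => hc i (by omega))
      have s : ∑ i ∈ Ico m (m + (n + 1)), Function.update c (m + n) N i = (∑ i ∈ Ico m (m + n), c i) + N := by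
        rw [← add_assoc, Finset.sum_Ico_succ_top (by omega), Function.update_self]
        congr 1
        apply Finset.sum_congr rfl
        intro i hi
        rw [Finset.mem_Ico] at hi
        exact hc i hi.2
      rw [g, s]
      by_cases hw : Wb m n (k - 1 + N) c
      · rw [if_pos (w.2 hw), if_pos hw, pow_add]; ring
      · rw [if_neg (fun h => hw (w.1 h)), if_neg hw, mul_zero]
    rw [e, SS_mul]
    calc _ = (2 * β) ^ N / N.factorial * SS β B (m + n) (fun c => if Wb m n (k - 1 + N) c then 2 ^ (∑ i ∈ Ico m (m + n), c i) * G c else 0) := by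
          rw [mul_pow]; ring
      _ ≤ (2 * β) ^ N / N.factorial * (bal (2 * β) (n + 1) (k - 1 + N) * SS β B m G) := by
          gcongr
      _ = _ := by ring

/-- Lower-part sum -/
noncomputable def YY (β : ℝ) (B n k : ℕ) : ℝ :=
  open Classical in SS β B n (fun c => if St n k c then 1 else 0)

lemma YY_zero (k : ℕ) : YY β B 0 k = if 1 ≤ k then 1 else 0 := by
  unfold YY
  simp only [SS, St]
  by_cases h : 1 ≤ k <;> simp [h]

lemma YY_nonneg (hβ : 0 ≤ β) (n k : ℕ) : 0 ≤ YY β B n k := by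
  classical
  apply SS_nonneg hβ; intro c; split_ifs <;> norm_num

lemma YY_k0 (n : ℕ) : YY β B n 0 = 0 := by
  classical
  unfold YY
  have e : (fun c : ℕ → ℕ => if St n 0 c then (1 : ℝ) else 0) = fun c => 0 * (fun _ => (0 : ℝ)) c := by
    funext c
    cases n <;> simp [St]
  rw [e, SS_mul, zero_mul]

lemma YY_succ (n k : ℕ) (hk : 1 ≤ k) : YY β B (n + 1) k = ∑ N ∈ range B, β ^ N / N.factorial * YY β B n (k - 1 + N) := by
  classical
  unfold YY
  simp only [SS]
  apply Finset.sum_congr rfl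
  intro N _
  congr 2
  funext c
  have : St (n + 1) k (Function.update c n N) ↔ St n (k - 1 + N) c := by
    simp only [St, hk, true_and, Function.update_self]
    exact St_congr _ _ n _ (fun i hi => by rw [Function.update_of_ne (by omega)])
  by_cases h : St n (k - 1 + N) c
  · rw [if_pos (this.2 h), if_pos h]
  · rw [if_neg (fun h' => h (this.1 h')), if_neg h]

lemma sum_shift_le (hβ : 0 ≤ β) (g : ℕ → ℝ) (hg : ∀ n, 0 ≤ g n) :
    ∑ N ∈ range B, β ^ N / N.factorial * (N * g N) ≤ β * ∑ N ∈ range B, β ^ N / N.factorial * g (N + 1) := by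
  rcases B with _ | B
  · simp
  · rw [Finset.sum_range_succ']
    simp only [Nat.cast_zero, zero_mul, mul_zero, add_zero]
    rw [Finset.sum_range_succ, mul_add, Finset.mul_sum]
    have h1 : ∑ k ∈ range B, β ^ (k + 1) / (k + 1).factorial * (((k + 1 : ℕ) : ℝ) * g (k + 1)) =
        ∑ i ∈ range B, β * (β ^ i / i.factorial * g (i + 1)) := by
      apply Finset.sum_congr rfl
      intro k _
      rw [Nat.factorial_succ]; push_cast; field_simp; ring
    rw [h1]
    have := hg (B + 1)
    have : 0 ≤ β * (β ^ B / B.factorial * g (B + 1)) := by positivity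
    linarith

open Classical in
lemma SS_shift (hβ : 0 ≤ β) (i : ℕ) : ∀ n k : ℕ, i < n → 1 ≤ k →
    SS β B n (fun c => if St n k c then (c i : ℝ) else 0) ≤ β * YY β B n (k + 1)
  | 0, k, h, _ => by omega
  | n + 1, k, h, hk => by
    rw [YY_succ n (k + 1) (by omega)]
    simp only [SS]
    have hSt : ∀ N c, St (n + 1) k (Function.update c n N) ↔ St n (k - 1 + N) c := by
      intro N c
      simp only [St, hk, true_and, Function.update_self]
      exact St_congr _ _ n _ (fun i hi => by rw [Function.update_of_ne (by omega)])
    by_cases hi : i = n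
    · subst hi
      have e : ∀ N, (fun c : ℕ → ℕ => if St (i + 1) k (Function.update c i N) then ((Function.update c i N i : ℕ) : ℝ) else 0) =
          fun c => (N : ℝ) * (if St i (k - 1 + N) c then 1 else 0) := by
        intro N; funext c
        rw [Function.update_self]
        by_cases hs : St i (k - 1 + N) c
        · rw [if_pos ((hSt N c).2 hs), if_pos hs, mul_one]
        · rw [if_neg (fun h' => hs ((hSt N c).1 h')), if_neg hs, mul_zero]
      simp only [e, SS_mul]
      refine (sum_shift_le hβ (fun N => YY β B i (k - 1 + N)) (fun N => YY_nonneg hβ _ _)).trans ?_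
      apply le_of_eq
      congr 1
      apply Finset.sum_congr rfl
      intro N _
      have : k - 1 + (N + 1) = k + 1 - 1 + N := by omega
      rw [this]
    · have e : ∀ N, (fun c : ℕ → ℕ => if St (n + 1) k (Function.update c n N) then ((Function.update c n N i : ℕ) : ℝ) else 0) =
          fun c => (if St n (k - 1 + N) c then (c i : ℝ) else 0) := by
        intro N; funext c
        rw [Function.update_of_ne hi]
        by_cases hs : St n (k - 1 + N) c
        · rw [if_pos ((hSt N c).2 hs), if_pos hs]
        · rw [if_neg (fun h' => hs ((hSt N c).1 h')), if_neg hs]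
      simp only [e]
      rw [Finset.mul_sum]
      apply Finset.sum_le_sum
      intro N _
      rcases Nat.eq_zero_or_pos (k - 1 + N) with h0 | h0
      · rw [h0]
        have e0 : (fun c : ℕ → ℕ => if St n 0 c then (c i : ℝ) else 0) = fun c => 0 * (fun _ => (0 : ℝ)) c := by
          funext c
          cases n <;> simp [St]
        rw [e0, SS_mul, zero_mul, mul_zero]
        have := YY_nonneg (B := B) hβ n (k + 1 - 1 + N)
        positivity
      · have ih := SS_shift hβ i n (k - 1 + N) (by omega) h0
        have e3 : k - 1 + N + 1 = k + 1 - 1 + N := by omega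
        rw [e3] at ih
        calc _ ≤ β ^ N / N.factorial * (β * YY β B n (k + 1 - 1 + N)) := by gcongr
          _ = _ := by ring

/-- supersolution bound -/
lemma YY_super (hβ : 0 < β) : ∀ n k K : ℕ, k + n * B ≤ K →
    YY β B n k ≤ ∑ j ∈ Icc 1 K, (bal β (2 * j) j)⁻¹ * bal β (n + 2 * j) k
  | 0, k, K, h => by
    rw [YY_zero]
    have hnn : ∀ j ∈ Icc 1 K, 0 ≤ (bal β (2 * j) j)⁻¹ * bal β (0 + 2 * j) k := by
      intro j _
      exact mul_nonneg (inv_nonneg.2 (bal_nonneg hβ.le _ _)) (bal_nonneg hβ.le _ _)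
    split_ifs with hk
    · have hm : k ∈ Icc 1 K := by rw [Finset.mem_Icc]; omega
      refine le_trans (le_of_eq ?_) (Finset.single_le_sum hnn hm)
      have : 0 < bal β (2 * k) k := by
        unfold bal
        rw [if_pos (by omega)]
        have : (0 : ℝ) < k := by exact_mod_cast hk
        push_cast
        positivity
      rw [zero_add, inv_mul_cancel₀ this.ne']
    · exact Finset.sum_nonneg hnn
  | n + 1, k, K, h => by
    rcases Nat.eq_zero_or_pos k with hk | hk
    · subst hk
      rw [YY_k0]
      apply Finset.sum_nonneg
      intro j _
      exact mul_nonneg (inv_nonneg.2 (bal_nonneg hβ.le _ _)) (bal_nonneg hβ.le _ _)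
    rw [YY_succ n k hk]
    calc _ ≤ ∑ N ∈ range B, β ^ N / N.factorial * ∑ j ∈ Icc 1 K, (bal β (2 * j) j)⁻¹ * bal β (n + 2 * j) (k - 1 + N) := by
          apply Finset.sum_le_sum
          intro N hN
          rw [Finset.mem_range] at hN
          apply mul_le_mul_of_nonneg_left _ (by positivity)
          apply YY_super hβ
          have : (n + 1) * B = n * B + B := by ring
          omega
      _ = ∑ j ∈ Icc 1 K, (bal β (2 * j) j)⁻¹ * ∑ N ∈ range B, β ^ N / N.factorial * bal β (n + 2 * j) (k - 1 + N) := by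
          simp_rw [Finset.mul_sum]
          rw [Finset.sum_comm]
          apply Finset.sum_congr rfl; intro j _
          apply Finset.sum_congr rfl; intro N _
          ring
      _ ≤ _ := by
          apply Finset.sum_le_sum
          intro j hj
          rw [Finset.mem_Icc] at hj
          apply mul_le_mul_of_nonneg_left _ (inv_nonneg.2 (bal_nonneg hβ.le _ _))
          have := bal_rec hβ.le B (n + 2 * j) k (by omega) hk
          rwa [show n + 1 + 2 * j = n + 2 * j + 1 by ring]

end Erd

namespace Erd
open Finset

/-- `x^{3/2}` -/
noncomputable def q32 (n : ℕ) : ℝ := n * Real.sqrt n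

lemma q32_pos {n : ℕ} (h : 1 ≤ n) : 0 < q32 n := by
  have : (0 : ℝ) < n := by exact_mod_cast h
  unfold q32; positivity

lemma q32_mono {m n : ℕ} (h : m ≤ n) : q32 m ≤ q32 n := by
  have : (m : ℝ) ≤ n := by exact_mod_cast h
  unfold q32; gcongr

lemma pow_div_fact_le (n : ℕ) (hn : 1 ≤ n) : (n : ℝ) ^ n / n.factorial ≤ Real.exp 1 ^ n / Real.sqrt n := by
  have h := Stirling.le_factorial_stirling n
  have hn0 : (0 : ℝ) < n := by exact_mod_cast hn
  have h1 : Real.sqrt n ≤ Real.sqrt (2 * Real.pi * n) := by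
    apply Real.sqrt_le_sqrt
    have := Real.pi_gt_three
    nlinarith
  have h2 : Real.sqrt n * (n / Real.exp 1) ^ n ≤ n.factorial := by
    refine le_trans ?_ h
    gcongr
  rw [div_le_div_iff₀ (by positivity) (by positivity)]
  rw [div_pow] at h2
  have he : 0 < Real.exp 1 ^ n := by positivity
  have h3 : Real.exp 1 ^ n * (Real.sqrt n * (n ^ n / Real.exp 1 ^ n)) ≤ Real.exp 1 ^ n * n.factorial := by gcongr
  calc (n : ℝ) ^ n * Real.sqrt n = Real.exp 1 ^ n * (Real.sqrt n * (n ^ n / Real.exp 1 ^ n)) := by field_simp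
    _ ≤ _ := h3

lemma bal_le {γ : ℝ} (hγ : 0 ≤ γ) (n k : ℕ) (hn : 1 ≤ n) (hk : k ≤ n) :
    bal γ n k ≤ k * γ ^ (n - k) * Real.exp 1 ^ n / q32 n := by
  have hn0 : (0 : ℝ) < n := by exact_mod_cast hn
  unfold bal
  rw [if_pos hk]
  have h1 : (n : ℝ) ^ (n - k) / (n - k).factorial ≤ (n : ℝ) ^ n / n.factorial := by
    rw [div_le_div_iff₀ (by positivity) (by positivity)]
    have a := Nat.factorial_mul_descFactorial hk
    have b := Nat.descFactorial_le_pow n k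
    have c : (n.factorial : ℝ) ≤ (n - k).factorial * (n : ℝ) ^ k := by
      rw [← a]; push_cast; gcongr; exact_mod_cast b
    have e : (n : ℝ) ^ n = n ^ (n - k) * n ^ k := by rw [← pow_add]; congr 1; omega
    rw [e]
    calc (n : ℝ) ^ (n - k) * n.factorial ≤ n ^ (n - k) * ((n - k).factorial * (n : ℝ) ^ k) := by gcongr
      _ = _ := by ring
  have h2 := h1.trans (pow_div_fact_le n hn)
  calc (k / n : ℝ) * (γ * n) ^ (n - k) / (n - k).factorial
      = (k / n) * γ ^ (n - k) * ((n : ℝ) ^ (n - k) / (n - k).factorial) := by rw [mul_pow]; ring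
    _ ≤ (k / n) * γ ^ (n - k) * (Real.exp 1 ^ n / Real.sqrt n) := by gcongr
    _ = _ := by unfold q32; field_simp

lemma fact_le_exp (K : ℕ) (hK : 1 ≤ K) : (K.factorial : ℝ) * Real.exp 1 ^ K ≤ Real.exp 1 * K * (K : ℝ) ^ K := by
  induction K, hK using Nat.le_induction with
  | base => simp
  | succ K hK ih =>
    have hK0 : (0 : ℝ) < K := by exact_mod_cast hK
    have h1 : Real.exp 1 * (K : ℝ) ^ (K + 1) ≤ ((K + 1 : ℕ) : ℝ) ^ (K + 1) := by
      have h2 : (1 : ℝ) / (K + 1) ≤ Real.log ((K + 1) / K) := by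
        have := Real.log_le_sub_one_of_pos (x := (K : ℝ) / (K + 1)) (by positivity)
        have e : Real.log ((K + 1 : ℝ) / K) = - Real.log ((K : ℝ) / (K + 1)) := by
          rw [← Real.log_inv, inv_div]
        rw [e]
        have : (K : ℝ) / (K + 1) - 1 = - (1 / (K + 1)) := by field_simp; ring
        linarith
      have h3 : 1 ≤ ((K + 1 : ℕ) : ℝ) * Real.log ((K + 1) / K) := by
        push_cast
        calc (1 : ℝ) = (K + 1) * (1 / (K + 1)) := by field_simp
          _ ≤ _ := by gcongr
      have h4 : Real.exp 1 ≤ ((K + 1 : ℝ) / K) ^ (K + 1) := by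
        calc Real.exp 1 ≤ Real.exp (((K + 1 : ℕ) : ℝ) * Real.log ((K + 1) / K)) := Real.exp_le_exp.2 h3
          _ = _ := by rw [Real.exp_nat_mul, Real.exp_log (by positivity)]
      rw [div_pow, le_div_iff₀ (by positivity)] at h4
      exact_mod_cast h4
    rw [Nat.factorial_succ, pow_succ]
    push_cast at h1 ⊢
    calc ((K : ℝ) + 1) * K.factorial * (Real.exp 1 ^ K * Real.exp 1)
        = (K + 1) * Real.exp 1 * (K.factorial * Real.exp 1 ^ K) := by ring
      _ ≤ (K + 1) * Real.exp 1 * (Real.exp 1 * K * (K : ℝ) ^ K) := by gcongr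
      _ = (K + 1) * Real.exp 1 * (Real.exp 1 * (K : ℝ) ^ (K + 1)) := by ring
      _ ≤ (K + 1) * Real.exp 1 * ((K + 1 : ℝ) ^ (K + 1)) := by gcongr
      _ = _ := by ring

lemma l2_lo : (0.693 : ℝ) < Real.log 2 := by have := Real.log_two_gt_d9; linarith
lemma l2_hi : Real.log 2 < (0.6932 : ℝ) := by have := Real.log_two_lt_d9; linarith
lemma rho_lt : Real.exp 1 * Real.log 2 / 2 < 1 := by
  have h1 := Real.exp_one_lt_d9
  have h2 := l2_hi
  have h3 := l2_lo
  nlinarith [Real.exp_pos 1]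

lemma inv_bal_le (j : ℕ) (hj : 1 ≤ j) {β : ℝ} (hβ : 0 < β) :
    (bal β (2 * j) j)⁻¹ ≤ 2 * Real.exp 1 * j * ((2 * Real.exp 1 * β) ^ j)⁻¹ := by
  have hj0 : (0 : ℝ) < j := by exact_mod_cast hj
  have e : bal β (2 * j) j = (1 / 2) * (2 * β * j) ^ j / j.factorial := by
    unfold bal
    rw [if_pos (by omega), show 2 * j - j = j by omega]
    push_cast
    have : (j : ℝ) / (2 * j) = 1 / 2 := by field_simp
    rw [this]; congr 3; ring
  rw [e]
  have h := fact_le_exp j hj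
  have h2 : (j.factorial : ℝ) ≤ Real.exp 1 * j * (j : ℝ) ^ j / Real.exp 1 ^ j := by
    rw [le_div_iff₀ (by positivity)]; exact h
  calc ((1 / 2) * (2 * β * j) ^ j / (j.factorial : ℝ))⁻¹ = 2 * j.factorial / (2 * β * j) ^ j := by
        field_simp
    _ ≤ 2 * (Real.exp 1 * j * (j : ℝ) ^ j / Real.exp 1 ^ j) / (2 * β * j) ^ j := by gcongr
    _ = _ := by
        rw [mul_pow, mul_pow, mul_pow, mul_pow]; field_simp

lemma summable_jr {r : ℝ} (h0 : 0 ≤ r) (h1 : r < 1) : Summable (fun j : ℕ => (j : ℝ) * r ^ j) := by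
  have := summable_pow_mul_geometric_of_norm_lt_one (R := ℝ) 1 (r := r) (by rwa [Real.norm_of_nonneg h0])
  simpa using this

lemma YY_bound : ∃ C : ℝ, 0 < C ∧ ∀ B n k : ℕ, k ≤ 2 →
    YY (Real.log 2) B n k ≤ C * (Real.exp 1 * Real.log 2) ^ n / q32 (n + 1) := by
  set β := Real.log 2 with hβ
  have hβ0 : 0 < β := by have := l2_lo; linarith
  have hβ1 : β ≤ 1 := by have := l2_hi; linarith
  have hs := summable_jr (r := Real.exp 1 * β / 2) (by positivity) rho_lt
  set S := ∑' j : ℕ, (j : ℝ) * (Real.exp 1 * β / 2) ^ j with hS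
  have hS0 : 0 ≤ S := tsum_nonneg (fun j => by positivity)
  refine ⟨4 * Real.exp 1 * (β ^ 2)⁻¹ * (S + 1), by positivity, fun B n k hk => ?_⟩
  have hq := q32_pos (n := n + 1) (by omega)
  refine (YY_super hβ0 n k (k + n * B) le_rfl).trans ?_
  have key : ∀ j ∈ Icc 1 (k + n * B), (bal β (2 * j) j)⁻¹ * bal β (n + 2 * j) k ≤
      (4 * Real.exp 1 * (β ^ 2)⁻¹ * (Real.exp 1 * β) ^ n / q32 (n + 1)) * ((j : ℝ) * (Real.exp 1 * β / 2) ^ j) := by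
    intro j hj
    rw [Finset.mem_Icc] at hj
    have h1 := inv_bal_le j hj.1 hβ0
    have h2 := bal_le hβ0.le (n + 2 * j) k (by omega) (by omega)
    have h3 : β ^ (n + 2 * j - k) ≤ (β ^ 2)⁻¹ * β ^ (n + 2 * j) := by
      rw [le_inv_mul_iff₀ (by positivity), ← pow_add]
      apply pow_le_pow_of_le_one hβ0.le hβ1; omega
    have h4 : bal β (n + 2 * j) k ≤ 2 * ((β ^ 2)⁻¹ * β ^ (n + 2 * j)) * Real.exp 1 ^ (n + 2 * j) / q32 (n + 1) := by
      refine h2.trans ?_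
      have : (k : ℝ) ≤ 2 := by exact_mod_cast hk
      have := q32_mono (show n + 1 ≤ n + 2 * j by omega)
      gcongr
    have hb := bal_nonneg hβ0.le (n + 2 * j) k
    calc (bal β (2 * j) j)⁻¹ * bal β (n + 2 * j) k ≤
        (2 * Real.exp 1 * j * ((2 * Real.exp 1 * β) ^ j)⁻¹) * (2 * ((β ^ 2)⁻¹ * β ^ (n + 2 * j)) * Real.exp 1 ^ (n + 2 * j) / q32 (n + 1)) := by
          apply mul_le_mul h1 h4 hb (by positivity)
      _ = _ := by
          rw [div_pow, mul_pow, mul_pow, mul_pow, mul_pow, pow_add, pow_add, pow_mul, pow_mul,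
            ]
          field_simp
          ring
  refine (Finset.sum_le_sum key).trans ?_
  rw [← Finset.mul_sum]
  have h5 := hs.sum_le_tsum (Icc 1 (k + n * B)) (fun i _ => by positivity)
  calc _ ≤ (4 * Real.exp 1 * (β ^ 2)⁻¹ * (Real.exp 1 * β) ^ n / q32 (n + 1)) * (S + 1) := by
        apply mul_le_mul_of_nonneg_left (by linarith) (by positivity)
    _ = _ := by ring

lemma bb_bound : ∃ C : ℝ, 0 < C ∧ ∀ n : ℕ,
    ∑ k ∈ Icc 1 (n + 1), bal (2 * Real.log 2) (n + 1) k ≤ C * (2 * Real.exp 1 * Real.log 2) ^ n / q32 (n + 1) := by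
  set β := Real.log 2 with hβ
  have hβ0 : 0 < β := by have := l2_lo; linarith
  have hβ1 : 1 < 2 * β := by have := l2_lo; linarith
  have hs := summable_jr (r := (2 * β)⁻¹) (by positivity) (inv_lt_one_of_one_lt₀ hβ1)
  set S := ∑' j : ℕ, (j : ℝ) * ((2 * β)⁻¹) ^ j with hS
  have hS0 : 0 ≤ S := tsum_nonneg (fun j => by positivity)
  refine ⟨(2 * Real.exp 1 * β) * (S + 1), by positivity, fun n => ?_⟩
  have hq := q32_pos (n := n + 1) (by omega)
  have key : ∀ k ∈ Icc 1 (n + 1), bal (2 * β) (n + 1) k ≤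
      ((2 * β) ^ (n + 1) * Real.exp 1 ^ (n + 1) / q32 (n + 1)) * ((k : ℝ) * ((2 * β)⁻¹) ^ k) := by
    intro k hk
    rw [Finset.mem_Icc] at hk
    refine (bal_le (by positivity) (n + 1) k (by omega) hk.2).trans (le_of_eq ?_)
    have : (2 * β) ^ (n + 1) = (2 * β) ^ (n + 1 - k) * (2 * β) ^ k := by
      rw [← pow_add]; congr 1; omega
    rw [this, inv_pow]
    field_simp
  refine (Finset.sum_le_sum key).trans ?_
  rw [← Finset.mul_sum]
  have h5 := hs.sum_le_tsum (Icc 1 (n + 1)) (fun i _ => by positivity)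
  calc _ ≤ ((2 * β) ^ (n + 1) * Real.exp 1 ^ (n + 1) / q32 (n + 1)) * (S + 1) := by
        apply mul_le_mul_of_nonneg_left (by linarith) (by positivity)
    _ = _ := by rw [mul_pow, mul_pow, mul_pow]; ring

lemma conv_bound : ∃ C : ℝ, 0 < C ∧ ∀ v : ℕ,
    ∑ p ∈ antidiagonal v, (q32 (p.1 + 1))⁻¹ * (q32 (p.2 + 1))⁻¹ ≤ C / q32 (v + 1) := by
  have hs : Summable (fun n : ℕ => (q32 (n + 1))⁻¹) := by
    have h := (Real.summable_nat_rpow_inv (p := 3 / 2)).2 (by norm_num)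
    have h' := (summable_nat_add_iff 1).2 h
    refine h'.congr (fun n => ?_)
    congr 1
    have h0 : (0 : ℝ) < ((n + 1 : ℕ) : ℝ) := by positivity
    unfold q32
    rw [Real.sqrt_eq_rpow, show (3 : ℝ) / 2 = 1 + 1 / 2 by norm_num, Real.rpow_add h0, Real.rpow_one]
  set S := ∑' n : ℕ, (q32 (n + 1))⁻¹ with hS
  have hnn : ∀ n : ℕ, 0 ≤ (q32 (n + 1))⁻¹ := fun n => (inv_pos.2 (q32_pos (by omega))).le
  have hS0 : 0 ≤ S := tsum_nonneg hnn
  refine ⟨8 * S + 1, by positivity, fun v => ?_⟩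
  have hq := q32_pos (n := v + 1) (by omega)
  have half : ∀ m : ℕ, v ≤ 2 * m + 1 → (q32 (m + 1))⁻¹ ≤ 4 / q32 (v + 1) := by
    intro m hm
    rw [inv_le_comm₀ (q32_pos (by omega)) (by positivity), inv_div, div_le_iff₀ (by norm_num)]
    unfold q32
    have h1 : ((v + 1 : ℕ) : ℝ) ≤ 2 * ((m + 1 : ℕ) : ℝ) := by exact_mod_cast (by omega)
    have h2 : Real.sqrt ((v + 1 : ℕ) : ℝ) ≤ 2 * Real.sqrt ((m + 1 : ℕ) : ℝ) := by
      rw [Real.sqrt_le_left (by positivity), mul_pow, Real.sq_sqrt (by positivity)]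
      have : (0 : ℝ) ≤ ((m + 1 : ℕ) : ℝ) := by positivity
      linarith
    calc _ ≤ (2 * ((m + 1 : ℕ) : ℝ)) * (2 * Real.sqrt ((m + 1 : ℕ) : ℝ)) := by gcongr
      _ = _ := by ring
  have key : ∀ p ∈ antidiagonal v, (q32 (p.1 + 1))⁻¹ * (q32 (p.2 + 1))⁻¹ ≤
      4 / q32 (v + 1) * ((q32 (p.1 + 1))⁻¹ + (q32 (p.2 + 1))⁻¹) := by
    intro p hp
    rw [Finset.HasAntidiagonal.mem_antidiagonal] at hp
    have a := hnn p.1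
    have b := hnn p.2
    have c : 0 ≤ 4 / q32 (v + 1) := by positivity
    rcases le_total p.1 p.2 with h | h
    · have := half p.2 (by omega)
      nlinarith
    · have := half p.1 (by omega)
      nlinarith
  refine (Finset.sum_le_sum key).trans ?_
  rw [← Finset.mul_sum, Finset.sum_add_distrib]
  have s1 : ∑ p ∈ antidiagonal v, (q32 (p.1 + 1))⁻¹ ≤ S := by
    rw [Finset.Nat.sum_antidiagonal_eq_sum_range_succ_mk]
    exact hs.sum_le_tsum _ (fun i _ => hnn i)
  have s2 : ∑ p ∈ antidiagonal v, (q32 (p.2 + 1))⁻¹ ≤ S := by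
    rw [← Finset.Nat.sum_antidiagonal_swap]; exact s1
  calc _ ≤ 4 / q32 (v + 1) * (S + S) := by gcongr
    _ ≤ _ := by
      rw [div_mul_eq_mul_div]
      apply div_le_div_of_nonneg_right _ hq.le
      linarith

open Classical in
lemma lower_bound : ∃ C : ℝ, 0 < C ∧ ∀ B m : ℕ,
    SS (Real.log 2) B m (fun c => if St m 1 c then (2 + ∑ i ∈ range m, (c i : ℝ) * 2 ^ (i + 1)) else 0) ≤
      C * (2 * Real.exp 1 * Real.log 2) ^ m / q32 (m + 1) := by
  obtain ⟨C, hC, h⟩ := YY_bound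
  have hβ0 : 0 < Real.log 2 := by have := l2_lo; linarith
  have hβ1 : Real.log 2 ≤ 1 := by have := l2_hi; linarith
  refine ⟨4 * C, by positivity, fun B m => ?_⟩
  have hq := q32_pos (n := m + 1) (by omega)
  have e : (fun c : ℕ → ℕ => if St m 1 c then (2 + ∑ i ∈ range m, (c i : ℝ) * 2 ^ (i + 1)) else 0) =
      fun c => (2 * (if St m 1 c then 1 else 0)) + ∑ i ∈ range m, 2 ^ (i + 1) * (if St m 1 c then (c i : ℝ) else 0) := by
    funext c
    split_ifs
    · simp [mul_comm]
    · simp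
  rw [e, SS_add, SS_mul, SS_sum]
  have h1 := h B m 1 (by norm_num)
  have h2 := h B m 2 le_rfl
  have h3 : ∀ i ∈ range m, SS (Real.log 2) B m (fun c => 2 ^ (i + 1) * (if St m 1 c then (c i : ℝ) else 0)) ≤
      2 ^ (i + 1) * YY (Real.log 2) B m 2 := by
    intro i hi
    rw [SS_mul]
    apply mul_le_mul_of_nonneg_left _ (by positivity)
    refine (SS_shift hβ0.le i m 1 (by simpa using hi) le_rfl).trans ?_
    have := YY_nonneg (B := B) hβ0.le m 2
    nlinarith
  have h4 : ∑ i ∈ range m, (2 : ℝ) ^ (i + 1) ≤ 2 * 2 ^ m - 2 := by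
    have : ∀ m : ℕ, ∑ i ∈ range m, (2 : ℝ) ^ (i + 1) = 2 * 2 ^ m - 2 := by
      intro m
      induction m with
      | zero => simp
      | succ m ih => rw [Finset.sum_range_succ, ih]; ring
    exact (this m).le
  have h5 := Finset.sum_le_sum h3
  rw [← Finset.sum_mul] at h5
  set Z := C * (Real.exp 1 * Real.log 2) ^ m / q32 (m + 1) with hZ
  have hZ0 : 0 ≤ Z := by positivity
  have h6 : (∑ i ∈ range m, (2 : ℝ) ^ (i + 1)) * YY (Real.log 2) B m 2 ≤ (2 * 2 ^ m - 2) * Z := by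
    apply mul_le_mul h4 h2 (YY_nonneg hβ0.le _ _)
    have : (1 : ℝ) ≤ 2 ^ m := one_le_pow₀ (by norm_num)
    linarith
  have e2 : 4 * C * (2 * Real.exp 1 * Real.log 2) ^ m / q32 (m + 1) = 4 * 2 ^ m * Z := by
    rw [hZ, mul_assoc 2, mul_pow 2]; ring
  rw [e2]
  have h7 : SS (Real.log 2) B m (fun c => if St m 1 c then (1 : ℝ) else 0) ≤ Z := h1
  have : (1 : ℝ) ≤ 2 ^ m := one_le_pow₀ (by norm_num)
  nlinarith

lemma walk_bound : ∃ C : ℝ, 0 < C ∧ ∀ (B v : ℕ) (F : (ℕ → ℕ) → ℝ),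
    (∀ c m n, m + n = v → F c ≤ 2 ^ (∑ i ∈ Ico m v, c i) * (2 + ∑ i ∈ range m, (c i : ℝ) * 2 ^ (i + 1))) →
    SS (Real.log 2) B v F ≤ C * (2 * Real.exp 1 * Real.log 2) ^ v / q32 (v + 1) := by
  classical
  obtain ⟨C1, hC1, h1⟩ := lower_bound
  obtain ⟨C2, hC2, h2⟩ := bb_bound
  obtain ⟨C3, hC3, h3⟩ := conv_bound
  have hβ0 : 0 < Real.log 2 := by have := l2_lo; linarith
  refine ⟨C1 * C2 * C3, by positivity, fun B v F hF => ?_⟩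
  set G : ℕ → (ℕ → ℕ) → ℝ := fun m c => if St m 1 c then (2 + ∑ i ∈ range m, (c i : ℝ) * 2 ^ (i + 1)) else 0 with hG
  have hG0 : ∀ m c, 0 ≤ G m c := by
    intro m c; rw [hG]; dsimp only; split_ifs
    · positivity
    · exact le_rfl
  have hGc : ∀ m, ∀ c c' : ℕ → ℕ, (∀ i < m, c i = c' i) → G m c = G m c' := by
    intro m c c' h
    rw [hG]; dsimp only
    have a : St m 1 c ↔ St m 1 c' := St_congr c c' m 1 h
    have b : ∑ i ∈ range m, (c i : ℝ) * 2 ^ (i + 1) = ∑ i ∈ range m, (c' i : ℝ) * 2 ^ (i + 1) := by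
      apply Finset.sum_congr rfl
      intro i hi; rw [h i (by simpa using hi)]
    rw [b]
    by_cases hs : St m 1 c
    · rw [if_pos hs, if_pos (a.1 hs)]
    · rw [if_neg hs, if_neg (fun x => hs (a.2 x))]
  have step1 : SS (Real.log 2) B v F ≤ SS (Real.log 2) B v (fun c => ∑ p ∈ antidiagonal v,
      ∑ k ∈ Icc 1 (p.2 + 1), if Wb p.1 p.2 k c then 2 ^ (∑ i ∈ Ico p.1 (p.1 + p.2), c i) * G p.1 c else 0) := by
    apply SS_mono hβ0.le
    intro c
    obtain ⟨m, n, k, hv, hk1, hk2, hw, hs⟩ := exists_split c v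
    have nn : ∀ p : ℕ × ℕ, ∀ k : ℕ, 0 ≤ if Wb p.1 p.2 k c then (2 : ℝ) ^ (∑ i ∈ Ico p.1 (p.1 + p.2), c i) * G p.1 c else 0 := by
      intro p k
      split_ifs
      · exact mul_nonneg (by positivity) (hG0 _ _)
      · exact le_rfl
    refine le_trans ?_ (Finset.single_le_sum (f := fun p : ℕ × ℕ => ∑ k ∈ Icc 1 (p.2 + 1), if Wb p.1 p.2 k c then (2 : ℝ) ^ (∑ i ∈ Ico p.1 (p.1 + p.2), c i) * G p.1 c else 0)
      (fun p _ => Finset.sum_nonneg (fun k _ => nn p k)) (a := (m, n)) (by simpa using hv))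
    refine le_trans ?_ (Finset.single_le_sum (fun k _ => nn (m, n) k) (a := k) (by rw [Finset.mem_Icc]; exact ⟨hk1, hk2⟩))
    dsimp only
    rw [if_pos hw, hG]
    dsimp only
    rw [if_pos hs, hv]
    exact hF c m n hv
  refine step1.trans ?_
  rw [SS_sum]
  have step2 : ∀ p ∈ antidiagonal v, SS (Real.log 2) B v (fun c => ∑ k ∈ Icc 1 (p.2 + 1), if Wb p.1 p.2 k c then 2 ^ (∑ i ∈ Ico p.1 (p.1 + p.2), c i) * G p.1 c else 0) ≤
      (C1 * C2 * (2 * Real.exp 1 * Real.log 2) ^ v) * ((q32 (p.1 + 1))⁻¹ * (q32 (p.2 + 1))⁻¹) := by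
    intro p hp
    rw [Finset.HasAntidiagonal.mem_antidiagonal] at hp
    rw [SS_sum, ← hp]
    have q1 := q32_pos (n := p.1 + 1) (by omega)
    have q2 := q32_pos (n := p.2 + 1) (by omega)
    calc _ ≤ ∑ k ∈ Icc 1 (p.2 + 1), bal (2 * Real.log 2) (p.2 + 1) k * SS (Real.log 2) B p.1 (G p.1) := by
          apply Finset.sum_le_sum
          intro k _
          exact SS_top hβ0.le p.1 (G p.1) (hG0 _) (hGc _) p.2 k
      _ = (∑ k ∈ Icc 1 (p.2 + 1), bal (2 * Real.log 2) (p.2 + 1) k) * SS (Real.log 2) B p.1 (G p.1) := by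
          rw [Finset.sum_mul]
      _ ≤ (C2 * (2 * Real.exp 1 * Real.log 2) ^ p.2 / q32 (p.2 + 1)) * (C1 * (2 * Real.exp 1 * Real.log 2) ^ p.1 / q32 (p.1 + 1)) := by
          apply mul_le_mul (h2 _) (h1 _ _) (SS_nonneg hβ0.le _ _ (hG0 _)) (by positivity)
      _ = _ := by rw [pow_add]; field_simp
  refine (Finset.sum_le_sum step2).trans ?_
  rw [← Finset.mul_sum]
  calc _ ≤ (C1 * C2 * (2 * Real.exp 1 * Real.log 2) ^ v) * (C3 / q32 (v + 1)) := by
        apply mul_le_mul_of_nonneg_left (h3 v) (by positivity)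
    _ = _ := by ring

end Erd

namespace Erd
open Finset

lemma pow_add_lower {a w : ℝ} (ha : 0 ≤ a) (hw : 0 ≤ w) (N : ℕ) :
    a ^ (N + 1) + (N + 1) * w * a ^ N ≤ (a + w) ^ (N + 1) := by
  induction N with
  | zero => simp
  | succ N ih =>
    have h1 : (a + w) ^ (N + 1 + 1) = (a + w) ^ (N + 1) * (a + w) := pow_succ _ _
    have h2 : (a ^ (N + 1) + (N + 1) * w * a ^ N) * (a + w) ≤ (a + w) ^ (N + 1) * (a + w) := by
      gcongr
    have h3 : 0 ≤ ((N : ℝ) + 1) * w * a ^ N * w := by positivity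
    rw [h1]
    refine le_trans ?_ h2
    push_cast
    have e1 : a ^ (N + 1 + 1) = a ^ N * a * a := by ring
    have e2 : a ^ (N + 1) = a ^ N * a := by ring
    rw [e1, e2]
    linarith

lemma one_block (w : ℕ → ℝ) (Q : Finset ℕ) : (∀ p ∈ Q, 0 ≤ w p) → ∀ (g : ℕ → ℝ) (Bd : ℕ), (∀ n, 0 ≤ g n) →
    Q.card < Bd → ∑ B ∈ Q.powerset, (∏ p ∈ B, w p) * g B.card ≤
      ∑ N ∈ range Bd, (∑ p ∈ Q, w p) ^ N / N.factorial * g N := by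
  induction Q using Finset.induction_on with
  | empty =>
    intro _ g Bd hg hB
    simp only [Finset.powerset_empty, Finset.sum_singleton, Finset.prod_empty, Finset.card_empty, one_mul, Finset.sum_empty]
    refine le_trans ?_ (Finset.single_le_sum (f := fun N : ℕ => (0 : ℝ) ^ N / N.factorial * g N) (fun i _ => ?_) (a := 0) (by simpa using hB))
    · simp
    · exact mul_nonneg (by positivity) (hg i)
  | insert q Q hq ih =>
    intro hw g Bd hg hB
    have hwq := hw q (Finset.mem_insert_self _ _)
    have hwQ : ∀ p ∈ Q, 0 ≤ w p := fun p hp => hw p (Finset.mem_insert_of_mem hp)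
    rw [Finset.card_insert_of_notMem hq] at hB
    obtain ⟨B, rfl⟩ : ∃ B, Bd = B + 1 := ⟨Bd - 1, by omega⟩
    rw [Finset.sum_powerset_insert hq, Finset.sum_insert hq]
    set σ := ∑ p ∈ Q, w p with hσ
    have hσ0 : 0 ≤ σ := Finset.sum_nonneg hwQ
    have i1 := ih hwQ g (B + 1) hg (by omega)
    have i2 := ih hwQ (fun n => g (n + 1)) B (fun n => hg _) (by omega)
    have e2 : ∑ t ∈ Q.powerset, (∏ p ∈ insert q t, w p) * g (insert q t).card =
        w q * ∑ B ∈ Q.powerset, (∏ p ∈ B, w p) * g (B.card + 1) := by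
      rw [Finset.mul_sum]
      apply Finset.sum_congr rfl
      intro t ht
      have : q ∉ t := fun h => hq (Finset.mem_powerset.1 ht h)
      rw [Finset.prod_insert this, Finset.card_insert_of_notMem this]; ring
    rw [e2]
    refine (add_le_add i1 (mul_le_mul_of_nonneg_left i2 hwq)).trans ?_
    rw [Finset.sum_range_succ' _ B, Finset.sum_range_succ' _ B, Finset.mul_sum]
    simp only [pow_zero]
    have : ∑ k ∈ range B, σ ^ (k + 1) / ((k + 1).factorial : ℝ) * g (k + 1) + ∑ i ∈ range B, w q * (σ ^ i / (i.factorial : ℝ) * g (i + 1)) ≤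
        ∑ k ∈ range B, (w q + σ) ^ (k + 1) / ((k + 1).factorial : ℝ) * g (k + 1) := by
      rw [← Finset.sum_add_distrib]
      apply Finset.sum_le_sum
      intro k _
      have h1 := pow_add_lower hσ0 hwq k
      have hf : (0 : ℝ) < k.factorial := by positivity
      have : (σ ^ (k + 1) / ((k + 1).factorial : ℝ) + w q * (σ ^ k / (k.factorial : ℝ))) ≤ (w q + σ) ^ (k + 1) / ((k + 1).factorial : ℝ) := by
        rw [Nat.factorial_succ]; push_cast
        have : σ ^ (k + 1) / (((k : ℝ) + 1) * k.factorial) + w q * (σ ^ k / (k.factorial : ℝ)) = (σ ^ (k + 1) + (k + 1) * w q * σ ^ k) / (((k : ℝ) + 1) * k.factorial) := by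
          field_simp
        rw [this, add_comm (w q) σ]
        gcongr
      nlinarith [hg (k + 1)]
    linarith

lemma sum_powerset_union {P Q : Finset ℕ} (h : Disjoint P Q) (f : Finset ℕ → ℝ) :
    ∑ A ∈ (P ∪ Q).powerset, f A = ∑ A ∈ P.powerset, ∑ B ∈ Q.powerset, f (A ∪ B) := by
  induction Q using Finset.induction_on generalizing f with
  | empty => simp
  | insert q Q hq ih =>
    have hd : Disjoint P Q := h.mono_right (Finset.subset_insert _ _)
    have hqP : q ∉ P := fun hp => (Finset.disjoint_left.1 h hp) (Finset.mem_insert_self _ _)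
    rw [Finset.union_insert, Finset.sum_powerset_insert (by simp [hq, hqP]), ih hd, ih hd (fun A => f (insert q A)), ← Finset.sum_add_distrib]
    apply Finset.sum_congr rfl
    intro A _
    rw [Finset.sum_powerset_insert hq]
    congr 1
    apply Finset.sum_congr rfl
    intro B _
    rw [Finset.union_insert]

lemma blocks_le (w : ℕ → ℝ) (hw : ∀ p, 0 ≤ w p) (blk : ℕ → Finset ℕ) (hd : ∀ i j, i ≠ j → Disjoint (blk i) (blk j))
    {β : ℝ} (Bd : ℕ) : ∀ v : ℕ, (∀ i < v, (blk i).card < Bd) → (∀ i < v, ∑ p ∈ blk i, w p ≤ β) →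
    ∀ F : (ℕ → ℕ) → ℝ, (∀ c, 0 ≤ F c) →
    ∑ A ∈ ((range v).biUnion blk).powerset, (∏ p ∈ A, w p) * F (fun i => (A ∩ blk i).card) ≤ SS β Bd v F := by
  intro v
  induction v with
  | zero => intro _ _ F _; simp [SS]
  | succ v ih =>
    intro hc hs F hF
    have hdU : Disjoint ((range v).biUnion blk) (blk v) := by
      rw [Finset.disjoint_biUnion_left]
      intro i hi
      exact hd i v (by have := Finset.mem_range.1 hi; omega)
    rw [Finset.range_add_one, Finset.biUnion_insert, Finset.union_comm, sum_powerset_union hdU, Finset.sum_comm]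
    have hβ : 0 ≤ β := le_trans (Finset.sum_nonneg (fun p _ => hw p)) (hs v (by omega))
    have key : ∀ B ∈ (blk v).powerset, ∑ A ∈ ((range v).biUnion blk).powerset, (∏ p ∈ A ∪ B, w p) * F (fun i => ((A ∪ B) ∩ blk i).card) ≤
        (∏ p ∈ B, w p) * SS β Bd v (fun c => F (Function.update c v B.card)) := by
      intro B hB
      rw [Finset.mem_powerset] at hB
      have := ih (fun i hi => hc i (by omega)) (fun i hi => hs i (by omega)) (fun c => F (Function.update c v B.card)) (fun c => hF _)
      refine le_trans (le_of_eq ?_) (mul_le_mul_of_nonneg_left this (Finset.prod_nonneg (fun p _ => hw p)))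
      rw [Finset.mul_sum]
      apply Finset.sum_congr rfl
      intro A hA
      rw [Finset.mem_powerset] at hA
      have hAB : Disjoint A B := hdU.mono hA hB
      rw [Finset.prod_union hAB]
      have : (fun i => ((A ∪ B) ∩ blk i).card) = Function.update (fun i => (A ∩ blk i).card) v B.card := by
        funext i
        rw [Finset.union_inter_distrib_right]
        by_cases hi : i = v
        · subst hi
          rw [Function.update_self]
          have h1 : A ∩ blk i = ∅ := Finset.disjoint_iff_inter_eq_empty.1 (hdU.mono_left hA)
          rw [h1, Finset.empty_union, Finset.inter_eq_left.2 hB]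
        · rw [Function.update_of_ne hi]
          have h1 : B ∩ blk i = ∅ := Finset.disjoint_iff_inter_eq_empty.1 ((hd v i (fun h => hi h.symm)).mono_left hB)
          rw [h1, Finset.union_empty]
      rw [this]; ring
    refine (Finset.sum_le_sum key).trans ?_
    have hnn : ∀ N, 0 ≤ SS β Bd v (fun c => F (Function.update c v N)) := fun N => SS_nonneg hβ v _ (fun c => hF _)
    refine (one_block w (blk v) (fun p _ => hw p) (fun N => SS β Bd v (fun c => F (Function.update c v N))) Bd hnn (hc v (by omega))).trans ?_
    rw [SS]
    apply Finset.sum_le_sum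
    intro N _
    apply mul_le_mul_of_nonneg_right _ (hnn N)
    have := hs v (by omega)
    have h0 : 0 ≤ ∑ p ∈ blk v, w p := Finset.sum_nonneg (fun p _ => hw p)
    gcongr

/-- number of `t`-cells met by the shifted subset sums of logs -/
noncomputable def Lx (t x : ℝ) (A : Finset ℕ) : ℕ :=
  ((A.powerset).image (fun B : Finset ℕ => ⌊(x + ∑ q ∈ B, Real.log q) / t⌋)).card

noncomputable def Lf (t : ℝ) (A : Finset ℕ) : ℕ := ⨆ x : ℝ, Lx t x A

lemma Lx_bdd (t : ℝ) (A : Finset ℕ) : BddAbove (Set.range (fun x => Lx t x A)) := by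
  refine ⟨2 ^ A.card, ?_⟩
  rintro _ ⟨x, rfl⟩
  dsimp only [Lx]
  exact Finset.card_image_le.trans (by rw [Finset.card_powerset])

lemma Lx_le (t x : ℝ) (A : Finset ℕ) : Lx t x A ≤ Lf t A := le_ciSup (Lx_bdd t A) x

lemma Lf_insert (t : ℝ) (q : ℕ) (A : Finset ℕ) : Lf t (insert q A) ≤ 2 * Lf t A := by
  by_cases hq : q ∈ A
  · rw [Finset.insert_eq_of_mem hq]; omega
  apply ciSup_le
  intro x
  have h1 : Lx t x (insert q A) ≤ Lx t x A + Lx t (x + Real.log q) A := by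
    unfold Lx
    rw [Finset.powerset_insert, Finset.image_union, Finset.image_image]
    refine (Finset.card_union_le _ _).trans ?_
    apply Nat.add_le_add_left
    apply le_of_eq
    congr 1
    apply Finset.image_congr
    intro B hB
    have : q ∉ B := fun h => hq (Finset.mem_powerset.1 hB h)
    simp only [Function.comp]
    rw [Finset.sum_insert this, add_assoc]
  have := Lx_le t x A
  have := Lx_le t (x + Real.log q) A
  omega

lemma Lf_union (t : ℝ) (A B : Finset ℕ) : Lf t (A ∪ B) ≤ 2 ^ B.card * Lf t A := by
  induction B using Finset.induction_on with
  | empty => simp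
  | insert q B hq ih =>
    rw [Finset.union_insert, Finset.card_insert_of_notMem hq, pow_succ]
    have := Lf_insert t q (A ∪ B)
    nlinarith

lemma Lf_le_sum {t : ℝ} (ht : 0 < t) (A : Finset ℕ) : (Lf t A : ℝ) ≤ 2 + (∑ q ∈ A, Real.log q) / t := by
  set S := ∑ q ∈ A, Real.log q with hS
  have hS0 : 0 ≤ S := Finset.sum_nonneg (fun q _ => Real.log_natCast_nonneg q)
  have key : Lf t A ≤ ⌊2 + S / t⌋₊ := by
    apply ciSup_le
    intro x
    have hsub : (A.powerset).image (fun B : Finset ℕ => ⌊(x + ∑ q ∈ B, Real.log q) / t⌋) ⊆ Finset.Icc ⌊x / t⌋ ⌊(x + S) / t⌋ := by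
      intro j hj
      rw [Finset.mem_image] at hj
      obtain ⟨B, hB, rfl⟩ := hj
      rw [Finset.mem_powerset] at hB
      rw [Finset.mem_Icc]
      have h0 : 0 ≤ ∑ q ∈ B, Real.log q := Finset.sum_nonneg (fun q _ => Real.log_natCast_nonneg q)
      have h1 : ∑ q ∈ B, Real.log q ≤ S := Finset.sum_le_sum_of_subset_of_nonneg hB (fun q _ _ => Real.log_natCast_nonneg q)
      constructor
      · apply Int.floor_le_floor; gcongr; linarith
      · apply Int.floor_le_floor; gcongr
    refine (Finset.card_le_card hsub).trans ?_
    rw [Int.card_Icc]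
    apply Nat.le_floor
    have h1 := Int.lt_floor_add_one (x / t)
    have h2 := Int.floor_le ((x + S) / t)
    have h3 : (x + S) / t = x / t + S / t := add_div _ _ _
    have h4 : ⌊x / t⌋ ≤ ⌊(x + S) / t⌋ := by apply Int.floor_le_floor; gcongr; linarith
    have h5 : (((⌊(x + S) / t⌋ + 1 - ⌊x / t⌋).toNat : ℤ) : ℝ) = ((⌊(x + S) / t⌋ + 1 - ⌊x / t⌋ : ℤ) : ℝ) := by
      rw [Int.toNat_of_nonneg (by omega)]
    rw [← Int.cast_natCast, h5]
    push_cast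
    linarith
  have h0 : 0 ≤ 2 + S / t := by positivity
  exact (Nat.cast_le.2 key).trans (Nat.floor_le h0)

lemma twist (f : Finset ℕ → ℝ) (hf : ∀ A, 0 ≤ f A) (hf2 : ∀ q A, f (insert q A) ≤ 2 * f A) (w ε : ℕ → ℝ) (P : Finset ℕ) :
    (∀ p ∈ P, 0 ≤ w p) → (∀ p ∈ P, 0 ≤ ε p) → ∀ R : Finset ℕ,
    ∑ A ∈ P.powerset, f (A ∪ R) * ∏ p ∈ A, (w p * (1 + ε p)) ≤
      Real.exp (2 * ∑ p ∈ P, w p * ε p) * ∑ A ∈ P.powerset, f (A ∪ R) * ∏ p ∈ A, w p := by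
  induction P using Finset.induction_on with
  | empty => intro _ _ R; simp
  | insert q P hq ih =>
    intro hw he R
    have hwq := hw q (Finset.mem_insert_self _ _)
    have heq := he q (Finset.mem_insert_self _ _)
    have hwP : ∀ p ∈ P, 0 ≤ w p := fun p hp => hw p (Finset.mem_insert_of_mem hp)
    have heP : ∀ p ∈ P, 0 ≤ ε p := fun p hp => he p (Finset.mem_insert_of_mem hp)
    have split : ∀ W : ℕ → ℝ, ∑ A ∈ (insert q P).powerset, f (A ∪ R) * ∏ p ∈ A, W p =
        ∑ A ∈ P.powerset, f (A ∪ R) * ∏ p ∈ A, W p + W q * ∑ A ∈ P.powerset, f (A ∪ insert q R) * ∏ p ∈ A, W p := by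
      intro W
      rw [Finset.sum_powerset_insert hq, Finset.mul_sum]
      congr 1
      apply Finset.sum_congr rfl
      intro A hA
      have : q ∉ A := fun h => hq (Finset.mem_powerset.1 hA h)
      rw [Finset.prod_insert this, Finset.insert_union, Finset.union_insert]; ring
    rw [split, split w, Finset.sum_insert hq]
    have i1 := ih hwP heP R
    have i2 := ih hwP heP (insert q R)
    set E := Real.exp (2 * ∑ p ∈ P, w p * ε p) with hE
    set S1 := ∑ A ∈ P.powerset, f (A ∪ R) * ∏ p ∈ A, w p with hS1
    set S2 := ∑ A ∈ P.powerset, f (A ∪ insert q R) * ∏ p ∈ A, w p with hS2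
    have hS1n : 0 ≤ S1 := Finset.sum_nonneg (fun A hA => mul_nonneg (hf _) (Finset.prod_nonneg (fun p hp => hwP p (Finset.mem_powerset.1 hA hp))))
    have hS2n : 0 ≤ S2 := Finset.sum_nonneg (fun A hA => mul_nonneg (hf _) (Finset.prod_nonneg (fun p hp => hwP p (Finset.mem_powerset.1 hA hp))))
    have hS : S2 ≤ 2 * S1 := by
      rw [hS1, hS2, Finset.mul_sum]
      apply Finset.sum_le_sum
      intro A hA
      have := Finset.prod_nonneg (s := A) (f := w) (fun p hp => hwP p (Finset.mem_powerset.1 hA hp))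
      rw [Finset.union_insert]
      have := hf2 q (A ∪ R)
      nlinarith
    have hE0 : 0 < E := Real.exp_pos _
    have hexp : Real.exp (2 * (w q * ε q + ∑ p ∈ P, w p * ε p)) = Real.exp (2 * (w q * ε q)) * E := by
      rw [hE, ← Real.exp_add]; congr 1; ring
    rw [hexp]
    have h1 : 2 * (w q * ε q) + 1 ≤ Real.exp (2 * (w q * ε q)) := Real.add_one_le_exp _
    have hwe : 0 ≤ w q * ε q := mul_nonneg hwq heq
    calc _ ≤ E * S1 + w q * (1 + ε q) * (E * S2) := by gcongr
      _ = E * (S1 + w q * S2 + w q * ε q * S2) := by ring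
      _ ≤ E * (S1 + w q * S2 + w q * ε q * (2 * S1)) := by gcongr
      _ ≤ E * ((2 * (w q * ε q) + 1) * (S1 + w q * S2)) := by
          gcongr
          nlinarith [mul_nonneg hwe (mul_nonneg hwq hS2n)]
      _ ≤ E * (Real.exp (2 * (w q * ε q)) * (S1 + w q * S2)) := by gcongr
      _ = _ := by ring

end Erd

namespace Erd
open Finset

lemma mert_int : ∃ C : ℝ, 0 < C ∧ ∀ (F : Finset ℕ) (u v : ℝ), u ≤ v →
    (∀ p ∈ F, p.Prime ∧ u ≤ Real.log p ∧ Real.log p ≤ v) →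
    ∑ p ∈ F, Real.log p / p ≤ v - u + C := by
  obtain ⟨C, hC, h⟩ := mert_bound_nat
  refine ⟨2 * C + 1, by positivity, fun F u v huv hF => ?_⟩
  by_cases hv : v < 0
  · have : F = ∅ := by
      apply Finset.eq_empty_of_forall_notMem
      intro p hp
      have h1 := (hF p hp).2.2
      have := Real.log_natCast_nonneg p
      linarith
    rw [this, Finset.sum_empty]; linarith
  push Not at hv
  set u' := max u 0 with hu'
  have hu0 : 0 ≤ u' := le_max_right _ _
  have huv' : u' ≤ v := max_le huv hv
  set N := ⌊Real.exp v⌋₊ with hN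
  set M := ⌈Real.exp u'⌉₊ with hM
  have hN1 : 1 ≤ N := Nat.le_floor (by simpa using Real.one_le_exp hv)
  have hM1 : 1 ≤ M := Nat.ceil_pos.2 (Real.exp_pos _)
  have hsub : F ∪ Nat.primesLE (M - 1) ⊆ Nat.primesLE N ∪ Nat.primesLE (M - 1) := by
    apply Finset.union_subset_union_left
    intro p hp
    obtain ⟨h1, h2, h3⟩ := hF p hp
    rw [Nat.mem_primesLE]
    refine ⟨Nat.le_floor ?_, h1⟩
    rw [← Real.exp_log (show (0 : ℝ) < p by exact_mod_cast h1.pos)]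
    exact Real.exp_le_exp.2 h3
  have hdis : Disjoint F (Nat.primesLE (M - 1)) := by
    rw [Finset.disjoint_left]
    intro p hp hp2
    obtain ⟨h1, h2, h3⟩ := hF p hp
    rw [Nat.mem_primesLE] at hp2
    have h4 : u' ≤ Real.log p := max_le h2 (Real.log_natCast_nonneg p)
    have h5 : Real.exp u' ≤ p := by
      rw [← Real.exp_log (show (0 : ℝ) < p by exact_mod_cast h1.pos)]
      exact Real.exp_le_exp.2 h4
    have h6 : M ≤ p := Nat.ceil_le.2 h5
    omega
  have nn : ∀ p : ℕ, 0 ≤ Real.log p / p := fun p => div_nonneg (Real.log_natCast_nonneg p) (Nat.cast_nonneg p)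
  have hlogN : Real.log N ≤ v := by
    rw [Real.log_le_iff_le_exp (by exact_mod_cast hN1)]
    exact Nat.floor_le (Real.exp_pos _).le
  have hu : u ≤ u' := le_max_left _ _
  have hb : ∑ p ∈ F, Real.log p / p ≤ Mert N := by
    apply Finset.sum_le_sum_of_subset_of_nonneg _ (fun p _ _ => nn p)
    intro p hp
    have := hsub (Finset.mem_union_left _ hp)
    rw [Finset.mem_union] at this
    rcases this with h | h
    · exact h
    · exact absurd h (Finset.disjoint_left.1 hdis hp)
  have hN2 := (abs_le.1 (h N hN1)).2
  by_cases hM2 : M = 1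
  · have : Real.exp u' ≤ 1 := by have := Nat.le_ceil (Real.exp u'); rw [← hM, hM2] at this; simpa using this
    have : u' ≤ 0 := by simpa using this
    linarith
  · have hMM : M - 1 ≤ N := by
      have h1 : (M : ℝ) < Real.exp u' + 1 := Nat.ceil_lt_add_one (Real.exp_pos _).le
      have h2 : Real.exp v < N + 1 := Nat.lt_floor_add_one _
      have h3 : Real.exp u' ≤ Real.exp v := Real.exp_le_exp.2 huv'
      have : (M : ℝ) < (N + 2 : ℕ) := by push_cast; linarith
      have : M < N + 2 := by exact_mod_cast this
      omega
    have e : Nat.primesLE N ∪ Nat.primesLE (M - 1) = Nat.primesLE N := by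
      apply Finset.union_eq_left.2
      intro p hp
      rw [Nat.mem_primesLE] at hp ⊢
      exact ⟨hp.1.trans hMM, hp.2⟩
    rw [e] at hsub
    have h1 : ∑ p ∈ F, Real.log p / p + Mert (M - 1) ≤ Mert N := by
      unfold Mert
      rw [← Finset.sum_union hdis]
      exact Finset.sum_le_sum_of_subset_of_nonneg hsub (fun p _ _ => nn p)
    have h2 := (abs_le.1 (h (M - 1) (by omega))).1
    have h3 : u' ≤ Real.log ((M - 1 : ℕ) : ℝ) + 1 := by
      have h4 : Real.exp u' ≤ M := Nat.le_ceil _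
      have h5 : (M : ℝ) ≤ 2 * ((M - 1 : ℕ) : ℝ) := by
        have : M ≤ 2 * (M - 1) := by omega
        exact_mod_cast this
      have h6 : 0 < ((M - 1 : ℕ) : ℝ) := by
        have : 0 < M - 1 := by omega
        exact_mod_cast this
      have h7 : u' ≤ Real.log (2 * ((M - 1 : ℕ) : ℝ)) := by
        rw [Real.le_log_iff_exp_le (by positivity)]; linarith
      rw [Real.log_mul (by norm_num) h6.ne'] at h7
      have := l2_hi
      linarith
    linarith

noncomputable def blk (t : ℝ) (i : ℕ) : Finset ℕ := PI (Real.exp (2 ^ i * t)) (Real.exp (2 ^ (i + 1) * t))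

lemma PI_union {a b c : ℝ} (h1 : a ≤ b) (h2 : b ≤ c) : PI a b ∪ PI b c = PI a c := by
  ext p
  rw [Finset.mem_union, mem_PI, mem_PI, mem_PI]
  constructor
  · rintro (⟨x, y, z⟩ | ⟨x, y, z⟩)
    · exact ⟨x, y, z.trans h2⟩
    · exact ⟨x, h1.trans_lt y, z⟩
  · rintro ⟨x, y, z⟩
    rcases le_or_gt (p : ℝ) b with h | h
    · exact Or.inl ⟨x, y, h⟩
    · exact Or.inr ⟨x, h, z⟩

lemma blk_union {t : ℝ} (ht : 0 ≤ t) (v : ℕ) : (range v).biUnion (blk t) = PI (Real.exp t) (Real.exp (2 ^ v * t)) := by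
  induction v with
  | zero =>
    simp only [Finset.range_zero, Finset.biUnion_empty, pow_zero, one_mul]
    symm
    apply Finset.eq_empty_of_forall_notMem
    intro p hp
    rw [mem_PI] at hp
    linarith [hp.2.1, hp.2.2]
  | succ v ih =>
    rw [Finset.range_add_one, Finset.biUnion_insert, ih, Finset.union_comm, blk]
    apply PI_union
    · apply Real.exp_le_exp.2
      have : (1 : ℝ) ≤ 2 ^ v := one_le_pow₀ (by norm_num)
      nlinarith
    · apply Real.exp_le_exp.2
      have : (0 : ℝ) ≤ 2 ^ v := by positivity
      rw [pow_succ]; nlinarith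

lemma blk_disj {t : ℝ} (ht : 0 ≤ t) : ∀ i j, i ≠ j → Disjoint (blk t i) (blk t j) := by
  have key : ∀ i j, i < j → Disjoint (blk t i) (blk t j) := by
    intro i j hij
    rw [Finset.disjoint_left]
    intro p h1 h2
    rw [blk, mem_PI] at h1 h2
    have : Real.exp (2 ^ (i + 1) * t) ≤ Real.exp (2 ^ j * t) := by
      apply Real.exp_le_exp.2
      apply mul_le_mul_of_nonneg_right _ ht
      exact pow_le_pow_right₀ (by norm_num) hij
    linarith [h1.2.2, h2.2.1]
  intro i j hij
  rcases lt_or_gt_of_ne hij with h | h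
  · exact key i j h
  · exact (key j i h).symm

lemma Lf_walk {t : ℝ} (ht : 0 < t) (v : ℕ) (A : Finset ℕ) (hA : A ⊆ (range v).biUnion (blk t)) (m n : ℕ) (hmn : m + n = v) :
    (Lf t A : ℝ) ≤ 2 ^ (∑ i ∈ Ico m v, (A ∩ blk t i).card) * (2 + ∑ i ∈ range m, ((A ∩ blk t i).card : ℝ) * 2 ^ (i + 1)) := by
  set A0 := A ∩ (range m).biUnion (blk t) with hA0
  set A1 := A ∩ (Ico m v).biUnion (blk t) with hA1
  have e : A = A0 ∪ A1 := by
    rw [hA0, hA1, ← Finset.inter_union_distrib_left, ← Finset.union_biUnion]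
    have : range m ∪ Ico m v = range v := by
      ext i; simp only [Finset.mem_union, Finset.mem_range, Finset.mem_Ico]; omega
    rw [this]
    exact (Finset.inter_eq_left.2 hA).symm
  have c1 : A1.card = ∑ i ∈ Ico m v, (A ∩ blk t i).card := by
    rw [hA1, Finset.inter_biUnion, Finset.card_biUnion]
    intro i _ j _ hij
    exact (blk_disj ht.le i j hij).mono Finset.inter_subset_right Finset.inter_subset_right
  have c0 : (∑ q ∈ A0, Real.log q) / t ≤ ∑ i ∈ range m, ((A ∩ blk t i).card : ℝ) * 2 ^ (i + 1) := by
    rw [hA0, Finset.inter_biUnion, Finset.sum_biUnion (by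
      intro i _ j _ hij
      exact (blk_disj ht.le i j hij).mono Finset.inter_subset_right Finset.inter_subset_right), Finset.sum_div]
    apply Finset.sum_le_sum
    intro i _
    rw [div_le_iff₀ ht]
    have : ∀ q ∈ A ∩ blk t i, Real.log q ≤ 2 ^ (i + 1) * t := by
      intro q hq
      have := (Finset.mem_inter.1 hq).2
      rw [blk, mem_PI] at this
      rw [Real.log_le_iff_le_exp (by exact_mod_cast this.1.pos)]
      exact this.2.2
    calc _ ≤ ∑ q ∈ A ∩ blk t i, (2 ^ (i + 1) * t : ℝ) := Finset.sum_le_sum this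
      _ = _ := by rw [Finset.sum_const, nsmul_eq_mul]; ring
  have h1 : (Lf t A : ℝ) ≤ 2 ^ A1.card * (Lf t A0 : ℝ) := by
    rw [e]
    have hd : Lf t (A0 ∪ A1) ≤ 2 ^ A1.card * Lf t A0 := Lf_union t A0 A1
    rw [← e] at hd ⊢
    exact_mod_cast hd
  have h2 := Lf_le_sum ht A0
  rw [c1] at h1
  refine h1.trans ?_
  gcongr
  linarith

lemma T_bound : ∃ C : ℝ, 0 < C ∧ ∀ (t : ℝ), 1 ≤ t → ∀ v : ℕ,
    ∑ A ∈ (PI (Real.exp t) (Real.exp (2 ^ v * t))).powerset,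
      (Lf t A : ℝ) * ∏ p ∈ A, ((1 / (p : ℝ)) * (p : ℝ) ^ (1 / (2 ^ v * t))) ≤
      C * (2 * Real.exp 1 * Real.log 2) ^ v / q32 (v + 1) := by
  obtain ⟨C0, hC0, hW⟩ := walk_bound
  obtain ⟨C1, hC1, hR⟩ := recip_real
  obtain ⟨C2, hC2, hM⟩ := mert_int
  have hl2 : 0 < Real.log 2 := by have := l2_lo; linarith
  set C' := C1 / Real.log 2 with hC'
  have hC'0 : 0 < C' := by positivity
  refine ⟨Real.exp (2 * (2 * (1 + C2))) * (Real.exp (2 * (2 * C1)) * C0), by positivity, fun t ht v => ?_⟩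
  have ht0 : 0 < t := by linarith
  have h2v : (1 : ℝ) ≤ 2 ^ v := one_le_pow₀ (by norm_num)
  set P := PI (Real.exp t) (Real.exp (2 ^ v * t)) with hP
  set κ := 1 / (2 ^ v * t) with hκ
  have hκ0 : 0 < κ := by positivity
  set f : Finset ℕ → ℝ := fun A => (Lf t A : ℝ) with hf
  have hfn : ∀ A, 0 ≤ f A := fun A => Nat.cast_nonneg _
  have hf2 : ∀ q A, f (insert q A) ≤ 2 * f A := by
    intro q A; have := Lf_insert t q A
    show (Lf t (insert q A) : ℝ) ≤ 2 * (Lf t A : ℝ)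
    exact_mod_cast this
  have hPlog : ∀ p ∈ P, p.Prime ∧ t ≤ Real.log p ∧ Real.log p ≤ 2 ^ v * t := by
    intro p hp
    rw [hP, mem_PI] at hp
    have hp0 : (0 : ℝ) < p := by exact_mod_cast hp.1.pos
    exact ⟨hp.1, (Real.le_log_iff_exp_le hp0).2 hp.2.1.le, (Real.log_le_iff_le_exp hp0).2 hp.2.2⟩
  -- first twist
  have tw1 := twist f hfn hf2 (fun p => 1 / (p : ℝ)) (fun p => 2 * κ * Real.log p) P (fun p _ => by positivity)
    (fun p _ => by have := Real.log_natCast_nonneg p; positivity) ∅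
  have st1 : ∑ A ∈ P.powerset, (Lf t A : ℝ) * ∏ p ∈ A, ((1 / (p : ℝ)) * (p : ℝ) ^ κ) ≤
      ∑ A ∈ P.powerset, f (A ∪ ∅) * ∏ p ∈ A, (1 / (p : ℝ) * (1 + 2 * κ * Real.log p)) := by
    apply Finset.sum_le_sum
    intro A hA
    rw [Finset.union_empty]
    apply mul_le_mul_of_nonneg_left _ (hfn A)
    apply Finset.prod_le_prod
    · intro p _; positivity
    · intro p hp
      obtain ⟨h1, h2, h3⟩ := hPlog p (Finset.mem_powerset.1 hA hp)
      have hp0 : (0 : ℝ) < p := by exact_mod_cast h1.pos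
      apply mul_le_mul_of_nonneg_left _ (by positivity)
      rw [Real.rpow_def_of_pos hp0]
      have hx0 : 0 ≤ Real.log p * κ := mul_nonneg (Real.log_natCast_nonneg p) hκ0.le
      have hx1 : Real.log p * κ ≤ 1 := by
        rw [hκ, mul_one_div, div_le_one (by positivity)]; exact h3
      have := Real.abs_exp_sub_one_le (x := Real.log p * κ) (by rw [abs_of_nonneg hx0]; exact hx1)
      rw [abs_of_nonneg hx0] at this
      have := (abs_le.1 this).2
      linarith
  have se1 : ∑ p ∈ P, 1 / (p : ℝ) * (2 * κ * Real.log p) ≤ 2 * (1 + C2) := by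
    have h1 := hM P t (2 ^ v * t) (by nlinarith) hPlog
    have : ∑ p ∈ P, 1 / (p : ℝ) * (2 * κ * Real.log p) = 2 * κ * ∑ p ∈ P, Real.log p / p := by
      rw [Finset.mul_sum]; apply Finset.sum_congr rfl; intro p _; ring
    rw [this]
    have h2 : κ * (2 ^ v * t) = 1 := by rw [hκ]; field_simp
    have h3 : κ ≤ 1 := by
      rw [hκ, div_le_one (by positivity)]; nlinarith
    calc 2 * κ * ∑ p ∈ P, Real.log p / p ≤ 2 * κ * (2 ^ v * t - t + C2) := by gcongr
      _ ≤ 2 * (1 + C2) := by nlinarith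
  -- second twist
  classical
  set e : ℕ → ℝ := fun p => ∑ i ∈ range v, if p ∈ blk t i then C' / (2 ^ i * t) else 0 with he
  have hee : ∀ i < v, ∀ p ∈ blk t i, e p = C' / (2 ^ i * t) := by
    intro i hi p hp
    rw [he]; dsimp only
    rw [Finset.sum_eq_single i]
    · rw [if_pos hp]
    · intro j _ hj
      rw [if_neg]
      intro hpj
      exact Finset.disjoint_left.1 (blk_disj ht0.le i j (fun h => hj h.symm)) hp hpj
    · intro h; exact absurd (Finset.mem_range.2 hi) h
  have he0 : ∀ p, 0 ≤ e p := by
    intro p; apply Finset.sum_nonneg; intro i _; split_ifs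
    · positivity
    · exact le_rfl
  set w : ℕ → ℝ := fun p => 1 / (p : ℝ) / (1 + e p) with hw
  have hw0 : ∀ p, 0 ≤ w p := by
    intro p; have := he0 p; rw [hw]; dsimp only; positivity
  have hwe : ∀ p, w p * (1 + e p) = 1 / (p : ℝ) := by
    intro p; have := he0 p
    rw [hw]; dsimp only
    rw [div_mul_cancel₀]; positivity
  have tw2 := twist f hfn hf2 w e P (fun p _ => hw0 p) (fun p _ => he0 p) ∅
  have blksum : ∀ i < v, ∑ p ∈ blk t i, w p ≤ Real.log 2 := by
    intro i hi
    have h2i : (1 : ℝ) ≤ 2 ^ i := one_le_pow₀ (by norm_num)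
    have h1 : ∑ p ∈ blk t i, w p = (∑ p ∈ blk t i, 1 / (p : ℝ)) / (1 + C' / (2 ^ i * t)) := by
      rw [Finset.sum_div]
      apply Finset.sum_congr rfl
      intro p hp
      rw [hw]; dsimp only
      rw [hee i hi p hp]
    rw [h1, div_le_iff₀ (by positivity)]
    have h3 := hR (Real.exp (2 ^ i * t)) (Real.exp (2 ^ (i + 1) * t)) (by
      have := Real.add_one_le_exp (2 ^ i * t)
      nlinarith) (by
      apply Real.exp_le_exp.2; rw [pow_succ]; nlinarith)
    rw [Real.log_exp, Real.log_exp] at h3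
    have h4 : Real.log (2 ^ (i + 1) * t) - Real.log (2 ^ i * t) = Real.log 2 := by
      rw [pow_succ, mul_right_comm, Real.log_mul (by positivity) (by norm_num)]; ring
    rw [h4] at h3
    refine h3.trans (le_of_eq ?_)
    rw [hC']; field_simp
  have se2 : ∑ p ∈ P, w p * e p ≤ 2 * C1 := by
    rw [hP, ← blk_union ht0.le, Finset.sum_biUnion (fun i _ j _ hij => blk_disj ht0.le i j hij)]
    have : ∀ i ∈ range v, ∑ p ∈ blk t i, w p * e p ≤ C1 * (1 / 2) ^ i := by
      intro i hi
      rw [Finset.mem_range] at hi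
      have h1 : ∑ p ∈ blk t i, w p * e p = (∑ p ∈ blk t i, w p) * (C' / (2 ^ i * t)) := by
        rw [Finset.sum_mul]
        apply Finset.sum_congr rfl
        intro p hp
        rw [hee i hi p hp]
      rw [h1]
      calc _ ≤ Real.log 2 * (C' / (2 ^ i * t)) := by
            apply mul_le_mul_of_nonneg_right (blksum i hi) (by positivity)
        _ = C1 * (1 / 2) ^ i / t := by rw [hC', one_div, inv_pow]; field_simp
        _ ≤ C1 * (1 / 2) ^ i := div_le_self (by positivity) ht
    refine (Finset.sum_le_sum this).trans ?_
    rw [← Finset.mul_sum]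
    have := sum_geometric_two_le v
    nlinarith
  -- walk
  set F : (ℕ → ℕ) → ℝ := fun c => (range (v + 1)).inf' ⟨0, by simp⟩
    (fun m => 2 ^ (∑ i ∈ Ico m v, c i) * (2 + ∑ i ∈ range m, (c i : ℝ) * 2 ^ (i + 1))) with hF
  have hF0 : ∀ c, 0 ≤ F c := by
    intro c; rw [hF]; dsimp only
    apply Finset.le_inf'
    intro m _; positivity
  set Bd := (∑ i ∈ range v, (blk t i).card) + 1 with hBd
  have hcard : ∀ i < v, (blk t i).card < Bd := by
    intro i hi
    have := Finset.single_le_sum (f := fun i => (blk t i).card) (fun i _ => Nat.zero_le _) (Finset.mem_range.2 hi)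
    omega
  have hb := blocks_le w hw0 (blk t) (blk_disj ht0.le) Bd v hcard blksum F hF0
  have hWv := hW Bd v F (by
    intro c m n hmn
    rw [hF]; dsimp only
    exact Finset.inf'_le _ (by rw [Finset.mem_range]; omega))
  have st3 : ∑ A ∈ P.powerset, f (A ∪ ∅) * ∏ p ∈ A, w p ≤
      ∑ A ∈ ((range v).biUnion (blk t)).powerset, (∏ p ∈ A, w p) * F (fun i => (A ∩ blk t i).card) := by
    rw [hP, ← blk_union ht0.le]
    apply Finset.sum_le_sum
    intro A hA
    rw [Finset.mem_powerset] at hA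
    rw [Finset.union_empty, mul_comm]
    apply mul_le_mul_of_nonneg_left _ (Finset.prod_nonneg (fun p _ => hw0 p))
    rw [hF]; dsimp only
    apply Finset.le_inf'
    intro m hm
    rw [Finset.mem_range] at hm
    exact Lf_walk ht0 v A hA m (v - m) (by omega)
  have hS3 := st3.trans (hb.trans hWv)
  simp only [hwe] at tw2
  have E1 : Real.exp (2 * ∑ p ∈ P, 1 / (p : ℝ) * (2 * κ * Real.log p)) ≤ Real.exp (2 * (2 * (1 + C2))) := by
    apply Real.exp_le_exp.2; linarith
  have E2 : Real.exp (2 * ∑ p ∈ P, w p * e p) ≤ Real.exp (2 * (2 * C1)) := by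
    apply Real.exp_le_exp.2; linarith
  have n1 : 0 ≤ ∑ A ∈ P.powerset, f (A ∪ ∅) * ∏ p ∈ A, 1 / (p : ℝ) :=
    Finset.sum_nonneg (fun A _ => mul_nonneg (hfn _) (Finset.prod_nonneg (fun p _ => by positivity)))
  have n2 : 0 ≤ ∑ A ∈ P.powerset, f (A ∪ ∅) * ∏ p ∈ A, w p :=
    Finset.sum_nonneg (fun A _ => mul_nonneg (hfn _) (Finset.prod_nonneg (fun p _ => hw0 p)))
  calc _ ≤ _ := st1
    _ ≤ _ := tw1
    _ ≤ Real.exp (2 * (2 * (1 + C2))) * ∑ A ∈ P.powerset, f (A ∪ ∅) * ∏ p ∈ A, 1 / (p : ℝ) :=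
        mul_le_mul_of_nonneg_right E1 n1
    _ ≤ Real.exp (2 * (2 * (1 + C2))) * (Real.exp (2 * (2 * C1)) * (C0 * (2 * Real.exp 1 * Real.log 2) ^ v / q32 (v + 1))) := by
        apply mul_le_mul_of_nonneg_left _ (Real.exp_pos _).le
        refine tw2.trans ?_
        exact mul_le_mul E2 hS3 n2 (Real.exp_pos _).le
    _ = _ := by ring

end Erd

namespace Erd
open Finset

lemma smooth_rankin : ∃ C : ℝ, 0 < C ∧ ∀ t : ℝ, 2 ≤ t → ∀ F : Finset ℕ,
    (∀ m ∈ F, ∀ p : ℕ, p.Prime → p ∣ m → (p : ℝ) ≤ Real.exp t) →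
    ∑ m ∈ F, (m : ℝ) ^ (-(1 - 1 / t)) ≤ C * t := by
  obtain ⟨C1, hC1, h1⟩ := prod_le
  obtain ⟨C2, hC2, h2⟩ := mert_int
  have hC1' : 0 < C1 := by linarith
  refine ⟨Real.exp (8 * (1 + C2)) * C1, by positivity, fun t ht F hF => ?_⟩
  have ht0 : 0 < t := by linarith
  have hinv : 1 / t ≤ 1 / 2 := one_div_le_one_div_of_le (by norm_num) ht
  have hinv0 : 0 < 1 / t := by positivity
  set s := Nat.primesLE ⌊Real.exp t⌋₊ with hs
  have hmem : ∀ p ∈ s, p.Prime ∧ (p : ℝ) ≤ Real.exp t := by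
    intro p hp
    rw [hs, Nat.mem_primesLE] at hp
    exact ⟨hp.2, (Nat.le_floor_iff (Real.exp_pos _).le).1 hp.1⟩
  have hE := sum_le_euler (σ := 1 - 1 / t) (by linarith) s (fun p hp => (hmem p hp).1) F (by
    intro m hm p hp hpm
    rw [hs, Nat.mem_primesLE]
    exact ⟨Nat.le_floor (hF m hm p hp hpm), hp⟩)
  refine hE.trans ?_
  have key : ∀ p ∈ s, (1 - (p : ℝ) ^ (-(1 - 1 / t)))⁻¹ ≤ Real.exp (8 / t * (Real.log p / p)) * (1 - 1 / (p : ℝ))⁻¹ := by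
    intro p hp
    obtain ⟨hpp, hpe⟩ := hmem p hp
    have hp2 : (2 : ℝ) ≤ p := by exact_mod_cast hpp.two_le
    have hp0 : (0 : ℝ) < p := by linarith
    set y := (p : ℝ) ^ (-(1 - 1 / t)) with hy
    have hlog0 : 0 ≤ Real.log p := Real.log_natCast_nonneg p
    have hlogt : Real.log p ≤ t := (Real.log_le_iff_le_exp hp0).2 hpe
    have hyeq : y = 1 / (p : ℝ) * Real.exp (Real.log p * (1 / t)) := by
      rw [hy, neg_sub, sub_eq_add_neg, Real.rpow_add hp0, Real.rpow_neg_one, Real.rpow_def_of_pos hp0]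
      ring
    have hx0 : 0 ≤ Real.log p * (1 / t) := by positivity
    have hx1 : Real.log p * (1 / t) ≤ 1 := by rw [mul_one_div, div_le_one ht0]; exact hlogt
    have hex : Real.exp (Real.log p * (1 / t)) ≤ 1 + 2 * (Real.log p * (1 / t)) := by
      have := Real.abs_exp_sub_one_le (x := Real.log p * (1 / t)) (by rw [abs_of_nonneg hx0]; exact hx1)
      rw [abs_of_nonneg hx0] at this
      linarith [(abs_le.1 this).2]
    have hyle : y ≤ 3 / 4 := by
      have a : y ≤ (2 : ℝ) ^ (-(1 / 2 : ℝ)) := by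
        rw [hy]
        calc (p : ℝ) ^ (-(1 - 1 / t)) ≤ (p : ℝ) ^ (-(1 / 2 : ℝ)) :=
              Real.rpow_le_rpow_of_exponent_le (by linarith) (by linarith)
          _ ≤ _ := Real.rpow_le_rpow_of_nonpos (by norm_num) hp2 (by norm_num)
      have b : (2 : ℝ) ^ (-(1 / 2 : ℝ)) ≤ 3 / 4 := by
        rw [Real.rpow_neg (by norm_num), ← Real.sqrt_eq_rpow]
        have : (4 / 3 : ℝ) ≤ Real.sqrt 2 := by
          apply Real.le_sqrt_of_sq_le; norm_num
        have h3 := inv_anti₀ (by norm_num) this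
        linarith
      linarith
    have hyd : y - 1 / (p : ℝ) ≤ 2 / t * (Real.log p / p) := by
      have : 1 / (p : ℝ) * Real.exp (Real.log p * (1 / t)) ≤ 1 / (p : ℝ) * (1 + 2 * (Real.log p * (1 / t))) := by gcongr
      have e : 1 / (p : ℝ) * (1 + 2 * (Real.log p * (1 / t))) = 1 / (p : ℝ) + 2 / t * (Real.log p / p) := by
        ring
      rw [hyeq]; linarith
    set z := 2 / t * (Real.log p / p) with hz
    have hz0 : 0 ≤ z := by positivity
    have h8 : 8 / t * (Real.log p / p) = 4 * z := by rw [hz]; ring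
    rw [h8]
    have hexp : 1 + 4 * z ≤ Real.exp (4 * z) := by have := Real.add_one_le_exp (4 * z); linarith
    have h1y : 0 < 1 - y := by linarith
    have h1p : 0 < 1 - 1 / (p : ℝ) := one_sub_inv_pos hpp
    rw [← div_eq_mul_inv, inv_eq_one_div, div_le_div_iff₀ h1y h1p]
    calc 1 * (1 - 1 / (p : ℝ)) ≤ (1 + 4 * z) * (1 - y) := by nlinarith
      _ ≤ _ := by gcongr
  calc _ ≤ ∏ p ∈ s, Real.exp (8 / t * (Real.log p / p)) * (1 - 1 / (p : ℝ))⁻¹ := by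
        apply Finset.prod_le_prod _ key
        intro p hp
        obtain ⟨hpp, hpe⟩ := hmem p hp
        rw [inv_nonneg, sub_nonneg]
        apply Real.rpow_le_one_of_one_le_of_nonpos
        · exact_mod_cast hpp.one_lt.le
        · linarith
    _ = Real.exp (∑ p ∈ s, 8 / t * (Real.log p / p)) * ∏ p ∈ s, (1 - 1 / (p : ℝ))⁻¹ := by
        rw [Finset.prod_mul_distrib, Real.exp_sum]
    _ ≤ Real.exp (8 * (1 + C2)) * (C1 * t) := by
        have a1 := h1 (Real.exp t) (by have := Real.add_one_le_exp t; linarith)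
        rw [Real.log_exp] at a1
        apply mul_le_mul _ a1 (Finset.prod_nonneg (fun p hp => (inv_pos.2 (one_sub_inv_pos (hmem p hp).1)).le)) (Real.exp_pos _).le
        apply Real.exp_le_exp.2
        rw [← Finset.mul_sum]
        have a2 := h2 s 0 t ht0.le (by
          intro p hp
          obtain ⟨hpp, hpe⟩ := hmem p hp
          exact ⟨hpp, Real.log_natCast_nonneg p, (Real.log_le_iff_le_exp (by exact_mod_cast hpp.pos)).2 hpe⟩)
        calc 8 / t * ∑ p ∈ s, Real.log p / p ≤ 8 / t * (t - 0 + C2) := by gcongr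
          _ = 8 * (1 + C2 / t) := by field_simp; ring
          _ ≤ 8 * (1 + C2) := by
            have := div_le_self hC2.le (show 1 ≤ t by linarith)
            linarith
    _ = _ := by ring

lemma smooth_rankin_log : ∃ C : ℝ, 0 < C ∧ ∀ t : ℝ, 2 ≤ t → ∀ F : Finset ℕ,
    (∀ m ∈ F, 1 ≤ m ∧ ∀ p : ℕ, p.Prime → p ∣ m → (p : ℝ) ≤ Real.exp t) →
    ∑ m ∈ F, (t + Real.log m) / m ≤ C * t ^ 2 := by
  obtain ⟨C, hC, h⟩ := smooth_rankin
  refine ⟨2 * C, by positivity, fun t ht F hF => ?_⟩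
  have ht0 : 0 < t := by linarith
  have := h t ht F (fun m hm => (hF m hm).2)
  calc _ ≤ ∑ m ∈ F, 2 * t * (m : ℝ) ^ (-(1 - 1 / t)) := by
        apply Finset.sum_le_sum
        intro m hm
        have hm1 : (1 : ℝ) ≤ m := by exact_mod_cast (hF m hm).1
        have hm0 : (0 : ℝ) < m := by linarith
        have e : (m : ℝ) ^ (-(1 - 1 / t)) = (m : ℝ) ^ (1 / t) / m := by
          rw [neg_sub, Real.rpow_sub hm0, Real.rpow_one]
        rw [e, ← mul_div_assoc]
        apply div_le_div_of_nonneg_right _ hm0.le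
        rw [Real.rpow_def_of_pos hm0]
        have h1 := Real.add_one_le_exp (Real.log m * (1 / t))
        have h2 : t * (Real.log m * (1 / t)) = Real.log m := by field_simp
        have h3 := Real.log_nonneg hm1
        nlinarith
    _ = 2 * t * ∑ m ∈ F, (m : ℝ) ^ (-(1 - 1 / t)) := by rw [Finset.mul_sum]
    _ ≤ 2 * t * (C * t) := by gcongr
    _ = _ := by ring

lemma smooth_tail : ∃ C : ℝ, 0 < C ∧ ∀ t R : ℝ, 2 ≤ t → ∀ F : Finset ℕ,
    (∀ m ∈ F, Real.exp R ≤ m ∧ ∀ p : ℕ, p.Prime → p ∣ m → (p : ℝ) ≤ Real.exp t) →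
    ∑ m ∈ F, 1 / (m : ℝ) ≤ C * t * Real.exp (-(R / t)) := by
  obtain ⟨C, hC, h⟩ := smooth_rankin
  refine ⟨C, by positivity, fun t R ht F hF => ?_⟩
  have ht0 : 0 < t := by linarith
  have := h t ht F (fun m hm => (hF m hm).2)
  calc _ ≤ ∑ m ∈ F, Real.exp (-(R / t)) * (m : ℝ) ^ (-(1 - 1 / t)) := by
        apply Finset.sum_le_sum
        intro m hm
        have hmR := (hF m hm).1
        have hm0 : (0 : ℝ) < m := lt_of_lt_of_le (Real.exp_pos _) hmR
        have e : (m : ℝ) ^ (-(1 - 1 / t)) = (m : ℝ) ^ (1 / t) / m := by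
          rw [neg_sub, Real.rpow_sub hm0, Real.rpow_one]
        rw [e, ← mul_div_assoc]
        apply div_le_div_of_nonneg_right _ hm0.le
        rw [Real.rpow_def_of_pos hm0, ← Real.exp_add]
        apply Real.one_le_exp
        have : R ≤ Real.log m := (Real.le_log_iff_exp_le hm0).2 hmR
        have : R / t ≤ Real.log m * (1 / t) := by rw [mul_one_div]; gcongr
        linarith
    _ = Real.exp (-(R / t)) * ∑ m ∈ F, (m : ℝ) ^ (-(1 - 1 / t)) := by rw [Finset.mul_sum]
    _ ≤ Real.exp (-(R / t)) * (C * t) := by gcongr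
    _ = _ := by ring

noncomputable def rho : ℝ := Real.exp 1 * Real.log 2 / 2

lemma rho_lo : 0.94 < rho := by
  unfold rho
  have h1 := Real.exp_one_gt_d9
  have h2 := l2_lo
  nlinarith

lemma i_sum : ∃ C : ℝ, 0 < C ∧ ∀ I N : ℕ,
    ∑ i ∈ range I, rho ^ i * Real.exp (-(2 ^ N / (4 * 2 ^ i))) / q32 (i + 2) ≤ C * rho ^ N / q32 (N + 1) := by
  have hr1 : rho < 1 := rho_lt
  have hr0 := rho_lo
  have hrp : 0 < rho := by linarith
  have hs : Summable (fun k : ℕ => ((k : ℝ) + 1) ^ 2 * (1 / (2 * rho)) ^ k) := by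
    have hn : ‖(1 / (2 * rho) : ℝ)‖ < 1 := by
      rw [Real.norm_of_nonneg (by positivity), div_lt_one (by positivity)]; linarith
    have h2 := summable_pow_mul_geometric_of_norm_lt_one (R := ℝ) 2 hn
    have h1 := summable_pow_mul_geometric_of_norm_lt_one (R := ℝ) 1 hn
    have h0 := summable_pow_mul_geometric_of_norm_lt_one (R := ℝ) 0 hn
    refine ((h2.add (h1.mul_left 2)).add h0).congr ?_
    intro k; ring
  set S := ∑' k : ℕ, ((k : ℝ) + 1) ^ 2 * (1 / (2 * rho)) ^ k with hS
  have hS0 : 0 ≤ S := tsum_nonneg (fun k => by positivity)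
  refine ⟨(1 - rho)⁻¹ + 4 * S, by have : 0 < (1 - rho)⁻¹ := inv_pos.2 (by linarith)
                                  positivity, fun I N => ?_⟩
  have hqN := q32_pos (n := N + 1) (by omega)
  have hq : ∀ i : ℕ, 0 < q32 (i + 2) := fun i => q32_pos (by omega)
  have nn : ∀ i : ℕ, 0 ≤ rho ^ i * Real.exp (-(2 ^ N / (4 * 2 ^ i))) / q32 (i + 2) := by
    intro i; have := hq i; positivity
  have big : ∑ i ∈ range I, rho ^ i * Real.exp (-(2 ^ N / (4 * 2 ^ i))) / q32 (i + 2) ≤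
      ∑ i ∈ range N, rho ^ i * Real.exp (-(2 ^ N / (4 * 2 ^ i))) / q32 (i + 2) +
      ∑ j ∈ range I, rho ^ (N + j) * Real.exp (-(2 ^ N / (4 * 2 ^ (N + j)))) / q32 (N + j + 2) := by
    rw [← Finset.sum_range_add]
    apply Finset.sum_le_sum_of_subset_of_nonneg
    · intro i; simp only [Finset.mem_range]; omega
    · intro i _ _; exact nn i
  refine big.trans ?_
  have p1 : ∑ j ∈ range I, rho ^ (N + j) * Real.exp (-(2 ^ N / (4 * 2 ^ (N + j)))) / q32 (N + j + 2) ≤ (1 - rho)⁻¹ * rho ^ N / q32 (N + 1) := by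
    have : ∀ j ∈ range I, rho ^ (N + j) * Real.exp (-(2 ^ N / (4 * 2 ^ (N + j)))) / q32 (N + j + 2) ≤ rho ^ N / q32 (N + 1) * rho ^ j := by
      intro j _
      have e1 : Real.exp (-(2 ^ N / (4 * 2 ^ (N + j)))) ≤ 1 := by
        rw [Real.exp_le_one_iff]; rw [neg_nonpos]; positivity
      have e2 : q32 (N + 1) ≤ q32 (N + j + 2) := q32_mono (by omega)
      calc _ ≤ rho ^ (N + j) * 1 / q32 (N + 1) := by gcongr
        _ = _ := by rw [pow_add]; ring
    refine (Finset.sum_le_sum this).trans ?_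
    rw [← Finset.mul_sum]
    have hg : ∑ j ∈ range I, rho ^ j ≤ (1 - rho)⁻¹ := by
      rw [← tsum_geometric_of_lt_one hrp.le hr1]
      exact (summable_geometric_of_lt_one hrp.le hr1).sum_le_tsum _ (fun i _ => by positivity)
    calc _ ≤ rho ^ N / q32 (N + 1) * (1 - rho)⁻¹ := by gcongr
      _ = _ := by ring
  have p2 : ∑ i ∈ range N, rho ^ i * Real.exp (-(2 ^ N / (4 * 2 ^ i))) / q32 (i + 2) ≤ 4 * S * rho ^ N / q32 (N + 1) := by
    rw [← Finset.sum_range_reflect]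
    have : ∀ j ∈ range N, rho ^ (N - 1 - j) * Real.exp (-(2 ^ N / (4 * 2 ^ (N - 1 - j)))) / q32 (N - 1 - j + 2) ≤
        4 * rho ^ N / q32 (N + 1) * ((((j + 1 : ℕ) : ℝ) + 1) ^ 2 * (1 / (2 * rho)) ^ (j + 1)) := by
      intro j hj
      rw [Finset.mem_range] at hj
      obtain ⟨i, hi⟩ : ∃ i, N = i + (j + 1) := ⟨N - 1 - j, by omega⟩
      have hi2 : N - 1 - j = i := by omega
      rw [hi2]
      obtain ⟨k, hk⟩ : ∃ k, k = j + 1 := ⟨_, rfl⟩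
      rw [← hk] at hi ⊢
      have e5 : rho ^ N * (1 / (2 * rho)) ^ k = rho ^ i / 2 ^ k := by
        rw [hi, pow_add, one_div, inv_pow, mul_pow]; field_simp
      have e1 : (2 : ℝ) ^ N / (4 * 2 ^ i) = 2 ^ k / 4 := by rw [hi, pow_add]; field_simp
      have e2 : Real.exp (-(2 ^ k / 4 : ℝ)) ≤ 4 / 2 ^ k := by
        rw [Real.exp_neg, inv_eq_one_div, div_le_div_iff₀ (Real.exp_pos _) (by positivity)]
        have := Real.add_one_le_exp (2 ^ k / 4 : ℝ)
        linarith
      have e3 : q32 (N + 1) ≤ q32 (i + 2) * ((k : ℝ) + 1) ^ 2 := by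
        unfold q32
        have c1 : ((N + 1 : ℕ) : ℝ) ≤ ((i + 2 : ℕ) : ℝ) * ((k : ℝ) + 1) := by
          have : N + 1 ≤ (i + 2) * (k + 1) := by rw [hi]; nlinarith
          exact_mod_cast this
        have c2 : Real.sqrt ((N + 1 : ℕ) : ℝ) ≤ Real.sqrt ((i + 2 : ℕ) : ℝ) * ((k : ℝ) + 1) := by
          rw [Real.sqrt_le_left (by positivity), mul_pow, Real.sq_sqrt (by positivity)]
          refine c1.trans ?_
          apply mul_le_mul_of_nonneg_left _ (by positivity)
          have : (0 : ℝ) ≤ k := by positivity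
          nlinarith
        calc _ ≤ (((i + 2 : ℕ) : ℝ) * ((k : ℝ) + 1)) * (Real.sqrt ((i + 2 : ℕ) : ℝ) * ((k : ℝ) + 1)) := by gcongr
          _ = _ := by ring
      rw [e1]
      have hqi := hq i
      calc rho ^ i * Real.exp (-(2 ^ k / 4)) / q32 (i + 2) ≤ rho ^ i * (4 / 2 ^ k) / q32 (i + 2) := by gcongr
        _ ≤ rho ^ i * (4 / 2 ^ k) * (((k : ℝ) + 1) ^ 2 / q32 (N + 1)) := by
            rw [div_eq_mul_inv]
            apply mul_le_mul_of_nonneg_left _ (by positivity)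
            rw [inv_eq_one_div, div_le_div_iff₀ hqi hqN]; linarith
        _ = 4 * (rho ^ i / 2 ^ k) * (((k : ℝ) + 1) ^ 2 / q32 (N + 1)) := by ring
        _ = _ := by rw [← e5]; ring
    refine (Finset.sum_le_sum this).trans ?_
    rw [← Finset.mul_sum]
    have hg : ∑ j ∈ range N, ((((j + 1 : ℕ) : ℝ) + 1) ^ 2 * (1 / (2 * rho)) ^ (j + 1)) ≤ S := by
      have h1 : ∑ j ∈ range (N + 1), (((j : ℝ) + 1) ^ 2 * (1 / (2 * rho)) ^ j) ≤ S :=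
        hs.sum_le_tsum _ (fun i _ => by positivity)
      rw [Finset.sum_range_succ'] at h1
      have : 0 ≤ (((0 : ℕ) : ℝ) + 1) ^ 2 * (1 / (2 * rho)) ^ 0 := by positivity
      linarith
    calc _ ≤ 4 * rho ^ N / q32 (N + 1) * S := by gcongr
      _ = _ := by ring
  calc _ ≤ 4 * S * rho ^ N / q32 (N + 1) + (1 - rho)⁻¹ * rho ^ N / q32 (N + 1) := add_le_add p2 p1
    _ = _ := by ring

end Erd

namespace Erd
open Finset

def OneSide (t l LQ : ℝ) (n : ℕ) : Prop :=
  ∃ (s : ℕ) (A : Finset ℕ) (p b : ℕ), n = s * (∏ q ∈ A, q) * p * b ∧ 1 ≤ s ∧ (s : ℝ) ≤ Real.exp (l / 2) ∧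
    (∀ r : ℕ, r.Prime → r ∣ s → (r : ℝ) ≤ Real.exp t) ∧ p.Prime ∧ Real.exp t < p ∧
    (∀ q ∈ A, q.Prime ∧ Real.exp t < q ∧ q < p) ∧ p < b ∧ (∀ r : ℕ, r.Prime → r ∣ b → p < r) ∧
    ∃ B ⊆ A, LQ - 2 * t - Real.log s ≤ Real.log p + ∑ q ∈ B, Real.log q ∧
      Real.log p + ∑ q ∈ B, Real.log q ≤ LQ

lemma sum_cover {ι κ : Type*} [DecidableEq ι] (F : Finset ι) (J : Finset κ) (G : κ → Finset ι) (f : ι → ℝ)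
    (hf : ∀ i, 0 ≤ f i) (h : ∀ i ∈ F, ∃ j ∈ J, i ∈ G j) : ∑ i ∈ F, f i ≤ ∑ j ∈ J, ∑ i ∈ G j, f i := by
  calc ∑ i ∈ F, f i ≤ ∑ i ∈ F, ∑ j ∈ J, if i ∈ G j then f i else 0 := by
        apply Finset.sum_le_sum
        intro i hi
        obtain ⟨j, hj, hij⟩ := h i hi
        refine le_trans ?_ (Finset.single_le_sum (f := fun j => if i ∈ G j then f i else 0) (fun j _ => ?_) hj)
        · rw [if_pos hij]
        · split_ifs
          · exact hf i
          · exact le_rfl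
    _ = ∑ j ∈ J, ∑ i ∈ F, if i ∈ G j then f i else 0 := Finset.sum_comm
    _ ≤ _ := by
        apply Finset.sum_le_sum
        intro j _
        rw [← Finset.sum_filter]
        apply Finset.sum_le_sum_of_subset_of_nonneg
        · intro i hi; exact (Finset.mem_filter.1 hi).2
        · intro i _ _; exact hf i

def Cond (t LQ : ℝ) (s : ℕ) (A : Finset ℕ) (p : ℕ) : Prop :=
  ∃ B ⊆ A, LQ - 2 * t - Real.log s ≤ Real.log p + ∑ q ∈ B, Real.log q ∧
      Real.log p + ∑ q ∈ B, Real.log q ≤ LQ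

open Classical in
lemma p_sum1 : ∃ C : ℝ, 0 < C ∧ ∀ (t LQ : ℝ) (s i : ℕ) (A : Finset ℕ), 1 ≤ t → 1 ≤ s →
    ∑ p ∈ (blk t i).filter (Cond t LQ s A), 1 / ((p : ℝ) * Real.log p) ≤
      (Lf t A : ℝ) * (C * (t + Real.log s) / (4 ^ i * t ^ 2)) := by
  obtain ⟨C, hC, h⟩ := mert_int
  refine ⟨3 + C, by positivity, fun t LQ s i A ht hs => ?_⟩
  have ht0 : 0 < t := by linarith
  have hlogs : 0 ≤ Real.log s := Real.log_natCast_nonneg s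
  set J := (A.powerset).image (fun B : Finset ℕ => ⌊(-LQ + ∑ q ∈ B, Real.log q) / t⌋) with hJ
  set G : ℤ → Finset ℕ := fun j => (blk t i).filter (fun p => -2 * t - Real.log s - (j + 1) * t ≤ Real.log p ∧ Real.log p ≤ -j * t) with hG
  have cov := sum_cover ((blk t i).filter (Cond t LQ s A)) J G (fun p => 1 / ((p : ℝ) * Real.log p))
    (fun p => by have := Real.log_natCast_nonneg p; positivity) (by
      intro p hp
      rw [Finset.mem_filter] at hp
      obtain ⟨hp1, B, hB, h1, h2⟩ := hp
      refine ⟨⌊(-LQ + ∑ q ∈ B, Real.log q) / t⌋, Finset.mem_image_of_mem _ (Finset.mem_powerset.2 hB), ?_⟩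
      rw [hG]; simp only
      rw [Finset.mem_filter]
      refine ⟨hp1, ?_⟩
      have f1 := Int.floor_le ((-LQ + ∑ q ∈ B, Real.log q) / t)
      have f2 := Int.lt_floor_add_one ((-LQ + ∑ q ∈ B, Real.log q) / t)
      rw [le_div_iff₀ ht0] at f1
      rw [div_lt_iff₀ ht0] at f2
      constructor <;> linarith)
  refine cov.trans ?_
  have each : ∀ j ∈ J, ∑ p ∈ G j, 1 / ((p : ℝ) * Real.log p) ≤ (3 + C) * (t + Real.log s) / (4 ^ i * t ^ 2) := by
    intro j _
    have hmem : ∀ p ∈ G j, p.Prime ∧ 2 ^ i * t < Real.log p ∧ (-2 * t - Real.log s - (j + 1) * t ≤ Real.log p ∧ Real.log p ≤ -j * t) := by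
      intro p hp
      rw [hG] at hp; simp only at hp
      rw [Finset.mem_filter, blk, mem_PI] at hp
      exact ⟨hp.1.1, (Real.lt_log_iff_exp_lt (by exact_mod_cast hp.1.1.pos)).2 hp.1.2.1, hp.2⟩
    have m := h (G j) (-2 * t - Real.log s - (j + 1) * t) (-j * t) (by nlinarith) (fun p hp => ⟨(hmem p hp).1, (hmem p hp).2.2⟩)
    calc _ ≤ ∑ p ∈ G j, (Real.log p / p) * (1 / (4 ^ i * t ^ 2)) := by
          apply Finset.sum_le_sum
          intro p hp
          obtain ⟨a, b, _⟩ := hmem p hp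
          have hp0 : (0 : ℝ) < p := by exact_mod_cast a.pos
          have h2 : (0 : ℝ) < 2 ^ i * t := by positivity
          have hl : 0 < Real.log p := h2.trans b
          have : (4 : ℝ) ^ i * t ^ 2 ≤ Real.log p ^ 2 := by
            have e : (4 : ℝ) ^ i * t ^ 2 = (2 ^ i * t) ^ 2 := by
              rw [mul_pow, ← pow_mul, mul_comm i 2, pow_mul]; norm_num
            rw [e]; gcongr
          rw [div_mul_div_comm, mul_one, div_le_div_iff₀ (by positivity) (by positivity)]
          nlinarith
      _ = (∑ p ∈ G j, (Real.log p / p)) * (1 / (4 ^ i * t ^ 2)) := by rw [Finset.sum_mul]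
      _ ≤ ((3 + C) * (t + Real.log s)) * (1 / (4 ^ i * t ^ 2)) := by
          gcongr
          refine m.trans ?_
          nlinarith
      _ = _ := by ring
  have hpos : 0 ≤ (3 + C) * (t + Real.log s) / (4 ^ i * t ^ 2) := by positivity
  calc _ ≤ ∑ j ∈ J, (3 + C) * (t + Real.log s) / (4 ^ i * t ^ 2) := Finset.sum_le_sum each
    _ = (J.card : ℝ) * ((3 + C) * (t + Real.log s) / (4 ^ i * t ^ 2)) := by rw [Finset.sum_const, nsmul_eq_mul]
    _ ≤ _ := by
        gcongr
        exact_mod_cast Lx_le t (-LQ) A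

open Classical in
lemma p_sum : ∃ C : ℝ, 0 < C ∧ ∀ (t l LQ : ℝ) (s i N : ℕ) (A : Finset ℕ), 1 ≤ t → 1 ≤ s → (s : ℝ) ≤ Real.exp (l / 2) → l ≤ LQ →
    2 ^ N * t ≤ l → (∀ q ∈ A, 1 ≤ q) →
    ∑ p ∈ (blk t i).filter (Cond t LQ s A), 1 / ((p : ℝ) * Real.log p) ≤
      C * (t + Real.log s) / t ^ 2 * (Real.exp (-(2 ^ N / (4 * 2 ^ i))) / 4 ^ i) *
      ((Lf t A : ℝ) * ∏ q ∈ A, (q : ℝ) ^ (1 / (2 ^ (i + 1) * t))) := by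
  obtain ⟨C, hC, h⟩ := p_sum1
  refine ⟨Real.exp 2 * C, by positivity, fun t l LQ s i N A ht hs hsl hlQ hN hA => ?_⟩
  have ht0 : 0 < t := by linarith
  have hlogs : 0 ≤ Real.log s := Real.log_natCast_nonneg s
  have hs0 : (0 : ℝ) < s := by exact_mod_cast hs
  by_cases hne : ((blk t i).filter (Cond t LQ s A)).Nonempty
  · obtain ⟨p, hp⟩ := hne
    rw [Finset.mem_filter, blk, mem_PI] at hp
    obtain ⟨⟨hpp, _, hp2⟩, B, hB, h1, h2⟩ := hp
    have hlp : Real.log p ≤ 2 ^ (i + 1) * t := (Real.log_le_iff_le_exp (by exact_mod_cast hpp.pos)).2 hp2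
    have hls : Real.log s ≤ l / 2 := (Real.log_le_iff_le_exp hs0).2 hsl
    have hBA : ∑ q ∈ B, Real.log q ≤ ∑ q ∈ A, Real.log q :=
      Finset.sum_le_sum_of_subset_of_nonneg hB (fun q _ _ => Real.log_natCast_nonneg q)
    set κ := 1 / (2 ^ (i + 1) * t) with hκ
    have hκ0 : 0 < κ := by positivity
    have e1 : ∏ q ∈ A, (q : ℝ) ^ κ = Real.exp (κ * ∑ q ∈ A, Real.log q) := by
      rw [Finset.mul_sum, Real.exp_sum]
      apply Finset.prod_congr rfl
      intro q hq
      rw [Real.rpow_def_of_pos (by exact_mod_cast hA q hq), mul_comm]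
    have e2 : 1 ≤ Real.exp 2 * Real.exp (-(2 ^ N / (4 * 2 ^ i))) * ∏ q ∈ A, (q : ℝ) ^ κ := by
      rw [e1, ← Real.exp_add, ← Real.exp_add]
      apply Real.one_le_exp
      have g1 : l / 2 - 2 * t - 2 ^ (i + 1) * t ≤ ∑ q ∈ A, Real.log q := by linarith
      have g2 : κ * (l / 2 - 2 * t - 2 ^ (i + 1) * t) ≤ κ * ∑ q ∈ A, Real.log q := by gcongr
      have g3 : κ * (l / 2 - 2 * t - 2 ^ (i + 1) * t) = l / t / (4 * 2 ^ i) - 1 / 2 ^ i - 1 := by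
        rw [hκ, pow_succ]; field_simp; ring
      have g4 : (2 : ℝ) ^ N / (4 * 2 ^ i) ≤ l / t / (4 * 2 ^ i) := by
        gcongr
        rw [le_div_iff₀ ht0]; exact hN
      have g5 : 1 / (2 : ℝ) ^ i ≤ 1 := by
        rw [div_le_one (by positivity)]; exact one_le_pow₀ (by norm_num)
      linarith
    refine (h t LQ s i A ht hs).trans ?_
    have nn : 0 ≤ (Lf t A : ℝ) * (C * (t + Real.log s) / (4 ^ i * t ^ 2)) := by positivity
    calc _ ≤ ((Lf t A : ℝ) * (C * (t + Real.log s) / (4 ^ i * t ^ 2))) * (Real.exp 2 * Real.exp (-(2 ^ N / (4 * 2 ^ i))) * ∏ q ∈ A, (q : ℝ) ^ κ) :=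
          le_mul_of_one_le_right nn e2
      _ = _ := by field_simp
  · rw [Finset.not_nonempty_iff_eq_empty] at hne
    rw [hne, Finset.sum_empty]
    positivity

lemma b_cnt : ∃ C : ℝ, 0 < C ∧ ∀ (p : ℕ) (X : ℝ), p.Prime → 0 ≤ X →
    cnt (fun b => p < b ∧ ∀ r : ℕ, r.Prime → r ∣ b → p < r) X ≤ C * X / Real.log p := by
  obtain ⟨C, hC, h⟩ := rough_cnt
  refine ⟨C, hC, fun p X hp hX => ?_⟩
  have hlog : 0 ≤ Real.log p := Real.log_natCast_nonneg p
  rcases lt_or_ge X p with hXp | hXp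
  · have : cnt (fun b => p < b ∧ ∀ r : ℕ, r.Prime → r ∣ b → p < r) X ≤ cnt (fun _ => False) X := by
      apply cnt_mono
      rintro m _ hm ⟨h1, _⟩
      have : (p : ℝ) < m := by exact_mod_cast h1
      linarith
    refine this.trans ?_
    have : cnt (fun _ => False) X = 0 := by simp [cnt]
    rw [this]; positivity
  · have h1 := h p X (by exact_mod_cast hp.two_le) hXp
    rw [← mul_div_assoc] at h1
    refine le_trans (cnt_mono ?_) h1
    rintro m _ hm ⟨_, h2⟩ r hr hrp hrm
    have := h2 r hr hrm
    have : r ≤ p := by exact_mod_cast hrp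
    omega

open Classical in
lemma one_side : ∃ C : ℝ, 0 < C ∧ ∀ (t l LQ x : ℝ) (N : ℕ), 2 ≤ t → l ≤ LQ → 2 ^ N * t ≤ l → 1 ≤ x →
    cnt (OneSide t l LQ) x ≤ C * x * rho ^ N / q32 (N + 1) := by
  obtain ⟨C0, hC0, h0⟩ := b_cnt
  obtain ⟨C1, hC1, h1⟩ := p_sum
  obtain ⟨C2, hC2, h2⟩ := smooth_rankin_log
  obtain ⟨C3, hC3, h3⟩ := T_bound
  obtain ⟨C4, hC4, h4⟩ := i_sum
  have hr0 := rho_lo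
  have hrp : 0 < rho := by linarith
  refine ⟨C0 * (C1 * C2) * (C3 * (4 * rho)) * C4, by positivity, fun t l LQ x N ht hlQ hN hx => ?_⟩
  have ht0 : 0 < t := by linarith
  have hx0 : 0 < x := by linarith
  set S := (Icc 1 ⌊x⌋₊).filter (fun s : ℕ => (s : ℝ) ≤ Real.exp (l / 2) ∧ ∀ r : ℕ, r.Prime → r ∣ s → (r : ℝ) ≤ Real.exp t) with hS
  set I := ⌈Real.log x⌉₊ with hI
  have hIx : Real.log x ≤ 2 ^ I * t := by
    have a1 : Real.log x ≤ I := Nat.le_ceil _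
    have a2 : (I : ℝ) ≤ 2 ^ I := by exact_mod_cast (Nat.lt_two_pow_self).le
    have a3 : (1 : ℝ) ≤ 2 ^ I := one_le_pow₀ (by norm_num)
    nlinarith
  set U : ℕ → Finset ℕ := fun i => PI (Real.exp t) (Real.exp (2 ^ (i + 1) * t)) with hU
  set bs : ℕ → Finset ℕ → ℕ → Finset ℕ := fun s A p =>
    (Icc 1 ⌊x / ((s : ℝ) * (∏ q ∈ A, (q : ℝ)) * p)⌋₊).filter (fun b => p < b ∧ ∀ r : ℕ, r.Prime → r ∣ b → p < r) with hbs
  have hsub : (Icc 1 ⌊x⌋₊).filter (OneSide t l LQ) ⊆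
      S.biUnion fun s => (range I).biUnion fun i => (U i).powerset.biUnion fun A =>
        ((blk t i).filter (Cond t LQ s A)).biUnion fun p =>
          (bs s A p).image (fun b => s * (∏ q ∈ A, q) * p * b) := by
    intro n hn
    rw [Finset.mem_filter, Finset.mem_Icc] at hn
    obtain ⟨⟨hn1, hnx⟩, s, A, p, b, hnn, hs1, hsl, hsm, hp, hpt, hA, hpb, hbr, hB⟩ := hn
    have hApos : 0 < ∏ q ∈ A, q := Finset.prod_pos (fun q hq => (hA q hq).1.pos)
    have hb1 : 1 ≤ b := by omega
    have hp1 := hp.pos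
    have hnx' : (n : ℝ) ≤ x := (Nat.le_floor_iff hx0.le).1 hnx
    have hsn : s ≤ n := Nat.le_of_dvd (by omega) (by rw [hnn, mul_assoc, mul_assoc]; exact Dvd.intro _ rfl)
    have hpn : p ≤ n := Nat.le_of_dvd (by omega) (by rw [hnn]; exact (Dvd.intro_left _ rfl).mul_right _)
    have hp0 : (0 : ℝ) < p := by exact_mod_cast hp1
    have hpx : Real.log p ≤ 2 ^ I * t := by
      refine le_trans (Real.log_le_log hp0 ?_) hIx
      exact le_trans (by exact_mod_cast hpn) hnx'
    have hpU : p ∈ (range I).biUnion (blk t) := by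
      rw [blk_union ht0.le, mem_PI]
      exact ⟨hp, hpt, (Real.log_le_iff_le_exp hp0).1 hpx⟩
    rw [Finset.mem_biUnion] at hpU
    obtain ⟨i, hi, hpi⟩ := hpU
    rw [Finset.mem_biUnion]
    refine ⟨s, ?_, ?_⟩
    · rw [hS, Finset.mem_filter, Finset.mem_Icc]
      exact ⟨⟨hs1, hsn.trans hnx⟩, hsl, hsm⟩
    rw [Finset.mem_biUnion]
    refine ⟨i, hi, ?_⟩
    rw [Finset.mem_biUnion]
    refine ⟨A, ?_, ?_⟩
    · rw [Finset.mem_powerset]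
      intro q hq
      rw [hU]; simp only
      rw [mem_PI]
      refine ⟨(hA q hq).1, (hA q hq).2.1, ?_⟩
      rw [blk, mem_PI] at hpi
      refine le_trans ?_ hpi.2.2
      exact_mod_cast (hA q hq).2.2.le
    rw [Finset.mem_biUnion]
    refine ⟨p, ?_, ?_⟩
    · rw [Finset.mem_filter]; exact ⟨hpi, hB⟩
    rw [Finset.mem_image]
    refine ⟨b, ?_, hnn.symm⟩
    rw [hbs]; simp only
    rw [Finset.mem_filter, Finset.mem_Icc]
    refine ⟨⟨hb1, Nat.le_floor ?_⟩, hpb, hbr⟩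
    have hs0 : (0 : ℝ) < s := by exact_mod_cast hs1
    have hA0 : (0 : ℝ) < ∏ q ∈ A, (q : ℝ) := Finset.prod_pos (fun q hq => by exact_mod_cast (hA q hq).1.pos)
    rw [le_div_iff₀ (by positivity)]
    have : ((s * (∏ q ∈ A, q) * p * b : ℕ) : ℝ) = (b : ℝ) * ((s : ℝ) * (∏ q ∈ A, (q : ℝ)) * p) := by push_cast; ring
    rw [← this, ← hnn]; exact hnx'
  have hcard : cnt (OneSide t l LQ) x ≤ ∑ s ∈ S, ∑ i ∈ range I, ∑ A ∈ (U i).powerset,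
      ∑ p ∈ (blk t i).filter (Cond t LQ s A), ((bs s A p).card : ℝ) := by
    have a0 : ((Icc 1 ⌊x⌋₊).filter (OneSide t l LQ)).card ≤ ∑ s ∈ S, ∑ i ∈ range I, ∑ A ∈ (U i).powerset,
      ∑ p ∈ (blk t i).filter (Cond t LQ s A), (bs s A p).card := by
      refine (Finset.card_le_card hsub).trans ?_
      refine Finset.card_biUnion_le.trans (Finset.sum_le_sum fun s _ => ?_)
      refine Finset.card_biUnion_le.trans (Finset.sum_le_sum fun i _ => ?_)
      refine Finset.card_biUnion_le.trans (Finset.sum_le_sum fun A _ => ?_)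
      refine Finset.card_biUnion_le.trans (Finset.sum_le_sum fun p _ => ?_)
      exact Finset.card_image_le
    unfold cnt
    exact_mod_cast a0
  refine hcard.trans ?_
  have hApos : ∀ i, ∀ A ∈ (U i).powerset, ∀ q ∈ A, q.Prime := by
    intro i A hA q hq
    exact (mem_PI.1 (Finset.mem_powerset.1 hA hq)).1
  have inner : ∀ s ∈ S, ∀ i ∈ range I, ∀ A ∈ (U i).powerset,
      ∑ p ∈ (blk t i).filter (Cond t LQ s A), ((bs s A p).card : ℝ) ≤
      C0 * C1 * x * ((t + Real.log s) / s / t ^ 2) * (Real.exp (-(2 ^ N / (4 * 2 ^ i))) / 4 ^ i *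
       ((Lf t A : ℝ) * ∏ q ∈ A, ((1 / (q : ℝ)) * (q : ℝ) ^ (1 / (2 ^ (i + 1) * t))))) := by
    intro s hs i hi A hA
    rw [hS, Finset.mem_filter, Finset.mem_Icc] at hs
    have hs0 : (0 : ℝ) < s := by exact_mod_cast hs.1.1
    have hA0 : (0 : ℝ) < ∏ q ∈ A, (q : ℝ) := Finset.prod_pos (fun q hq => by exact_mod_cast (hApos i A hA q hq).pos)
    have b1 : ∀ p ∈ (blk t i).filter (Cond t LQ s A), ((bs s A p).card : ℝ) ≤
        C0 * x / (s * ∏ q ∈ A, (q : ℝ)) * (1 / ((p : ℝ) * Real.log p)) := by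
      intro p hp
      rw [Finset.mem_filter, blk, mem_PI] at hp
      have hp0 : (0 : ℝ) < p := by exact_mod_cast hp.1.1.pos
      have := h0 p (x / ((s : ℝ) * (∏ q ∈ A, (q : ℝ)) * p)) hp.1.1 (by positivity)
      unfold cnt at this
      refine le_trans (le_of_eq ?_) (this.trans (le_of_eq ?_))
      · rw [hbs]; simp only; congr!
      · field_simp
    refine (Finset.sum_le_sum b1).trans ?_
    rw [← Finset.mul_sum]
    have b2 := h1 t l LQ s i N A (by linarith) hs.1.1 hs.2.1 hlQ hN (fun q hq => (hApos i A hA q hq).pos)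
    refine (mul_le_mul_of_nonneg_left b2 (by positivity)).trans (le_of_eq ?_)
    rw [Finset.prod_mul_distrib]
    have : ∏ q ∈ A, (1 / (q : ℝ)) = 1 / ∏ q ∈ A, (q : ℝ) := by
      rw [Finset.prod_div_distrib, Finset.prod_const_one]
    rw [this]
    field_simp
  have hslog : ∑ s ∈ S, (t + Real.log s) / s ≤ C2 * t ^ 2 := h2 t ht S (by
    intro m hm
    rw [hS, Finset.mem_filter, Finset.mem_Icc] at hm
    exact ⟨hm.1.1, hm.2.2⟩)
  have hE : ∑ i ∈ range I, ∑ A ∈ (U i).powerset, (Real.exp (-(2 ^ N / (4 * 2 ^ i))) / 4 ^ i *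
       ((Lf t A : ℝ) * ∏ q ∈ A, ((1 / (q : ℝ)) * (q : ℝ) ^ (1 / (2 ^ (i + 1) * t))))) ≤ C3 * (4 * rho) * (C4 * rho ^ N / q32 (N + 1)) := by
    have e1 : ∀ i ∈ range I, ∑ A ∈ (U i).powerset, (Real.exp (-(2 ^ N / (4 * 2 ^ i))) / 4 ^ i *
       ((Lf t A : ℝ) * ∏ q ∈ A, ((1 / (q : ℝ)) * (q : ℝ) ^ (1 / (2 ^ (i + 1) * t))))) ≤
       C3 * (4 * rho) * (rho ^ i * Real.exp (-(2 ^ N / (4 * 2 ^ i))) / q32 (i + 2)) := by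
      intro i _
      rw [← Finset.mul_sum]
      have := h3 t (by linarith) (i + 1)
      refine (mul_le_mul_of_nonneg_left this (by positivity)).trans (le_of_eq ?_)
      have e : 2 * Real.exp 1 * Real.log 2 = 4 * rho := by unfold rho; ring
      rw [e, pow_succ, mul_pow]
      field_simp
    refine (Finset.sum_le_sum e1).trans ?_
    rw [← Finset.mul_sum]
    exact mul_le_mul_of_nonneg_left (h4 I N) (by positivity)
  calc _ ≤ ∑ s ∈ S, ∑ i ∈ range I, ∑ A ∈ (U i).powerset,
      C0 * C1 * x * ((t + Real.log s) / s / t ^ 2) * (Real.exp (-(2 ^ N / (4 * 2 ^ i))) / 4 ^ i *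
       ((Lf t A : ℝ) * ∏ q ∈ A, ((1 / (q : ℝ)) * (q : ℝ) ^ (1 / (2 ^ (i + 1) * t))))) :=
        Finset.sum_le_sum fun s hs => Finset.sum_le_sum fun i hi => Finset.sum_le_sum fun A hA => inner s hs i hi A hA
    _ = C0 * C1 * x * ((∑ s ∈ S, (t + Real.log s) / s) / t ^ 2) * ∑ i ∈ range I, ∑ A ∈ (U i).powerset, (Real.exp (-(2 ^ N / (4 * 2 ^ i))) / 4 ^ i *
       ((Lf t A : ℝ) * ∏ q ∈ A, ((1 / (q : ℝ)) * (q : ℝ) ^ (1 / (2 ^ (i + 1) * t))))) := by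
        simp only [← Finset.mul_sum, ← Finset.sum_mul, ← Finset.sum_div]
    _ ≤ C0 * C1 * x * (C2 * t ^ 2 / t ^ 2) * (C3 * (4 * rho) * (C4 * rho ^ N / q32 (N + 1))) := by
        have : 0 ≤ C4 * rho ^ N / q32 (N + 1) := by
          have := q32_pos (n := N + 1) (by omega)
          positivity
        have : 0 ≤ ∑ i ∈ range I, ∑ A ∈ (U i).powerset, (Real.exp (-(2 ^ N / (4 * 2 ^ i))) / 4 ^ i *
          ((Lf t A : ℝ) * ∏ q ∈ A, ((1 / (q : ℝ)) * (q : ℝ) ^ (1 / (2 ^ (i + 1) * t))))) := by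
          apply Finset.sum_nonneg; intro i _
          apply Finset.sum_nonneg; intro A _
          positivity
        gcongr
    _ = _ := by field_simp

end Erd

namespace Erd
open Finset

lemma dec_aux (w : ℝ) (D E : ℕ) (hsq : Squarefree (D * E)) (hD : 1 < D)
    (hmax : D.primeFactors.sup id < E.primeFactors.sup id) (hE : 1 < E)
    (hr : ∀ r : ℕ, r.Prime → r ∣ D * E → w < r) :
    ∃ (A : Finset ℕ) (p b : ℕ), D * E = (∏ q ∈ A, q) * p * b ∧ p.Prime ∧ w < p ∧
    (∀ q ∈ A, q.Prime ∧ w < q ∧ q < p) ∧ p < b ∧ (∀ r : ℕ, r.Prime → r ∣ b → p < r) ∧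
    ∃ B ⊆ A, Real.log p + ∑ q ∈ B, Real.log q = Real.log D := by
  have hD0 : D ≠ 0 := by omega
  have hE0 : E ≠ 0 := by omega
  have hDE0 : D * E ≠ 0 := mul_ne_zero hD0 hE0
  have hDne : D.primeFactors.Nonempty := Nat.nonempty_primeFactors.2 hD
  have hEne : E.primeFactors.Nonempty := Nat.nonempty_primeFactors.2 hE
  obtain ⟨p, hp, hpe⟩ := Finset.exists_mem_eq_sup D.primeFactors hDne id
  obtain ⟨q', hq', hqe⟩ := Finset.exists_mem_eq_sup E.primeFactors hEne id
  simp only [id] at hpe hqe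
  have hpmax : ∀ r ∈ D.primeFactors, r ≤ p := by
    intro r hr; rw [← hpe]; exact Finset.le_sup (f := id) hr
  have hpq : p < q' := by
    have h := hmax
    rw [hqe] at h
    calc p = D.primeFactors.sup id := hpe.symm
      _ < q' := h
  have hpp : p.Prime := Nat.prime_of_mem_primeFactors hp
  set PF := (D * E).primeFactors with hPF
  have hDsub : D.primeFactors ⊆ PF := Nat.primeFactors_mono (Dvd.intro _ rfl) hDE0
  have hEsub : E.primeFactors ⊆ PF := Nat.primeFactors_mono (Dvd.intro_left _ rfl) hDE0
  have hmem : ∀ r ∈ PF, r.Prime ∧ w < r := fun r h => ⟨Nat.prime_of_mem_primeFactors h, hr r (Nat.prime_of_mem_primeFactors h) (Nat.dvd_of_mem_primeFactors h)⟩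
  refine ⟨PF.filter (· < p), p, ∏ q ∈ PF.filter (p < ·), q, ?_, hpp, (hmem p (hDsub hp)).2, ?_, ?_, ?_, D.primeFactors.erase p, ?_, ?_⟩
  · rw [← Nat.prod_primeFactors_of_squarefree hsq, ← hPF]
    have e1 : PF = (PF.filter (· < p)) ∪ ({p} ∪ (PF.filter (p < ·))) := by
      ext r
      simp only [Finset.mem_union, Finset.mem_filter, Finset.mem_singleton]
      constructor
      · intro h
        rcases lt_trichotomy r p with h1 | h1 | h1
        · exact Or.inl ⟨h, h1⟩
        · exact Or.inr (Or.inl h1)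
        · exact Or.inr (Or.inr ⟨h, h1⟩)
      · rintro (h | h | h)
        · exact h.1
        · rw [h]; exact hDsub hp
        · exact h.1
    conv_lhs => rw [e1]
    rw [Finset.prod_union, Finset.prod_union, Finset.prod_singleton, mul_assoc]
    · rw [Finset.disjoint_left]; intro r h1 h2
      simp only [Finset.mem_filter, Finset.mem_singleton] at h1 h2
      omega
    · rw [Finset.disjoint_left]; intro r h1 h2
      simp only [Finset.mem_union, Finset.mem_filter, Finset.mem_singleton] at h1 h2
      omega
  · intro q hq
    rw [Finset.mem_filter] at hq
    exact ⟨(hmem q hq.1).1, (hmem q hq.1).2, hq.2⟩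
  · have hin : q' ∈ PF.filter (p < ·) := Finset.mem_filter.2 ⟨hEsub hq', hpq⟩
    refine lt_of_lt_of_le hpq (Nat.le_of_dvd ?_ (Finset.dvd_prod_of_mem _ hin))
    apply Finset.prod_pos
    intro r hr
    exact (hmem r (Finset.mem_filter.1 hr).1).1.pos
  · intro r hrp hrd
    rw [Prime.dvd_finset_prod_iff hrp.prime] at hrd
    obtain ⟨q, hq, hrq⟩ := hrd
    rw [Finset.mem_filter] at hq
    rw [(Nat.prime_dvd_prime_iff_eq hrp (hmem q hq.1).1).1 hrq]
    exact hq.2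
  · intro r hr
    rw [Finset.mem_erase] at hr
    rw [Finset.mem_filter]
    exact ⟨hDsub hr.2, lt_of_le_of_ne (hpmax r hr.2) hr.1⟩
  · rw [Finset.add_sum_erase _ (fun q : ℕ => Real.log q) hp]
    have hsD : Squarefree D := hsq.of_mul_left
    conv_rhs => rw [← Nat.prod_primeFactors_of_squarefree hsD]
    push_cast
    rw [Real.log_prod]
    intro q hq
    exact_mod_cast (Nat.prime_of_mem_primeFactors hq).ne_zero

lemma split_part (P : ℕ → Prop) (n : ℕ) (hn : n ≠ 0) : ∃ s m, n = s * m ∧ (∀ p : ℕ, p.Prime → p ∣ s → P p) ∧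
    (∀ p : ℕ, p.Prime → p ∣ m → ¬ P p) := by
  induction n using Nat.recOnMul with
  | zero => exact absurd rfl hn
  | one => exact ⟨1, 1, rfl, fun p hp h => absurd (Nat.dvd_one.1 h) hp.ne_one, fun p hp h => absurd (Nat.dvd_one.1 h) hp.ne_one⟩
  | prime q hq =>
    by_cases h : P q
    · exact ⟨q, 1, by simp, fun p hp hpq => by rwa [(Nat.prime_dvd_prime_iff_eq hp hq).1 hpq], fun p hp h => absurd (Nat.dvd_one.1 h) hp.ne_one⟩
    · exact ⟨1, q, by simp, fun p hp h => absurd (Nat.dvd_one.1 h) hp.ne_one, fun p hp hpq => by rwa [(Nat.prime_dvd_prime_iff_eq hp hq).1 hpq]⟩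
  | mul a b iha ihb =>
    obtain ⟨s1, m1, e1, h1, h1'⟩ := iha (left_ne_zero_of_mul hn)
    obtain ⟨s2, m2, e2, h2, h2'⟩ := ihb (right_ne_zero_of_mul hn)
    refine ⟨s1 * s2, m1 * m2, by rw [e1, e2]; ring, ?_, ?_⟩
    · intro p hp h
      rcases (Nat.Prime.dvd_mul hp).1 h with h | h
      · exact h1 p hp h
      · exact h2 p hp h
    · intro p hp h
      rcases (Nat.Prime.dvd_mul hp).1 h with h | h
      · exact h1' p hp h
      · exact h2' p hp h

lemma cnt_dvd_le (F : Finset ℕ) {x : ℝ} (hx : 0 ≤ x) : cnt (fun n => ∃ k ∈ F, k ∣ n) x ≤ ∑ k ∈ F, x / k := by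
  classical
  have hsub : (Icc 1 ⌊x⌋₊).filter (fun n => ∃ k ∈ F, k ∣ n) ⊆ F.biUnion (fun k => (Ioc 0 ⌊x⌋₊).filter (k ∣ ·)) := by
    intro n hn
    rw [Finset.mem_filter, Finset.mem_Icc] at hn
    obtain ⟨⟨h1, h2⟩, k, hk, hkn⟩ := hn
    rw [Finset.mem_biUnion]
    exact ⟨k, hk, by rw [Finset.mem_filter, Finset.mem_Ioc]; exact ⟨⟨by omega, h2⟩, hkn⟩⟩
  have h1 : ((Icc 1 ⌊x⌋₊).filter (fun n => ∃ k ∈ F, k ∣ n)).card ≤ ∑ k ∈ F, ⌊x⌋₊ / k := by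
    refine (Finset.card_le_card hsub).trans (Finset.card_biUnion_le.trans (Finset.sum_le_sum fun k _ => ?_))
    rw [Nat.Ioc_filter_dvd_card_eq_div]
  unfold cnt
  calc _ ≤ ((∑ k ∈ F, ⌊x⌋₊ / k : ℕ) : ℝ) := by
        refine le_trans (le_of_eq ?_) (Nat.cast_le.2 h1)
        congr!
    _ = ∑ k ∈ F, ((⌊x⌋₊ / k : ℕ) : ℝ) := by push_cast; rfl
    _ ≤ _ := by
        apply Finset.sum_le_sum
        intro k _
        refine Nat.cast_div_le.trans ?_
        gcongr
        exact Nat.floor_le hx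

def EdgeL (a t : ℝ) (n : ℕ) : Prop := ∃ d : ℕ, d ∣ n ∧ a ≤ Real.log d ∧ Real.log d ≤ a + t

lemma edge_cover {t l a x : ℝ} (ht : 2 ≤ t) (htl : 4 * t < l) (hla : l ≤ a) (hax : a + l ≤ Real.log x) (hx : 1 ≤ x) (n : ℕ)
    (hn1 : 1 ≤ n) (hnx : (n : ℝ) ≤ x) (hE : EdgeL a t n) :
    ((n : ℝ) ≤ x * Real.exp (-t)) ∨ (∃ p : ℕ, Real.exp t < p ∧ p ^ 2 ∣ n) ∨
    (∃ s : ℕ, Real.exp (l / 2) ≤ s ∧ (∀ r : ℕ, r.Prime → r ∣ s → (r : ℝ) ≤ Real.exp t) ∧ s ∣ n) ∨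
    (OneSide t l (a + t) n ∨ OneSide t l (Real.log x - a) n) := by
  by_contra hcon
  push Not at hcon
  obtain ⟨h1, h2, h3, h4, h5⟩ := hcon
  have hx0 : 0 < x := by linarith
  have hn0 : n ≠ 0 := by omega
  have hnR : (0 : ℝ) < n := by exact_mod_cast hn1
  obtain ⟨s, m, hsm, hs, hm⟩ := split_part (fun p => (p : ℝ) ≤ Real.exp t) n hn0
  simp only [not_le] at hm
  have hs0 : s ≠ 0 := by rintro rfl; simp at hsm; exact hn0 hsm
  have hm0 : m ≠ 0 := by rintro rfl; simp at hsm; exact hn0 hsm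
  have hsl : (s : ℝ) < Real.exp (l / 2) := by
    by_contra hc
    push Not at hc
    exact h3 s hc hs (Dvd.intro _ hsm.symm)
  have hsR : (0 : ℝ) < s := by exact_mod_cast Nat.pos_of_ne_zero hs0
  have hlogs : Real.log s ≤ l / 2 := (Real.log_le_iff_le_exp hsR).2 hsl.le
  have hmsq : Squarefree m := by
    rw [Nat.squarefree_iff_prime_squarefree]
    intro p hp hpp
    have := hm p hp (dvd_trans (Dvd.intro _ rfl) hpp)
    apply h2 p this
    rw [sq, hsm]
    exact hpp.mul_left _
  obtain ⟨d, hdn, hd1, hd2⟩ := hE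
  rw [hsm] at hdn
  obtain ⟨d1, d2, hd1s, hd2m, rfl⟩ := exists_dvd_and_dvd_of_dvd_mul hdn
  obtain ⟨s', hs'⟩ := hd1s
  obtain ⟨E, hE⟩ := hd2m
  have hd10 : d1 ≠ 0 := by rintro rfl; simp at hs'; exact hs0 hs'
  have hd20 : d2 ≠ 0 := by rintro rfl; simp at hE; exact hm0 hE
  have hs'0 : s' ≠ 0 := by rintro rfl; simp at hs'; exact hs0 hs'
  have hE0 : E ≠ 0 := by rintro rfl; simp at hE; exact hm0 hE
  have p1 : (d1 : ℝ) ≠ 0 := by exact_mod_cast hd10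
  have p2 : (d2 : ℝ) ≠ 0 := by exact_mod_cast hd20
  have p3 : (s' : ℝ) ≠ 0 := by exact_mod_cast hs'0
  have p4 : (E : ℝ) ≠ 0 := by exact_mod_cast hE0
  have L1 : Real.log s = Real.log d1 + Real.log s' := by
    rw [hs']; push_cast; rw [Real.log_mul p1 p3]
  have L2 : Real.log n = Real.log s + (Real.log d2 + Real.log E) := by
    rw [hsm, hE]; push_cast; rw [Real.log_mul hsR.ne' (mul_ne_zero p2 p4), Real.log_mul p2 p4]
  push_cast at hd1 hd2
  rw [Real.log_mul p1 p2] at hd1 hd2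
  have g1 := Real.log_natCast_nonneg d1
  have g2 := Real.log_natCast_nonneg s'
  have hnlow : Real.log x - t ≤ Real.log n := by
    have := Real.log_le_log (by positivity) h1.le
    rw [Real.log_mul hx0.ne' (Real.exp_pos _).ne', Real.log_exp] at this
    linarith
  have hnup : Real.log n ≤ Real.log x := Real.log_le_log hnR hnx
  have hd2big : 0 < Real.log d2 := by linarith
  have hEbig : 0 < Real.log E := by linarith
  have hD1 : 1 < d2 := by
    by_contra hc
    have : d2 = 1 := by omega
    rw [this] at hd2big; simp at hd2big
  have hE1 : 1 < E := by
    by_contra hc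
    have : E = 1 := by omega
    rw [this] at hEbig; simp at hEbig
  have hcop : Nat.Coprime d2 E := by
    have := hmsq; rw [hE] at this
    exact (Nat.squarefree_mul_iff.1 this).1
  have hs1 : 1 ≤ s := Nat.pos_of_ne_zero hs0
  have hne : d2.primeFactors.sup id ≠ E.primeFactors.sup id := by
    intro he
    obtain ⟨p, hp, hpe⟩ := Finset.exists_mem_eq_sup d2.primeFactors (Nat.nonempty_primeFactors.2 hD1) id
    obtain ⟨q, hq, hqe⟩ := Finset.exists_mem_eq_sup E.primeFactors (Nat.nonempty_primeFactors.2 hE1) id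
    have : p = q := by
      simp only [id] at hpe hqe
      calc p = d2.primeFactors.sup id := hpe.symm
        _ = E.primeFactors.sup id := he
        _ = q := hqe
    rw [← this] at hq
    have := Nat.dvd_gcd (Nat.dvd_of_mem_primeFactors hp) (Nat.dvd_of_mem_primeFactors hq)
    rw [hcop.gcd_eq_one] at this
    exact (Nat.prime_of_mem_primeFactors hp).ne_one (Nat.dvd_one.1 this)
  rcases lt_or_gt_of_ne hne with hlt | hlt
  · apply h4
    obtain ⟨A, p, b, e, q1, q2, q3, q4, q5, B, hB, q6⟩ := dec_aux (Real.exp t) d2 E (hE ▸ hmsq) hD1 hlt hE1 (by rw [← hE]; exact hm)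
    refine ⟨s, A, p, b, ?_, hs1, hsl.le, hs, q1, q2, q3, q4, q5, B, hB, ?_, ?_⟩
    · rw [hsm, hE, e]; ring
    · rw [q6]; linarith
    · rw [q6]; linarith
  · apply h5
    have hE' : m = E * d2 := by rw [hE]; ring
    obtain ⟨A, p, b, e, q1, q2, q3, q4, q5, B, hB, q6⟩ := dec_aux (Real.exp t) E d2 (hE' ▸ hmsq) hE1 hlt hD1 (by rw [← hE']; exact hm)
    refine ⟨s, A, p, b, ?_, hs1, hsl.le, hs, q1, q2, q3, q4, q5, B, hB, ?_, ?_⟩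
    · rw [hsm, hE', e]; ring
    · rw [q6]; linarith
    · rw [q6]; linarith

lemma edge_raw : ∃ C : ℝ, 0 < C ∧ ∀ (t l a x : ℝ) (N : ℕ), 2 ≤ t → 4 * t < l → 2 ^ N * t ≤ l → l ≤ a → a + l ≤ Real.log x → 1 ≤ x →
    cnt (EdgeL a t) x ≤ C * x * (Real.exp (-t) + t * Real.exp (-(l / 2 / t)) + rho ^ N / q32 (N + 1)) := by
  classical
  obtain ⟨C1, hC1, h1⟩ := one_side
  obtain ⟨C2, hC2, h2⟩ := smooth_tail
  refine ⟨3 + C2 + 2 * C1, by positivity, fun t l a x N ht htl hN hla hax hx => ?_⟩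
  have hx0 : 0 < x := by linarith
  have hr0 := rho_lo
  have hrp : 0 < rho := by linarith
  have hq := q32_pos (n := N + 1) (by omega)
  set F1 := (Ioo ⌊Real.exp t⌋₊ (⌊x⌋₊ + 1)).image (fun k : ℕ => k ^ 2) with hF1
  set F2 := (Icc 1 ⌊x⌋₊).filter (fun s : ℕ => Real.exp (l / 2) ≤ s ∧ ∀ r : ℕ, r.Prime → r ∣ s → (r : ℝ) ≤ Real.exp t) with hF2
  have b0 : cnt (EdgeL a t) x ≤ cnt (fun n => ((n : ℝ) ≤ x * Real.exp (-t)) ∨ (∃ k ∈ F1, k ∣ n) ∨ (∃ k ∈ F2, k ∣ n) ∨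
      (OneSide t l (a + t) n ∨ OneSide t l (Real.log x - a) n)) x := by
    apply cnt_mono
    intro n hn1 hnx hE
    rcases edge_cover ht htl hla hax hx n hn1 hnx hE with h | ⟨p, hp, hpn⟩ | ⟨s, hs, hsr, hsn⟩ | h
    · exact Or.inl h
    · refine Or.inr (Or.inl ⟨p ^ 2, Finset.mem_image_of_mem _ ?_, hpn⟩)
      rw [Finset.mem_Ioo]
      have hp0 : 0 < p := by
        have : (0 : ℝ) < p := lt_trans (Real.exp_pos _) hp
        exact_mod_cast this
      constructor
      · exact (Nat.floor_lt (Real.exp_pos _).le).2 hp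
      · have : p ≤ p ^ 2 := by nlinarith
        have h3 := Nat.le_of_dvd (by omega) hpn
        have : n ≤ ⌊x⌋₊ := Nat.le_floor hnx
        omega
    · refine Or.inr (Or.inr (Or.inl ⟨s, ?_, hsn⟩))
      rw [hF2, Finset.mem_filter, Finset.mem_Icc]
      have h3 := Nat.le_of_dvd (by omega) hsn
      have : n ≤ ⌊x⌋₊ := Nat.le_floor hnx
      have : 0 < s := by
        have : (0 : ℝ) < s := lt_of_lt_of_le (Real.exp_pos _) hs
        exact_mod_cast this
      exact ⟨⟨by omega, by omega⟩, hs, hsr⟩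
    · exact Or.inr (Or.inr (Or.inr h))
  have b1 : cnt (fun n => (n : ℝ) ≤ x * Real.exp (-t)) x ≤ x * Real.exp (-t) := by
    have hf := Nat.floor_le (a := x * Real.exp (-t)) (by positivity)
    refine le_trans ?_ hf
    have : ((Icc 1 ⌊x * Real.exp (-t)⌋₊).card : ℝ) = (⌊x * Real.exp (-t)⌋₊ : ℝ) := by simp
    rw [← this]
    unfold cnt
    refine Nat.cast_le.2 (Finset.card_le_card ?_)
    intro n hn
    rw [Finset.mem_filter, Finset.mem_Icc] at hn
    rw [Finset.mem_Icc]
    exact ⟨hn.1.1, Nat.le_floor hn.2⟩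
  have b2 : cnt (fun n => ∃ k ∈ F1, k ∣ n) x ≤ 2 * x * Real.exp (-t) := by
    refine (cnt_dvd_le F1 hx0.le).trans ?_
    rw [hF1, Finset.sum_image (by intro a _ b _ h; exact Nat.pow_left_injective (n := 2) (by norm_num) h)]
    have := sum_Ioo_inv_sq_le (α := ℝ) ⌊Real.exp t⌋₊ (⌊x⌋₊ + 1)
    have e : ∑ k ∈ Ioo ⌊Real.exp t⌋₊ (⌊x⌋₊ + 1), x / ((k ^ 2 : ℕ) : ℝ) = x * ∑ k ∈ Ioo ⌊Real.exp t⌋₊ (⌊x⌋₊ + 1), ((k : ℝ) ^ 2)⁻¹ := by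
      rw [Finset.mul_sum]; apply Finset.sum_congr rfl; intro k _; push_cast; ring
    rw [e]
    have hf : 2 / ((⌊Real.exp t⌋₊ : ℝ) + 1) ≤ 2 * Real.exp (-t) := by
      rw [Real.exp_neg, ← div_eq_mul_inv]
      gcongr
      exact (Nat.lt_floor_add_one _).le
    nlinarith
  have b3 : cnt (fun n => ∃ k ∈ F2, k ∣ n) x ≤ C2 * x * (t * Real.exp (-(l / 2 / t))) := by
    refine (cnt_dvd_le F2 hx0.le).trans ?_
    have := h2 t (l / 2) ht F2 (by
      intro m hm
      rw [hF2, Finset.mem_filter] at hm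
      exact hm.2)
    have e : ∑ k ∈ F2, x / (k : ℝ) = x * ∑ k ∈ F2, 1 / (k : ℝ) := by
      rw [Finset.mul_sum]; apply Finset.sum_congr rfl; intro k _; ring
    rw [e]
    calc _ ≤ x * (C2 * t * Real.exp (-(l / 2 / t))) := by gcongr
      _ = _ := by ring
  have b4 := h1 t l (a + t) x N ht (by linarith) hN hx
  have b5 := h1 t l (Real.log x - a) x N ht (by linarith) hN hx
  have c1 := cnt_or_le (fun n => (n : ℝ) ≤ x * Real.exp (-t)) (fun n => (∃ k ∈ F1, k ∣ n) ∨ (∃ k ∈ F2, k ∣ n) ∨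
      (OneSide t l (a + t) n ∨ OneSide t l (Real.log x - a) n)) x
  have c2 := cnt_or_le (fun n => ∃ k ∈ F1, k ∣ n) (fun n => (∃ k ∈ F2, k ∣ n) ∨
      (OneSide t l (a + t) n ∨ OneSide t l (Real.log x - a) n)) x
  have c3 := cnt_or_le (fun n => ∃ k ∈ F2, k ∣ n) (fun n => OneSide t l (a + t) n ∨ OneSide t l (Real.log x - a) n) x
  have c4 := cnt_or_le (OneSide t l (a + t)) (OneSide t l (Real.log x - a)) x
  have n1 : 0 ≤ x * Real.exp (-t) := by positivity
  have n2 : 0 ≤ x * (t * Real.exp (-(l / 2 / t))) := by positivity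
  have n3 : 0 ≤ x * (rho ^ N / q32 (N + 1)) := by positivity
  have e4 : C1 * x * rho ^ N / q32 (N + 1) = C1 * (x * (rho ^ N / q32 (N + 1))) := by ring
  have tot : cnt (EdgeL a t) x ≤ 3 * (x * Real.exp (-t)) + C2 * (x * (t * Real.exp (-(l / 2 / t)))) + 2 * C1 * (x * (rho ^ N / q32 (N + 1))) := by
    rw [e4] at b4 b5
    linarith
  refine tot.trans ?_
  have k1 := mul_nonneg hC2.le n1
  have k2 := mul_nonneg hC1.le n1
  have k3 := mul_nonneg hC1.le n2
  have k4 := mul_nonneg hC2.le n3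
  nlinarith

end Erd

namespace Erd
open Finset

lemma log_rho : Real.log rho = -erdosDelta * Real.log 2 := by
  have h2 : 0 < Real.log 2 := by have := l2_lo; linarith
  unfold rho erdosDelta
  rw [Real.log_div (by positivity) (by norm_num), Real.log_mul (by positivity) h2.ne', Real.log_exp]
  field_simp
  ring

lemma del_pos : 0 < erdosDelta := by
  have h := log_rho
  have h1 : rho < 1 := rho_lt
  have h0 := rho_lo
  have h3 : Real.log rho < 0 := Real.log_neg (by linarith) h1
  have := l2_lo
  by_contra hc
  push Not at hc
  nlinarith

lemma del_lt : erdosDelta < 1 / 10 := by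
  have h := log_rho
  have h0 := rho_lo
  have h1 : Real.log 0.94 < Real.log rho := Real.log_lt_log (by norm_num) h0
  have h2 := Real.one_sub_inv_le_log_of_pos (x := 0.94) (by norm_num)
  have := l2_lo
  norm_num at h1 h2
  by_contra hc
  push Not at hc
  nlinarith

lemma rho_pow (n : ℕ) : rho ^ n = ((2:ℝ) ^ n) ^ (-erdosDelta) := by
  have h0 := rho_lo
  have hr : 0 < rho := by linarith
  have e : rho = (2:ℝ) ^ (-erdosDelta) := by
    rw [Real.rpow_def_of_pos (by norm_num), ← Real.exp_log hr, log_rho]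
    ring_nf
  rw [e, ← Real.rpow_natCast, ← Real.rpow_mul (by norm_num), ← Real.rpow_natCast (2:ℝ) n, ← Real.rpow_mul (by norm_num)]
  ring_nf

lemma log32_le {l : ℝ} (hl : 1 ≤ l) : Real.log l ^ ((3:ℝ)/2) ≤ 6 * l ^ ((1:ℝ)/2) := by
  have h1 := Real.log_le_rpow_div (x := l) (by linarith) (ε := 1/3) (by norm_num)
  have h0 : 0 ≤ Real.log l := Real.log_nonneg hl
  have h2 : Real.log l ^ ((3:ℝ)/2) ≤ (3 * l ^ ((1:ℝ)/3)) ^ ((3:ℝ)/2) := by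
    apply Real.rpow_le_rpow h0 _ (by norm_num)
    calc _ ≤ _ := h1
      _ = _ := by ring
  refine h2.trans ?_
  rw [Real.mul_rpow (by norm_num) (by positivity), ← Real.rpow_mul (by linarith)]
  have h3 : (3:ℝ) ^ ((3:ℝ)/2) ≤ 6 := by
    have : ((3:ℝ) ^ ((3:ℝ)/2)) ^ 2 ≤ 6 ^ 2 := by
      rw [← Real.rpow_natCast, ← Real.rpow_mul (by norm_num)]
      norm_num
    exact le_of_sq_le_sq this (by norm_num)
  norm_num
  gcongr

lemma one_div_le {l : ℝ} (hl : Real.exp 1 ≤ l) : 1 / l ≤ 6 * ((1 / l) ^ erdosDelta / Real.log l ^ ((3:ℝ)/2)) := by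
  have hl1 : 1 < l := lt_of_lt_of_le (by have := Real.add_one_le_exp (1:ℝ); linarith) hl
  have hlog : 0 < Real.log l := Real.log_pos hl1
  have h1 := log32_le hl1.le
  have hd := del_lt
  have hp : 0 < Real.log l ^ ((3:ℝ)/2) := by positivity
  rw [← mul_div_assoc, le_div_iff₀ hp]
  have h2 : (1 / l) ^ ((1:ℝ)/2) ≤ (1 / l) ^ erdosDelta :=
    Real.rpow_le_rpow_of_exponent_ge (by positivity) (by rw [div_le_one (by linarith)]; exact hl1.le) (by linarith)
  have h3 : 1 / l * l ^ ((1:ℝ)/2) = (1/l) ^ ((1:ℝ)/2) := by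
    rw [← Real.sqrt_eq_rpow, ← Real.sqrt_eq_rpow, Real.sqrt_div (by norm_num), Real.sqrt_one]
    have := Real.mul_self_sqrt (show 0 ≤ l by linarith)
    have h4 : 0 < Real.sqrt l := Real.sqrt_pos.2 (by linarith)
    field_simp
    nlinarith
  calc 1 / l * Real.log l ^ ((3:ℝ)/2) ≤ 1 / l * (6 * l ^ ((1:ℝ)/2)) := by gcongr
    _ = 6 * (1 / l * l ^ ((1:ℝ)/2)) := by ring
    _ ≤ _ := by rw [h3]; gcongr

lemma edge_bound : ∃ C : ℝ, 0 < C ∧ ∀ l t a x : ℝ, 100 ≤ l → Real.log l ≤ t → t ≤ Real.sqrt l → l ≤ a →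
    a + l ≤ Real.log x → 0 < x →
    cnt (EdgeL a t) x ≤ C * x * ((t / l) ^ erdosDelta / Real.log l ^ ((3:ℝ)/2)) := by
  obtain ⟨C, hC, h⟩ := edge_raw
  refine ⟨C * 600, by positivity, fun l t a x hl ht htl hla hax hx => ?_⟩
  have hdp := del_pos
  have he1 : Real.exp 1 < 3 := Real.exp_one_lt_three
  have hlog4 : 4 ≤ Real.log l := by
    rw [Real.le_log_iff_exp_le (by linarith)]
    have : Real.exp 4 = Real.exp 1 ^ 4 := by rw [← Real.exp_nat_mul]; norm_num
    rw [this]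
    calc Real.exp 1 ^ 4 ≤ 3 ^ 4 := by gcongr
      _ ≤ l := by norm_num; linarith
  have hsq := Real.mul_self_sqrt (show 0 ≤ l by linarith)
  have hs10 : 10 ≤ Real.sqrt l := by
    rw [Real.le_sqrt (by norm_num) (by linarith)]; norm_num; linarith
  have ht0 : 0 < t := by linarith
  have h4t : 4 * t < l := by nlinarith
  have hx1 : 1 ≤ x := by
    by_contra hc
    push Not at hc
    have := Real.log_neg hx hc
    linarith
  obtain ⟨N, hN1, hN2⟩ := exists_nat_pow_near (x := l / t) (y := (2:ℝ)) (by rw [le_div_iff₀ ht0]; linarith) (by norm_num)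
  have hN1' : 2 ^ N * t ≤ l := (le_div_iff₀ ht0).1 hN1
  refine (h t l a x N (by linarith) h4t hN1' hla hax hx1).trans ?_
  set E := (t / l) ^ erdosDelta / Real.log l ^ ((3:ℝ)/2) with hE
  have hlp : 0 < Real.log l ^ ((3:ℝ)/2) := by positivity
  have hEpos : 0 < E := by positivity
  have hlE : 1 / l ≤ 6 * E := by
    refine (one_div_le (by linarith)).trans ?_
    rw [hE]; gcongr
    linarith
  have p1 : Real.exp (-t) ≤ 6 * E := by
    refine le_trans ?_ hlE
    rw [Real.exp_neg, one_div]
    apply inv_anti₀ (by linarith)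
    rw [← Real.log_le_iff_le_exp (by linarith)]; exact ht
  have p2 : t * Real.exp (-(l / 2 / t)) ≤ 288 * E := by
    set w := Real.sqrt l
    have a1 : w / 2 ≤ l / 2 / t := by
      rw [le_div_iff₀ ht0]; nlinarith
    have a2 := Real.pow_div_factorial_le_exp (w / 2) (by positivity) 3
    have a3 : Real.exp (-(l / 2 / t)) ≤ 48 / w ^ 3 := by
      calc Real.exp (-(l / 2 / t)) ≤ Real.exp (-(w / 2)) := by gcongr
        _ = 1 / Real.exp (w / 2) := by rw [Real.exp_neg, one_div]
        _ ≤ 1 / ((w / 2) ^ 3 / (Nat.factorial 3 : ℕ)) := by gcongr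
        _ = 48 / w ^ 3 := by simp [Nat.factorial]; field_simp; norm_num
    calc t * Real.exp (-(l / 2 / t)) ≤ w * (48 / w ^ 3) := by gcongr
      _ = 48 * (1 / (w * w)) := by field_simp
      _ = 48 * (1 / l) := by rw [hsq]
      _ ≤ _ := by linarith
  have p3 : rho ^ N / q32 (N + 1) ≤ 6 * E := by
    have hr0 := rho_lo
    have hr : 0 < rho := by linarith
    have b1 : rho ^ (N + 1) ≤ (t / l) ^ erdosDelta := by
      rw [rho_pow, Real.rpow_neg (by positivity), ← Real.inv_rpow (by positivity)]
      apply Real.rpow_le_rpow (by positivity) _ hdp.le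
      rw [← inv_div]
      exact inv_anti₀ (by positivity) hN2.le
    have b2 : rho ^ N ≤ 2 * (t / l) ^ erdosDelta := by
      have : rho ^ (N + 1) = rho ^ N * rho := pow_succ _ _
      have hp := pow_pos hr N
      nlinarith
    have b3 : Real.log l / 2 ≤ ((N + 1 : ℕ) : ℝ) := by
      have c1 : Real.log (l / t) ≤ (N + 1 : ℕ) * Real.log 2 := by
        rw [← Real.log_pow]; exact Real.log_le_log (by positivity) hN2.le
      have c2 : Real.log t ≤ Real.log l / 2 := by
        rw [← Real.log_sqrt (by linarith)]; exact Real.log_le_log ht0 htl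
      rw [Real.log_div (by linarith) ht0.ne'] at c1
      have := l2_hi
      have : ((N + 1 : ℕ) : ℝ) * Real.log 2 ≤ (N + 1 : ℕ) := by
        have : (0 : ℝ) ≤ (N + 1 : ℕ) := by positivity
        nlinarith
      linarith
    have b4 : Real.log l ^ ((3:ℝ)/2) / 3 ≤ q32 (N + 1) := by
      have c1 : q32 (N + 1) = ((N + 1 : ℕ) : ℝ) ^ ((3:ℝ)/2) := by
        unfold q32
        rw [show (3:ℝ)/2 = 1 + 1/2 by norm_num, Real.rpow_add (by positivity), Real.rpow_one, ← Real.sqrt_eq_rpow]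
      rw [c1]
      have c2 : (Real.log l / 2) ^ ((3:ℝ)/2) ≤ ((N + 1 : ℕ) : ℝ) ^ ((3:ℝ)/2) :=
        Real.rpow_le_rpow (by positivity) b3 (by norm_num)
      refine le_trans ?_ c2
      rw [Real.div_rpow (by positivity) (by norm_num)]
      have h3 : (2:ℝ) ^ ((3:ℝ)/2) ≤ 3 := by
        have : ((2:ℝ) ^ ((3:ℝ)/2)) ^ 2 ≤ 3 ^ 2 := by
          rw [← Real.rpow_natCast, ← Real.rpow_mul (by norm_num)]
          norm_num
        exact le_of_sq_le_sq this (by norm_num)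
      gcongr
    calc rho ^ N / q32 (N + 1) ≤ 2 * (t / l) ^ erdosDelta / (Real.log l ^ ((3:ℝ)/2) / 3) := by gcongr
      _ = 6 * E := by rw [hE]; field_simp; norm_num
  calc _ ≤ C * x * (6 * E + 288 * E + 6 * E) := by gcongr
    _ ≤ _ := by
      have : 0 ≤ C * x * E := by positivity
      nlinarith

end Erd

namespace Erd
open Finset

/-- ideal (stick-breaking) model -/
noncomputable def GG (a b : ℝ) : ℕ → List ℝ → ℝ → ℝ
  | 0, S, _ => open Classical in if ∃ σ ∈ S, a < σ ∧ σ < b then 1 else 0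
  | k + 1, S, L => ∫ U in (0:ℝ)..1, GG a b k (S ++ S.map (fun σ => σ + U * L)) ((1 - U) * L)

lemma ii_of_bdd {g : ℝ → ℝ} (hm : Measurable g) (h0 : ∀ x, 0 ≤ g x) (h1 : ∀ x, g x ≤ 1) (u v : ℝ) :
    IntervalIntegrable g MeasureTheory.volume u v := by
  rw [intervalIntegrable_iff]
  apply MeasureTheory.Measure.integrableOn_of_bounded (M := 1)
  · simp
  · exact hm.aestronglyMeasurable
  · exact Filter.Eventually.of_forall fun x => by
      rw [Real.norm_of_nonneg (h0 x)]; exact h1 x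

lemma GG_meas (a b : ℝ) (k : ℕ) : ∀ {α : Type} [MeasurableSpace α] (F : List (α → ℝ)) (_ : ∀ f ∈ F, Measurable f)
    (L : α → ℝ) (_ : Measurable L), Measurable (fun x => GG a b k (F.map (fun f => f x)) (L x)) := by
  induction k with
  | zero =>
    intro α _ F hF L hL
    simp only [GG]
    apply Measurable.ite _ measurable_const measurable_const
    have : {x : α | ∃ σ ∈ F.map (fun f => f x), a < σ ∧ σ < b} = ⋃ f ∈ {f | f ∈ F}, {x | a < f x ∧ f x < b} := by
      ext x
      simp only [List.mem_map, Set.mem_setOf_eq, Set.mem_iUnion, exists_prop]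
      constructor
      · rintro ⟨_, ⟨f, hf, rfl⟩, h⟩; exact ⟨f, hf, h⟩
      · rintro ⟨f, hf, h⟩; exact ⟨_, ⟨f, hf, rfl⟩, h⟩
    rw [this]
    apply Set.Finite.measurableSet_biUnion
    · exact List.finite_toSet F
    · intro f hf
      have hm := hF f hf
      exact (measurableSet_lt measurable_const hm).inter (measurableSet_lt hm measurable_const)
  | succ k ih =>
    intro α _ F hF L hL
    simp only [GG]
    simp_rw [intervalIntegral.integral_of_le (zero_le_one' ℝ)]
    apply MeasureTheory.StronglyMeasurable.measurable
    apply MeasureTheory.StronglyMeasurable.integral_prod_right (f := fun (x : α) (U : ℝ) =>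
      GG a b k (F.map (fun f => f x) ++ (F.map (fun f => f x)).map (fun σ => σ + U * L x)) ((1 - U) * L x))
    apply Measurable.stronglyMeasurable
    have := ih (α := α × ℝ) (F.map (fun f q => f q.1) ++ F.map (fun f q => f q.1 + q.2 * L q.1)) (by
      intro f hf
      rw [List.mem_append, List.mem_map, List.mem_map] at hf
      rcases hf with ⟨g, hg, rfl⟩ | ⟨g, hg, rfl⟩
      · exact (hF g hg).comp measurable_fst
      · exact ((hF g hg).comp measurable_fst).add (measurable_snd.mul (hL.comp measurable_fst)))
      (fun q => (1 - q.2) * L q.1) ((measurable_const.sub measurable_snd).mul (hL.comp measurable_fst))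
    convert this using 2
    simp [Function.uncurry, List.map_map, Function.comp_def]

lemma GG_meas1 (a b : ℝ) (k : ℕ) (S : List ℝ) (L : ℝ) :
    Measurable (fun U : ℝ => GG a b k (S ++ S.map (fun σ => σ + U * L)) ((1 - U) * L)) := by
  have := GG_meas a b k (α := ℝ) (S.map (fun σ _ => σ) ++ S.map (fun σ U => σ + U * L)) (by
      intro f hf
      rw [List.mem_append, List.mem_map, List.mem_map] at hf
      rcases hf with ⟨g, hg, rfl⟩ | ⟨g, hg, rfl⟩
      · exact measurable_const
      · fun_prop) (fun U => (1 - U) * L) (by fun_prop)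
  convert this using 2
  simp [List.map_map, Function.comp_def]

lemma GG_meas2 (a b : ℝ) (k : ℕ) (S : List ℝ) (L : ℝ) :
    Measurable (fun t : ℝ => GG a b k (S ++ S.map (fun σ => σ + t)) (L - t)) := by
  have := GG_meas a b k (α := ℝ) (S.map (fun σ _ => σ) ++ S.map (fun σ U => σ + U)) (by
      intro f hf
      rw [List.mem_append, List.mem_map, List.mem_map] at hf
      rcases hf with ⟨g, hg, rfl⟩ | ⟨g, hg, rfl⟩
      · exact measurable_const
      · fun_prop) (fun U => L - U) (by fun_prop)
  convert this using 2
  simp [List.map_map, Function.comp_def]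

lemma GG_mem (a b : ℝ) (k : ℕ) : ∀ (S : List ℝ) (L : ℝ), 0 ≤ GG a b k S L ∧ GG a b k S L ≤ 1 := by
  induction k with
  | zero =>
    intro S L
    simp only [GG]
    split_ifs <;> norm_num
  | succ k ih =>
    intro S L
    simp only [GG]
    have hi := ii_of_bdd (GG_meas1 a b k S L) (fun U => (ih _ _).1) (fun U => (ih _ _).2) 0 1
    constructor
    · exact intervalIntegral.integral_nonneg (by norm_num) fun U _ => (ih _ _).1
    · calc _ ≤ ∫ U in (0:ℝ)..1, (1:ℝ) := by
            apply intervalIntegral.integral_mono_on (by norm_num) hi (by simp)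
            intro U _; exact (ih _ _).2
        _ = 1 := by simp

lemma GG_ii (a b : ℝ) (k : ℕ) (S : List ℝ) (L u v : ℝ) :
    IntervalIntegrable (fun U : ℝ => GG a b k (S ++ S.map (fun σ => σ + U * L)) ((1 - U) * L)) MeasureTheory.volume u v :=
  ii_of_bdd (GG_meas1 a b k S L) (fun U => (GG_mem a b k _ _).1) (fun U => (GG_mem a b k _ _).2) u v

lemma GG_ii2 (a b : ℝ) (k : ℕ) (S : List ℝ) (L u v : ℝ) :
    IntervalIntegrable (fun t : ℝ => GG a b k (S ++ S.map (fun σ => σ + t)) (L - t)) MeasureTheory.volume u v :=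
  ii_of_bdd (GG_meas2 a b k S L) (fun U => (GG_mem a b k _ _).1) (fun U => (GG_mem a b k _ _).2) u v

/-- monotonicity + stability -/
lemma GG_stab (k : ℕ) : ∀ (a b a' b' e f L L' : ℝ) (S S' : List ℝ), 0 ≤ f → |L - L'| ≤ f →
    (∀ σ ∈ S, ∃ τ ∈ S', |σ - τ| ≤ e) → a' ≤ a - (e + f) → b + (e + f) ≤ b' →
    GG a b k S L ≤ GG a' b' k S' L' := by
  induction k with
  | zero =>
    intro a b a' b' e f L L' S S' hf hL hS ha hb
    simp only [GG]
    by_cases h : ∃ σ ∈ S, a < σ ∧ σ < b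
    · rw [if_pos h, if_pos]
      obtain ⟨σ, hσ, h1, h2⟩ := h
      obtain ⟨τ, hτ, h3⟩ := hS σ hσ
      rw [abs_le] at h3
      exact ⟨τ, hτ, by linarith, by linarith⟩
    · rw [if_neg h]; split_ifs <;> norm_num
  | succ k ih =>
    intro a b a' b' e f L L' S S' hf hL hS ha hb
    simp only [GG]
    apply intervalIntegral.integral_mono_on (by norm_num) (GG_ii a b k S L 0 1) (GG_ii a' b' k S' L' 0 1)
    intro U hU
    have hLU : |U * L - U * L'| ≤ U * f := by
      rw [← mul_sub, abs_mul, abs_of_nonneg hU.1]; exact mul_le_mul_of_nonneg_left hL hU.1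
    have hUf := mul_nonneg hU.1 hf
    apply ih a b a' b' (e + U * f) ((1 - U) * f)
    · exact mul_nonneg (by linarith [hU.2]) hf
    · rw [← mul_sub, abs_mul, abs_of_nonneg (by linarith [hU.2] : 0 ≤ 1 - U)]
      exact mul_le_mul_of_nonneg_left hL (by linarith [hU.2])
    · intro σ hσ
      rw [List.mem_append, List.mem_map] at hσ
      rcases hσ with h | ⟨σ', h, rfl⟩
      · obtain ⟨τ, hτ, h3⟩ := hS σ h
        exact ⟨τ, List.mem_append_left _ hτ, by linarith⟩
      · obtain ⟨τ, hτ, h3⟩ := hS σ' h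
        refine ⟨τ + U * L', List.mem_append_right _ (List.mem_map_of_mem hτ), ?_⟩
        rw [abs_le] at *
        constructor <;> linarith
    · linarith
    · linarith

lemma GG_hit (a b : ℝ) (k : ℕ) : ∀ (S : List ℝ) (L : ℝ), (∃ σ ∈ S, a < σ ∧ σ < b) → GG a b k S L = 1 := by
  induction k with
  | zero => intro S L h; simp only [GG]; rw [if_pos h]
  | succ k ih =>
    intro S L h
    simp only [GG]
    rw [intervalIntegral.integral_congr (g := fun _ => (1:ℝ))]
    · simp
    · intro U _
      apply ih
      obtain ⟨σ, hσ, h'⟩ := h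
      exact ⟨σ, List.mem_append_left _ hσ, h'⟩

lemma GG_miss (a b : ℝ) (k : ℕ) : ∀ (S : List ℝ) (L : ℝ), 0 ≤ L → (∀ σ ∈ S, a - L < σ → b ≤ σ) → GG a b k S L = 0 := by
  induction k with
  | zero =>
    intro S L hL h
    simp only [GG]
    rw [if_neg]
    rintro ⟨σ, hσ, h1, h2⟩
    have := h σ hσ (by linarith)
    linarith
  | succ k ih =>
    intro S L hL h
    simp only [GG]
    rw [intervalIntegral.integral_congr (g := fun _ => (0:ℝ))]
    · simp
    · intro U hU
      rw [Set.uIcc_of_le (by norm_num)] at hU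
      have hUL := mul_nonneg hU.1 hL
      apply ih _ _ (mul_nonneg (by linarith [hU.2]) hL)
      intro σ hσ h1
      rw [List.mem_append, List.mem_map] at hσ
      rcases hσ with h' | ⟨σ', h', rfl⟩
      · exact h σ h' (by nlinarith)
      · have := h σ' h' (by nlinarith)
        linarith

lemma GG_mono_k (a b : ℝ) (k : ℕ) : ∀ (S : List ℝ) (L : ℝ), GG a b k S L ≤ GG a b (k + 1) S L := by
  induction k with
  | zero =>
    intro S L
    by_cases h : ∃ σ ∈ S, a < σ ∧ σ < b
    · rw [GG_hit a b _ S L h, GG_hit a b _ S L h]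
    · have : GG a b 0 S L = 0 := by simp only [GG]; rw [if_neg h]
      rw [this]; exact (GG_mem a b _ S L).1
  | succ k ih =>
    intro S L
    rw [GG, GG]
    apply intervalIntegral.integral_mono_on (by norm_num) (GG_ii a b k S L 0 1) (GG_ii a b (k+1) S L 0 1)
    intro U _
    exact ih _ _

lemma GG_trunc (k : ℕ) : ∀ (a b e : ℝ) (j : ℕ) (S : List ℝ) (L : ℝ), 0 < e → 0 ≤ L →
    GG a b (k + j) S L ≤ GG (a - e) (b + e) k S L + (1/2) ^ k * L / e := by
  induction k with
  | zero =>
    intro a b e j S L he hL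
    have h0 := GG_mem (a - e) (b + e) 0 S L
    have hLe : 0 ≤ L / e := by positivity
    simp only [pow_zero, one_mul]
    by_cases h1 : e ≤ L
    · have : 1 ≤ L / e := by rwa [le_div_iff₀ he, one_mul]
      have := (GG_mem a b (0 + j) S L).2
      linarith
    · by_cases h : ∃ σ ∈ S, a - e < σ ∧ σ < b + e
      · rw [GG_hit _ _ 0 S L h]
        have := (GG_mem a b (0 + j) S L).2
        linarith
      · rw [GG_miss a b _ S L hL]
        · linarith
        · push Not at h h1
          intro σ hσ h2
          have := h σ hσ (by linarith)
          linarith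
  | succ k ih =>
    intro a b e j S L he hL
    rw [show k + 1 + j = (k + j) + 1 by ring]
    rw [GG, GG]
    calc _ ≤ ∫ U in (0:ℝ)..1, (GG (a - e) (b + e) k (S ++ S.map (fun σ => σ + U * L)) ((1 - U) * L) + (1/2) ^ k * ((1 - U) * L) / e) := by
          apply intervalIntegral.integral_mono_on (by norm_num) (GG_ii a b _ S L 0 1) ((GG_ii _ _ k S L 0 1).add _)
          · intro U hU
            exact ih a b e j _ _ he (mul_nonneg (by linarith [hU.2]) hL)
          · apply Continuous.intervalIntegrable; fun_prop
      _ = _ := by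
          rw [intervalIntegral.integral_add (GG_ii _ _ k S L 0 1) (by apply Continuous.intervalIntegrable; fun_prop)]
          congr 1
          have : (fun U : ℝ => (1/2:ℝ) ^ k * ((1 - U) * L) / e) = fun U => ((1/2:ℝ) ^ k * L / e) * (1 - U) := by
            ext U; ring
          rw [this, intervalIntegral.integral_const_mul, intervalIntegral.integral_sub (by simp) (by simp)]
          simp
          ring

lemma GG_scale (c : ℝ) (hc : 0 < c) (a b : ℝ) (k : ℕ) : ∀ (S : List ℝ) (L : ℝ),
    GG (c * a) (c * b) k (S.map (fun σ => c * σ)) (c * L) = GG a b k S L := by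
  induction k with
  | zero =>
    intro S L
    simp only [GG]
    congr 1
    simp [hc]
  | succ k ih =>
    intro S L
    simp only [GG]
    congr 1
    ext U
    rw [← ih]
    congr 1
    · simp [List.map_map, Function.comp_def, mul_add]
      intros; ring
    · ring

lemma GG_int (a b : ℝ) (k : ℕ) (S : List ℝ) (L : ℝ) :
    L * GG a b (k + 1) S L = ∫ t in (0:ℝ)..L, GG a b k (S ++ S.map (fun σ => σ + t)) (L - t) := by
  have := intervalIntegral.mul_integral_comp_mul_right (a := 0) (b := 1) (f := fun t : ℝ => GG a b k (S ++ S.map (fun σ => σ + t)) (L - t)) L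
  rw [zero_mul, one_mul] at this
  rw [← this, GG]
  congr 2
  ext U
  congr 1
  ring

end Erd

namespace Erd
open Finset

lemma couple : ∃ C : ℝ, 1 ≤ C ∧ (∀ X : ℝ, 1 ≤ X → |Mert ⌊X⌋₊ - Real.log X| ≤ C) ∧
    ∀ (N : ℕ) (f : ℕ → ℝ) (g : ℝ → ℝ), (∀ u v, IntervalIntegrable g MeasureTheory.volume u v) →
      (∀ p : ℕ, p.Prime → p ≤ N → ∀ τ, |τ - Real.log p| ≤ C → f p ≤ g τ) →
      ∑ p ∈ Nat.primesLE N, Real.log p / p * f p ≤ ∫ τ in (0:ℝ)..Mert N, g τ := by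
  obtain ⟨C, hC, h⟩ := mert_bound_nat
  refine ⟨C + 1, by linarith, ?_, ?_⟩
  · intro X hX
    have hN : 1 ≤ ⌊X⌋₊ := Nat.floor_pos.2 hX
    have h1 := h _ hN
    have hN' : (1 : ℝ) ≤ ⌊X⌋₊ := by exact_mod_cast hN
    have h2 : (⌊X⌋₊ : ℝ) ≤ X := Nat.floor_le (by linarith)
    have h3 := Nat.lt_floor_add_one X
    have h4 : Real.log X ≤ Real.log ⌊X⌋₊ + 1 := by
      have e : Real.log X ≤ Real.log (⌊X⌋₊ * Real.exp 1) := by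
        apply Real.log_le_log (by linarith)
        have := Real.add_one_le_exp (1:ℝ)
        nlinarith
      rwa [Real.log_mul (by linarith) (by positivity), Real.log_exp] at e
    have h5 : Real.log ⌊X⌋₊ ≤ Real.log X := Real.log_le_log (by linarith) h2
    rw [abs_le] at *
    constructor <;> linarith
  · intro N f g hg
    induction N with
    | zero => intro _; simp [Mert, Nat.primesLE_eq_filter_Icc_one]
    | succ n ih =>
      intro hf
      have ih' := ih (fun p hp hpn => hf p hp (by omega))
      rw [← intervalIntegral.integral_add_adjacent_intervals (hg 0 (Mert n)) (hg _ _)]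
      have e : ∑ p ∈ Nat.primesLE (n+1), Real.log p / p * f p = ∑ p ∈ Nat.primesLE n, Real.log p / p * f p +
          (if (n + 1).Prime then Real.log ((n + 1 : ℕ) : ℝ) / ((n + 1 : ℕ) : ℝ) * f (n+1) else 0) := by
        rw [Nat.primesLE_eq_filter_Icc_one, Nat.primesLE_eq_filter_Icc_one, Finset.sum_filter,
          Finset.sum_filter, Finset.sum_Icc_succ_top (by omega)]
      rw [e]
      apply add_le_add ih'
      have hs := mert_succ n
      split_ifs at hs ⊢ with hp
      · set p := n + 1 with hpd
        have hpos : (0:ℝ) < p := by exact_mod_cast hp.pos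
        set w := Real.log (p : ℝ) / p with hw
        have hw0 : 0 ≤ w := by
          have : 0 ≤ Real.log (p:ℝ) := Real.log_natCast_nonneg p
          positivity
        have hw1 : w ≤ 1 := by
          rw [hw, div_le_one hpos]; exact Real.log_le_self hpos.le
        have hb := h p hp.one_le
        rw [abs_le] at hb
        calc w * f p = ∫ τ in Mert n..Mert p, f p := by
              rw [intervalIntegral.integral_const, hs]; simp
          _ ≤ _ := by
              apply intervalIntegral.integral_mono_on (by linarith) (by simp) (hg _ _)
              intro τ hτ
              apply hf p hp le_rfl
              rw [abs_le]
              constructor <;> linarith [hτ.1, hτ.2]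
      · rw [hs]; simp

lemma mert_diff {u v : ℝ} (huv : u ≤ v) : ∑ p ∈ PI u v, Real.log p / p = Mert ⌊v⌋₊ - Mert ⌊u⌋₊ := by
  unfold Mert
  have hsub : Nat.primesLE ⌊u⌋₊ ⊆ Nat.primesLE ⌊v⌋₊ := by
    intro p hp
    rw [Nat.mem_primesLE] at *
    exact ⟨hp.1.trans (Nat.floor_le_floor huv), hp.2⟩
  rw [← Finset.sum_sdiff hsub, add_sub_cancel_right]
  apply Finset.sum_congr _ (fun _ _ => rfl)
  ext p
  unfold PI
  rw [Finset.mem_filter, Finset.mem_sdiff, Nat.mem_primesLE, Nat.mem_primesLE]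
  constructor
  · rintro ⟨⟨h1, h2⟩, h3⟩
    refine ⟨⟨h1, h2⟩, fun h => ?_⟩
    have := (Nat.le_floor_iff' h2.ne_zero).1 h.1
    linarith
  · rintro ⟨⟨h1, h2⟩, h3⟩
    refine ⟨⟨h1, h2⟩, ?_⟩
    by_contra hc
    push Not at hc
    exact h3 ⟨Nat.le_floor hc, h2⟩

lemma low_sq : ∃ T : ℝ, 1 ≤ T ∧ ∀ X : ℝ, 1 ≤ X → T ≤ Real.log X →
    1/100 * X * Real.log X ^ 2 ≤ ∑ p ∈ Nat.primesLE ⌊X⌋₊, Real.log p * (Real.log p * (⌊X / p⌋₊ : ℝ)) := by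
  obtain ⟨C, hC, hM, _⟩ := couple
  refine ⟨100 * C, by linarith, fun X hX hT => ?_⟩
  set L := Real.log X with hL
  have hXe : Real.exp L = X := Real.exp_log (by linarith)
  have huv : Real.exp (L/4) ≤ Real.exp (L/2) := Real.exp_le_exp.2 (by linarith)
  have hd := mert_diff huv
  have m1 := hM (Real.exp (L/4)) (Real.one_le_exp (by linarith))
  have m2 := hM (Real.exp (L/2)) (Real.one_le_exp (by linarith))
  rw [Real.log_exp, abs_le] at m1 m2
  have hv : Real.exp (L/2) * Real.exp (L/2) = X := by rw [← Real.exp_add, ← hXe]; ring_nf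
  have hv1 : 1 ≤ Real.exp (L/2) := Real.one_le_exp (by linarith)
  have hsub : PI (Real.exp (L/4)) (Real.exp (L/2)) ⊆ Nat.primesLE ⌊X⌋₊ := by
    intro p hp
    unfold PI at hp
    rw [Finset.mem_filter, Nat.mem_primesLE] at hp
    rw [Nat.mem_primesLE]
    refine ⟨hp.1.1.trans (Nat.floor_le_floor ?_), hp.1.2⟩
    nlinarith
  have key : ∑ p ∈ PI (Real.exp (L/4)) (Real.exp (L/2)), (X * L / 8) * (Real.log p / p) ≤
      ∑ p ∈ PI (Real.exp (L/4)) (Real.exp (L/2)), Real.log p * (Real.log p * (⌊X / p⌋₊ : ℝ)) := by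
    apply Finset.sum_le_sum
    intro p hp
    unfold PI at hp
    rw [Finset.mem_filter, Nat.mem_primesLE] at hp
    obtain ⟨⟨h1, h2⟩, h3⟩ := hp
    have hp0 : (0:ℝ) < p := by exact_mod_cast h2.pos
    have h1' : (p:ℝ) ≤ Real.exp (L/2) := (Nat.le_floor_iff' h2.ne_zero).1 h1
    have hlp : L/4 ≤ Real.log p := by
      rw [Real.le_log_iff_exp_le hp0]; exact h3.le
    have hXp : 1 ≤ X / p := by
      rw [le_div_iff₀ hp0]; nlinarith
    have hfl : X / p / 2 ≤ (⌊X / p⌋₊ : ℝ) := by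
      have := Nat.lt_floor_add_one (X / p)
      have h' : (1:ℝ) ≤ ⌊X / p⌋₊ := by exact_mod_cast (Nat.floor_pos.2 hXp : 0 < ⌊X / (p:ℝ)⌋₊)
      linarith
    calc (X * L / 8) * (Real.log p / p) = Real.log p * ((L/4) * (X / p / 2)) := by field_simp; ring
      _ ≤ _ := by
        have : 0 ≤ L := by linarith
        have : 0 ≤ Real.log p := by linarith
        gcongr
  rw [← Finset.mul_sum, hd] at key
  have k2 : ∑ p ∈ PI (Real.exp (L/4)) (Real.exp (L/2)), Real.log p * (Real.log p * (⌊X / p⌋₊ : ℝ)) ≤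
      ∑ p ∈ Nat.primesLE ⌊X⌋₊, Real.log p * (Real.log p * (⌊X / p⌋₊ : ℝ)) := by
    apply Finset.sum_le_sum_of_subset_of_nonneg hsub
    intro p _ _
    have := Real.log_natCast_nonneg p
    positivity
  refine le_trans ?_ (key.trans k2)
  have : (23:ℝ)/100 * L ≤ Mert ⌊Real.exp (L/2)⌋₊ - Mert ⌊Real.exp (L/4)⌋₊ := by linarith
  have hXL : 0 ≤ X * L / 8 := by have : 0 ≤ L := by linarith
                                 positivity
  have := mul_le_mul_of_nonneg_left this hXL
  have : 0 ≤ X * L^2 := by positivity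
  nlinarith

/-- edge indicator -/
def Eg (a w : ℝ) (n : ℕ) : Prop := ∃ d : ℕ, d ∣ n ∧ a - w < Real.log d ∧ Real.log d ≤ a

lemma supersol : ∃ C A T0 : ℝ, 1 ≤ C ∧ 0 < A ∧ 1 ≤ T0 ∧ ∀ (a : ℝ) (S : ℕ → Prop) (Γ : ℕ → ℕ → ℝ → ℝ) (γ : ℕ → ℕ → ℝ → ℝ → ℝ)
    (i0 I : ℕ), T0 ≤ 2 ^ i0 →
    (∀ k s L, 0 ≤ Γ k s L) →
    (∀ k s τ L, 0 ≤ γ k s τ L ∧ γ k s τ L ≤ 1) →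
    (∀ k s L u v, IntervalIntegrable (fun τ => γ k s τ L) MeasureTheory.volume u v) →
    (∀ k s L, L * Γ (k + 1) s L = ∫ τ in (0:ℝ)..L, γ k s τ L) →
    (∀ (k s p : ℕ) (L τ : ℝ), 1 ≤ s → p.Prime → |τ - Real.log p| ≤ C → Γ k (s * p) (L - Real.log p) ≤ γ k s τ L) →
    (∀ (k s : ℕ) (X : ℝ), 1 ≤ s → 1 ≤ X → (Real.log X ≤ 2 ^ i0 ∨ ¬ Eg a (Real.log X) s) →
      cnt (fun m => S (s * m)) X ≤ X * Γ k s (Real.log X)) →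
    ∀ (k s : ℕ) (X : ℝ), 1 ≤ s → 1 ≤ X → Real.log X < 2 ^ I →
      cnt (fun m => S (s * m)) X ≤ X * Γ k s (Real.log X) + X * (3/4) ^ k * Real.log X +
        A * ∑ i ∈ Ico i0 (I + 1), (1/4) ^ i * (min (Real.log X) (2 ^ i) * cnt (fun m => Eg a (2 ^ i) (s * m)) X) := by
  obtain ⟨C, hC, hM, hcp⟩ := couple
  obtain ⟨C2, hC2, hru⟩ := rec_upper
  obtain ⟨T1, hT1, hls⟩ := low_sq
  refine ⟨C, 400 * (C + C2), max T1 (10 * C), hC, by linarith, le_max_of_le_left hT1, ?_⟩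
  intro a S Γ γ i0 I hT hΓ hγ hγi hrec hcoup hbase k
  set A := 400 * (C + C2) with hA
  have hA0 : 0 < A := by rw [hA]; linarith
  have Kpos : ∀ (s : ℕ) (X : ℝ), 1 ≤ X → 0 ≤ A * ∑ i ∈ Ico i0 (I + 1), (1/4:ℝ) ^ i * (min (Real.log X) (2 ^ i) * cnt (fun m => Eg a (2 ^ i) (s * m)) X) := by
    intro s X hX
    have h0 : 0 ≤ Real.log X := Real.log_nonneg hX
    apply mul_nonneg hA0.le
    apply Finset.sum_nonneg
    intro i _
    have := cnt_nonneg (fun m => Eg a (2 ^ i) (s * m)) X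
    have : 0 ≤ min (Real.log X) (2 ^ i) := le_min h0 (by positivity)
    positivity
  induction k with
  | zero =>
    intro s X hs hX hXI
    have hK := Kpos s X hX
    have hL0 : 0 ≤ Real.log X := Real.log_nonneg hX
    have hG := hΓ 0 s (Real.log X)
    have hXG : 0 ≤ X * Γ 0 s (Real.log X) := mul_nonneg (by linarith) hG
    rw [pow_zero, mul_one]
    by_cases h1 : Real.log X ≤ 1
    · have hb := hbase 0 s X hs hX (Or.inl (h1.trans (one_le_pow₀ (by norm_num))))
      have : 0 ≤ X * Real.log X := mul_nonneg (by linarith) hL0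
      linarith
    · push Not at h1
      have := cnt_le (fun m => S (s * m)) (X := X) (by linarith)
      nlinarith
  | succ k ih =>
    intro s X hs hX hXI
    have hK := Kpos s X hX
    have hX0 : 0 < X := by linarith
    set L := Real.log X with hL
    have hL0 : 0 ≤ L := Real.log_nonneg hX
    by_cases hcase : L ≤ 2 ^ i0 ∨ ¬ Eg a L s
    · have hb := hbase (k+1) s X hs hX hcase
      have : 0 ≤ X * (3/4) ^ (k+1) * L := by positivity
      linarith
    · push Not at hcase
      obtain ⟨hLT, hedge⟩ := hcase
      have hLT1 : T1 ≤ L := (le_max_left _ _).trans (hT.trans hLT.le)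
      have hLC : 10 * C ≤ L := (le_max_right _ _).trans (hT.trans hLT.le)
      have hLpos : 0 < L := by linarith
      have hMX := hM X hX
      rw [abs_le] at hMX
      have hpr : ∀ p ∈ Nat.primesLE ⌊X⌋₊, p.Prime ∧ (0:ℝ) < p ∧ 1 ≤ X / p ∧ Real.log (X / p) = L - Real.log p ∧ 0 ≤ Real.log p ∧ 0 ≤ L - Real.log p := by
        intro p hp
        rw [Nat.mem_primesLE] at hp
        have hp0 : (0:ℝ) < p := by exact_mod_cast hp.2.pos
        have hpX : (p:ℝ) ≤ X := (Nat.le_floor_iff' hp.2.ne_zero).1 hp.1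
        have h1 : 1 ≤ X / p := by rwa [le_div_iff₀ hp0, one_mul]
        have h2 : Real.log (X / p) = L - Real.log p := by rw [Real.log_div hX0.ne' hp0.ne']
        exact ⟨hp.2, hp0, h1, h2, Real.log_natCast_nonneg p, by rw [← h2]; exact Real.log_nonneg h1⟩
      -- main recursion
      have r0 := hru (fun m => S (s * m)) X hX
      set F : ℕ → ℕ → ℝ := fun i p => Real.log p * (min (L - Real.log p) (2 ^ i) * cnt (fun m => Eg a (2 ^ i) (s * p * m)) (X / p)) with hF
      have r1 : ∑ p ∈ Nat.primesLE ⌊X⌋₊, Real.log p * cnt (fun k => S (s * (p * k))) (X / p) ≤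
          X * (∑ p ∈ Nat.primesLE ⌊X⌋₊, Real.log p / p * Γ k (s * p) (L - Real.log p)) +
          X * (3/4)^k * (∑ p ∈ Nat.primesLE ⌊X⌋₊, Real.log p / p * (L - Real.log p)) +
          A * ∑ i ∈ Ico i0 (I + 1), (1/4) ^ i * ∑ p ∈ Nat.primesLE ⌊X⌋₊, F i p := by
        have e3 : ∑ i ∈ Ico i0 (I + 1), (1/4:ℝ) ^ i * ∑ p ∈ Nat.primesLE ⌊X⌋₊, F i p =
            ∑ p ∈ Nat.primesLE ⌊X⌋₊, ∑ i ∈ Ico i0 (I + 1), (1/4:ℝ) ^ i * F i p := by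
          rw [Finset.sum_comm]; simp_rw [Finset.mul_sum]
        rw [e3, Finset.mul_sum, Finset.mul_sum, Finset.mul_sum, ← Finset.sum_add_distrib, ← Finset.sum_add_distrib]
        apply Finset.sum_le_sum
        intro p hp
        obtain ⟨hpp, hp0, h1, h2, h3, h4⟩ := hpr p hp
        have := ih (s * p) (X / p) (Nat.mul_pos hs hpp.pos) h1 (by rw [h2]; linarith)
        rw [h2] at this
        have e1 : cnt (fun k => S (s * (p * k))) (X / p) = cnt (fun k => S (s * p * k)) (X / p) :=
          cnt_congr fun m _ _ => by rw [mul_assoc]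
        rw [e1]
        refine (mul_le_mul_of_nonneg_left this h3).trans (le_of_eq ?_)
        rw [mul_add, mul_add]
        congr 1
        · field_simp
        · rw [Finset.mul_sum, Finset.mul_sum, Finset.mul_sum]
          apply Finset.sum_congr rfl
          intro i _
          simp only [hF]; ring
      have r2 : ∑ p ∈ Nat.primesLE ⌊X⌋₊, Real.log p / p * Γ k (s * p) (L - Real.log p) ≤ L * Γ (k+1) s L + C := by
        refine (hcp ⌊X⌋₊ (fun p => Γ k (s * p) (L - Real.log p)) (fun τ => γ k s τ L) (hγi k s L) ?_).trans ?_
        · intro p hp _ τ hτ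
          exact hcoup k s p L τ hs hp hτ
        · rw [hrec, ← intervalIntegral.integral_add_adjacent_intervals (hγi k s L 0 L) (hγi k s L L _)]
          gcongr
          have := intervalIntegral.norm_integral_le_of_norm_le_const (a := L) (b := Mert ⌊X⌋₊) (f := fun τ => γ k s τ L) (C := 1)
            (fun x _ => by rw [Real.norm_of_nonneg (hγ k s x L).1]; exact (hγ k s x L).2)
          refine (le_abs_self _).trans (this.trans ?_)
          rw [one_mul]; exact hM X hX
      have r3 : ∑ p ∈ Nat.primesLE ⌊X⌋₊, Real.log p / p * (L - Real.log p) ≤ 3/4 * L^2 := by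
        refine (hcp ⌊X⌋₊ (fun p => L - Real.log p) (fun τ => L + C - τ) (fun u v => by apply Continuous.intervalIntegrable; fun_prop) ?_).trans ?_
        · intro p hp _ τ hτ
          rw [abs_le] at hτ
          linarith
        · rw [intervalIntegral.integral_sub (by simp) (by simp)]
          simp only [intervalIntegral.integral_const, integral_id, smul_eq_mul]
          set M := Mert ⌊X⌋₊
          nlinarith [sq_nonneg (L + C - M)]
      obtain ⟨n, hn1, hn2⟩ := exists_nat_pow_near (x := L) (y := (2:ℝ)) (by linarith) (by norm_num)
      have hin : n + 1 ∈ Ico i0 (I + 1) := by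
        rw [Finset.mem_Ico]
        have a1 : i0 < n + 1 := (pow_lt_pow_iff_right₀ (one_lt_two : (1:ℝ) < 2)).1 (lt_trans hLT hn2)
        have a2 : n < I := (pow_lt_pow_iff_right₀ (one_lt_two : (1:ℝ) < 2)).1 (lt_of_le_of_lt hn1 hXI)
        omega
      set E : ℕ → ℝ := fun i => cnt (fun m => Eg a (2 ^ i) (s * m)) X with hE
      have rl : ∀ i, ∑ p ∈ Nat.primesLE ⌊X⌋₊, Real.log p * cnt (fun m => Eg a (2 ^ i) (s * p * m)) (X / p) ≤ L * E i := by
        intro i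
        have := rec_lower (fun m => Eg a (2 ^ i) (s * m)) X
        refine le_trans (le_of_eq ?_) this
        apply Finset.sum_congr rfl
        intro p _
        congr 1
        exact cnt_congr fun m _ _ => by rw [mul_assoc]
      have r4 : ∀ i, ∑ p ∈ Nat.primesLE ⌊X⌋₊, F i p ≤ L * (min L (2 ^ i) * E i) := by
        intro i
        calc _ ≤ ∑ p ∈ Nat.primesLE ⌊X⌋₊, min L (2 ^ i) * (Real.log p * cnt (fun m => Eg a (2 ^ i) (s * p * m)) (X / p)) := by
              apply Finset.sum_le_sum
              intro p hp
              obtain ⟨hpp, hp0, h1, h2, h3, h4⟩ := hpr p hp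
              have c0 := cnt_nonneg (fun m => Eg a (2 ^ i) (s * p * m)) (X / p)
              have : min (L - Real.log p) (2 ^ i) ≤ min L (2^i) := min_le_min_right _ (by linarith)
              simp only [hF]
              rw [mul_left_comm]
              exact mul_le_mul_of_nonneg_right this (mul_nonneg h3 c0)
          _ = min L (2 ^ i) * ∑ p ∈ Nat.primesLE ⌊X⌋₊, (Real.log p * cnt (fun m => Eg a (2 ^ i) (s * p * m)) (X / p)) := by
              rw [Finset.mul_sum]
          _ ≤ min L (2 ^ i) * (L * E i) := mul_le_mul_of_nonneg_left (rl i) (le_min hL0 (by positivity))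
          _ = _ := by ring
      have r5 : ∑ p ∈ Nat.primesLE ⌊X⌋₊, F (n+1) p ≤ L * (min L (2 ^ (n+1)) * E (n+1)) - 1/100 * X * L^2 := by
        rw [min_eq_left hn2.le]
        have h5 := hls X hX hLT1
        have : ∑ p ∈ Nat.primesLE ⌊X⌋₊, F (n+1) p + ∑ p ∈ Nat.primesLE ⌊X⌋₊, Real.log p * (Real.log p * (⌊X / p⌋₊ : ℝ)) ≤
            L * (L * E (n+1)) := by
          refine le_trans ?_ (mul_le_mul_of_nonneg_left (rl (n+1)) hL0)
          rw [← Finset.sum_add_distrib, Finset.mul_sum]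
          apply Finset.sum_le_sum
          intro p hp
          obtain ⟨hpp, hp0, h1, h2, h3, h4⟩ := hpr p hp
          have full : cnt (fun m => Eg a (2 ^ (n+1)) (s * p * m)) (X / p) = ⌊X / p⌋₊ := by
            have := cnt_not (fun m => Eg a (2 ^ (n+1)) (s * p * m)) (X / p)
            have z : cnt (fun m => ¬ Eg a (2 ^ (n+1)) (s * p * m)) (X / p) = 0 := by
              apply le_antisymm _ (cnt_nonneg _ _)
              refine (cnt_mono (Q := fun _ => False) ?_).trans (by simp [cnt])
              intro m _ _ hm
              apply hm
              obtain ⟨d, hd, hd1, hd2⟩ := hedge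
              exact ⟨d, dvd_mul_of_dvd_left (dvd_mul_of_dvd_left hd p) m, by linarith, hd2⟩
            linarith
          simp only [hF, full]
          rw [min_eq_left (by linarith)]
          apply le_of_eq; ring
        linarith
      have r6 : ∑ i ∈ Ico i0 (I + 1), (1/4:ℝ) ^ i * ∑ p ∈ Nat.primesLE ⌊X⌋₊, F i p ≤
          L * ∑ i ∈ Ico i0 (I + 1), (1/4:ℝ) ^ i * (min L (2 ^ i) * E i) - (1/4) ^ (n+1) * (1/100 * X * L^2) := by
        rw [Finset.mul_sum, ← Finset.add_sum_erase _ _ hin, ← Finset.add_sum_erase _ (fun i => L * ((1/4:ℝ) ^ i * (min L (2 ^ i) * E i))) hin]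
        have q1 : ∑ i ∈ (Ico i0 (I + 1)).erase (n+1), (1/4:ℝ) ^ i * ∑ p ∈ Nat.primesLE ⌊X⌋₊, F i p ≤
            ∑ i ∈ (Ico i0 (I + 1)).erase (n+1), L * ((1/4:ℝ) ^ i * (min L (2 ^ i) * E i)) := by
          apply Finset.sum_le_sum
          intro i _
          have := mul_le_mul_of_nonneg_left (r4 i) (show (0:ℝ) ≤ (1/4)^i by positivity)
          linarith
        have q2 := mul_le_mul_of_nonneg_left r5 (show (0:ℝ) ≤ (1/4)^(n+1) by positivity)
        linarith
      have r7 : 1/4 ≤ (1/4:ℝ) ^ (n+1) * L^2 := by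
        have : (2:ℝ)^n * 2^n ≤ L^2 := by nlinarith [pow_pos (two_pos : (0:ℝ) < 2) n]
        have e : (2:ℝ)^n * 2^n = 4^n := by rw [← mul_pow]; norm_num
        rw [e] at this
        have e2 : (1/4:ℝ)^(n+1) * 4^n = 1/4 := by
          rw [pow_succ, mul_right_comm, ← mul_pow]; norm_num
        calc (1/4:ℝ) = (1/4:ℝ)^(n+1) * 4^n := e2.symm
          _ ≤ _ := by gcongr
      have fin : L * cnt (fun m => S (s * m)) X ≤ L * (X * Γ (k+1) s L + X * (3/4) ^ (k+1) * L +
        A * ∑ i ∈ Ico i0 (I + 1), (1/4) ^ i * (min L (2 ^ i) * E i)) := by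
        have m2 := mul_le_mul_of_nonneg_left r2 hX0.le
        have m3 := mul_le_mul_of_nonneg_left r3 (show 0 ≤ X * (3/4:ℝ)^k by positivity)
        have m6 := mul_le_mul_of_nonneg_left r6 hA0.le
        have m7 := mul_le_mul_of_nonneg_left r7 (show 0 ≤ A * (1/100) * X by positivity)
        have eA : A * (1/100) * X * (1/4) = (C + C2) * X := by rw [hA]; ring
        rw [eA] at m7
        have e34 : X * (3/4:ℝ)^(k+1) * L = X * (3/4)^k * (3/4 * L) := by rw [pow_succ]; ring
        rw [e34]
        nlinarith
      exact le_of_mul_le_mul_left fin hLpos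

end Erd

namespace Erd
open Finset

noncomputable def Dl (s : ℕ) : List ℝ := s.divisors.toList.map (fun d : ℕ => Real.log d)

lemma mem_Dl {s : ℕ} (hs : 1 ≤ s) (σ : ℝ) : σ ∈ Dl s ↔ ∃ d : ℕ, d ∣ s ∧ Real.log d = σ := by
  unfold Dl
  rw [List.mem_map]
  constructor
  · rintro ⟨d, hd, h⟩
    rw [Finset.mem_toList, Nat.mem_divisors] at hd
    exact ⟨d, hd.1, h⟩
  · rintro ⟨d, hd, h⟩
    refine ⟨d, ?_, h⟩
    rw [Finset.mem_toList, Nat.mem_divisors]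
    exact ⟨hd, by omega⟩

lemma Dl_one : Dl 1 = [0] := by simp [Dl]

def Sab (a b : ℝ) (n : ℕ) : Prop := ∃ d : ℕ, d ∣ n ∧ a < Real.log d ∧ Real.log d < b

lemma cnt_zero {P : ℕ → Prop} {X : ℝ} (h : ∀ m : ℕ, 1 ≤ m → (m:ℝ) ≤ X → ¬ P m) : cnt P X = 0 := by
  apply le_antisymm _ (cnt_nonneg _ _)
  refine (cnt_mono (Q := fun _ => False) ?_).trans (by simp [cnt])
  intro m h1 h2 h3
  exact h m h1 h2 h3

lemma Dl_mul {s p : ℕ} (hs : 1 ≤ s) (hp : p.Prime) {C τ : ℝ} (hC : 0 ≤ C) (hτ : |τ - Real.log p| ≤ C) :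
    (∀ σ ∈ Dl (s * p), ∃ σ' ∈ Dl s ++ (Dl s).map (fun σ => σ + τ), |σ - σ'| ≤ C) ∧
    (∀ σ' ∈ Dl s ++ (Dl s).map (fun σ => σ + τ), ∃ σ ∈ Dl (s * p), |σ' - σ| ≤ C) := by
  have hsp : 1 ≤ s * p := Nat.mul_pos hs hp.pos
  have hp0 : (0:ℝ) < p := by exact_mod_cast hp.pos
  have hpos : ∀ d : ℕ, d ∣ s → (0:ℝ) < d := fun d hd => by exact_mod_cast Nat.pos_of_dvd_of_pos hd hs
  constructor
  · intro σ hσ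
    rw [mem_Dl hsp] at hσ
    obtain ⟨d, hd, rfl⟩ := hσ
    by_cases hpd : p ∣ d
    · obtain ⟨e, rfl⟩ := hpd
      have he : e ∣ s := by
        rw [mul_comm s p] at hd
        exact Nat.dvd_of_mul_dvd_mul_left hp.pos hd
      refine ⟨Real.log e + τ, List.mem_append_right _ (List.mem_map_of_mem (f := fun σ => σ + τ) ((mem_Dl hs _).2 ⟨e, he, rfl⟩)), ?_⟩
      rw [Nat.cast_mul, Real.log_mul hp0.ne' (hpos e he).ne', ← abs_neg]
      convert hτ using 2; ring
    · have hc : Nat.Coprime d p := ((Nat.Prime.coprime_iff_not_dvd hp).2 hpd).symm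
      have := hc.dvd_of_dvd_mul_right hd
      exact ⟨Real.log d, List.mem_append_left _ ((mem_Dl hs _).2 ⟨d, this, rfl⟩), by simpa using hC⟩
  · intro σ hσ
    rw [List.mem_append, List.mem_map] at hσ
    rcases hσ with h | ⟨σ', h, rfl⟩
    · rw [mem_Dl hs] at h
      obtain ⟨d, hd, rfl⟩ := h
      exact ⟨Real.log d, (mem_Dl hsp _).2 ⟨d, dvd_mul_of_dvd_left hd p, rfl⟩, by simpa using hC⟩
    · rw [mem_Dl hs] at h
      obtain ⟨d, hd, rfl⟩ := h
      refine ⟨Real.log (d * p : ℕ), (mem_Dl hsp _).2 ⟨d * p, Nat.mul_dvd_mul_right hd p, rfl⟩, ?_⟩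
      rw [Nat.cast_mul, Real.log_mul (hpos d hd).ne' hp0.ne']
      convert hτ using 2; ring

/-- if `s*m` has a divisor with log in (a,b) and m ≤ X -/
lemma Sab_split {a b X : ℝ} {s m : ℕ} (hs : 1 ≤ s) (hm : 1 ≤ m) (hmX : (m:ℝ) ≤ X) (h : Sab a b (s * m)) :
    ∃ d : ℕ, d ∣ s ∧ a - Real.log X < Real.log d ∧ Real.log d < b := by
  obtain ⟨d, hd, h1, h2⟩ := h
  obtain ⟨d1, d2, hd1, hd2, rfl⟩ := (Nat.dvd_mul).1 hd
  have p1 : (0:ℝ) < d1 := by exact_mod_cast Nat.pos_of_dvd_of_pos hd1 hs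
  have p2' : 1 ≤ d2 := Nat.pos_of_dvd_of_pos hd2 hm
  have p2 : (1:ℝ) ≤ d2 := by exact_mod_cast p2'
  have p3 : (d2:ℝ) ≤ X := le_trans (by exact_mod_cast Nat.le_of_dvd hm hd2) hmX
  have l2 := Real.log_nonneg p2
  have l3 := Real.log_le_log (by linarith) p3
  rw [Nat.cast_mul, Real.log_mul p1.ne' (by linarith)] at h1 h2
  exact ⟨d1, hd1, by linarith, by linarith⟩

noncomputable def Ksum (i0 I : ℕ) (a X : ℝ) : ℝ :=
  ∑ i ∈ Ico i0 (I + 1), (1/4) ^ i * (min (Real.log X) (2 ^ i) * cnt (Eg a (2 ^ i)) X)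

lemma coup_both : ∃ C A T0 : ℝ, 1 ≤ C ∧ 0 < A ∧ 1 ≤ T0 ∧ ∀ (a b X : ℝ) (i0 I k : ℕ), T0 ≤ 2 ^ i0 → 1 ≤ X → Real.log X < 2 ^ I →
    cnt (Sab a b) X ≤ X * GG (a - (2 ^ i0 + C * k)) (b + (2 ^ i0 + C * k)) k [0] (Real.log X) + X * (3/4) ^ k * Real.log X + A * Ksum i0 I a X ∧
    cnt (fun n => ¬ Sab a b n) X ≤ X * (1 - GG (a + (2 ^ i0 + C * k)) (b - (2 ^ i0 + C * k)) k [0] (Real.log X)) + X * (3/4) ^ k * Real.log X + A * Ksum i0 I a X := by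
  obtain ⟨C, A, T0, hC, hA, hT0, H⟩ := supersol
  refine ⟨2 * C, A, T0, by linarith, hA, hT0, fun a b X i0 I k hT hX hXI => ⟨?_, ?_⟩⟩
  · have := H a (Sab a b) (fun k s L => GG (a - (2 ^ i0 + 2 * C * k)) (b + (2 ^ i0 + 2 * C * k)) k (Dl s) L)
      (fun k s τ L => GG (a - (2 ^ i0 + 2 * C * (k + 1 : ℕ))) (b + (2 ^ i0 + 2 * C * (k + 1 : ℕ))) k (Dl s ++ (Dl s).map (fun σ => σ + τ)) (L - τ))
      i0 I hT (fun k s L => (GG_mem _ _ _ _ _).1) (fun k s τ L => GG_mem _ _ _ _ _) (fun k s L u v => GG_ii2 _ _ _ _ _ _ _)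
      (fun k s L => GG_int _ _ _ _ _) ?_ ?_ k 1 X le_rfl hX hXI
    · simpa [Ksum, Dl_one] using this
    · intro k s p L τ hs hp hτ
      apply GG_stab k _ _ _ _ C C _ _ _ _ (by linarith)
      · convert hτ using 2; ring
      · exact (Dl_mul hs hp (by linarith) hτ).1
      · push_cast; linarith
      · push_cast; linarith
    · intro k s X hs hX hcase
      have hck : (0:ℝ) ≤ 2 * C * k := by positivity
      have h2 : (0:ℝ) < 2 ^ i0 := by positivity
      by_cases hex : ∃ m : ℕ, 1 ≤ m ∧ (m:ℝ) ≤ X ∧ Sab a b (s * m)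
      · obtain ⟨m, hm, hmX, hS⟩ := hex
        obtain ⟨d, hd, hd1, hd2⟩ := Sab_split hs hm hmX hS
        have hit : GG (a - (2 ^ i0 + 2 * C * k)) (b + (2 ^ i0 + 2 * C * k)) k (Dl s) (Real.log X) = 1 := by
          apply GG_hit
          refine ⟨Real.log d, (mem_Dl hs _).2 ⟨d, hd, rfl⟩, ?_, by linarith⟩
          rcases hcase with h | h
          · linarith
          · by_contra hc
            push Not at hc
            exact h ⟨d, hd, hd1, by linarith⟩
        beta_reduce
        rw [hit, mul_one]
        exact cnt_le _ (by linarith)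
      · push Not at hex
        rw [cnt_zero hex]
        exact mul_nonneg (by linarith) (GG_mem _ _ _ _ _).1
  · have := H a (fun n => ¬ Sab a b n) (fun k s L => 1 - GG (a + (2 ^ i0 + 2 * C * k)) (b - (2 ^ i0 + 2 * C * k)) k (Dl s) L)
      (fun k s τ L => 1 - GG (a + (2 ^ i0 + 2 * C * (k + 1 : ℕ))) (b - (2 ^ i0 + 2 * C * (k + 1 : ℕ))) k (Dl s ++ (Dl s).map (fun σ => σ + τ)) (L - τ))
      i0 I hT (fun k s L => by linarith [(GG_mem (a + (2 ^ i0 + 2 * C * k)) (b - (2 ^ i0 + 2 * C * k)) k (Dl s) L).2])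
      (fun k s τ L => by
        have := GG_mem (a + (2 ^ i0 + 2 * C * (k + 1 : ℕ))) (b - (2 ^ i0 + 2 * C * (k + 1 : ℕ))) k (Dl s ++ (Dl s).map (fun σ => σ + τ)) (L - τ)
        constructor <;> linarith) (fun k s L u v => IntervalIntegrable.sub (by simp) (GG_ii2 _ _ _ _ _ _ _))
      (fun k s L => by
        rw [intervalIntegral.integral_sub (by simp) (GG_ii2 _ _ _ _ _ _ _), ← GG_int, mul_sub]
        simp) ?_ ?_ k 1 X le_rfl hX hXI
    · simpa [Ksum, Dl_one] using this
    · intro k s p L τ hs hp hτ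
      apply sub_le_sub_left
      apply GG_stab k _ _ _ _ C C _ _ _ _ (by linarith)
      · rw [← abs_neg]; convert hτ using 2; ring
      · exact (Dl_mul hs hp (by linarith) hτ).2
      · push_cast; linarith
      · push_cast; linarith
    · intro k s X hs hX hcase
      have hck : (0:ℝ) ≤ 2 * C * k := by positivity
      have h2 : (0:ℝ) < 2 ^ i0 := by positivity
      have hL0 := Real.log_nonneg hX
      by_cases hex : ∃ d : ℕ, d ∣ s ∧ a < Real.log d ∧ Real.log d < b
      · obtain ⟨d, hd, h1, h3⟩ := hex
        rw [cnt_zero]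
        · exact mul_nonneg (by linarith) (by linarith [(GG_mem (a + (2 ^ i0 + 2 * C * k)) (b - (2 ^ i0 + 2 * C * k)) k (Dl s) (Real.log X)).2])
        · intro m _ _ hm
          exact hm ⟨d, dvd_mul_of_dvd_left hd m, h1, h3⟩
      · push Not at hex
        have miss : GG (a + (2 ^ i0 + 2 * C * k)) (b - (2 ^ i0 + 2 * C * k)) k (Dl s) (Real.log X) = 0 := by
          apply GG_miss _ _ _ _ _ hL0
          intro σ hσ h3
          obtain ⟨d, hd, rfl⟩ := (mem_Dl hs _).1 hσ
          rcases hcase with h | h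
          · have := hex d hd (by linarith)
            linarith
          · by_cases h4 : a < Real.log d
            · have := hex d hd h4
              linarith
            · push Not at h4
              exact absurd ⟨d, hd, by linarith, h4⟩ h
        beta_reduce
        rw [miss, sub_zero, mul_one]
        exact cnt_le _ (by linarith)

end Erd

namespace Erd
open Finset

noncomputable def hL (a b L : ℝ) : ℝ := ⨆ k : ℕ, GG a b k [0] L

lemma hL_bdd (a b L : ℝ) : BddAbove (Set.range fun k : ℕ => GG a b k [0] L) :=
  ⟨1, by rintro _ ⟨k, rfl⟩; exact (GG_mem a b k [0] L).2⟩

lemma GG_le_hL (a b L : ℝ) (k : ℕ) : GG a b k [0] L ≤ hL a b L := le_ciSup (hL_bdd a b L) k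

lemma hL_le {a b L r : ℝ} (h : ∀ k, GG a b k [0] L ≤ r) : hL a b L ≤ r := ciSup_le h

lemma hL_nonneg (a b L : ℝ) : 0 ≤ hL a b L := (GG_mem a b 0 [0] L).1.trans (GG_le_hL a b L 0)
lemma hL_le_one (a b L : ℝ) : hL a b L ≤ 1 := hL_le fun k => (GG_mem a b k [0] L).2

lemma GG_mono_k' (a b : ℝ) (S : List ℝ) (L : ℝ) {k j : ℕ} (h : k ≤ j) : GG a b k S L ≤ GG a b j S L :=
  monotone_nat_of_le_succ (f := fun k => GG a b k S L) (fun k => GG_mono_k a b k S L) h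

lemma GG_mono_ab {a b a' b' : ℝ} (ha : a' ≤ a) (hb : b ≤ b') (k : ℕ) (S : List ℝ) (L : ℝ) :
    GG a b k S L ≤ GG a' b' k S L := by
  apply GG_stab k a b a' b' 0 0 L L S S le_rfl (by simp) (fun σ hσ => ⟨σ, hσ, by simp⟩) <;> linarith

lemma hL_mono {a b a' b' : ℝ} (ha : a' ≤ a) (hb : b ≤ b') (L : ℝ) : hL a b L ≤ hL a' b' L :=
  hL_le fun k => (GG_mono_ab ha hb k [0] L).trans (GG_le_hL _ _ _ k)

lemma hL_trunc (a b L : ℝ) (hL0 : 0 ≤ L) (k : ℕ) : hL a b L ≤ GG (a - 1) (b + 1) k [0] L + (1/2) ^ k * L := by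
  apply hL_le
  intro j
  have h1 := GG_mono_k' a b [0] L (show j ≤ k + j by omega)
  have h2 := GG_trunc k a b 1 j [0] L one_pos hL0
  rw [div_one] at h2
  linarith

lemma hL_scale {c : ℝ} (hc : 0 < c) (a b L : ℝ) : hL (c * a) (c * b) (c * L) = hL a b L := by
  unfold hL
  congr 1
  ext k
  have := GG_scale c hc a b k [0] L
  simpa using this

lemma coup_h : ∃ C A T0 : ℝ, 1 ≤ C ∧ 0 < A ∧ 1 ≤ T0 ∧ ∀ (a b X c : ℝ) (i0 I k : ℕ), T0 ≤ 2 ^ i0 → 1 ≤ X → Real.log X < 2 ^ I →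
    c = 2 ^ i0 + C * k + 1 →
    cnt (Sab a b) X ≤ X * hL (a - c) (b + c) (Real.log X) + X * (3/4) ^ k * Real.log X + A * Ksum i0 I a X ∧
    X * hL (a + c) (b - c) (Real.log X) ≤ cnt (Sab a b) X + 2 * (X * (3/4) ^ k * Real.log X) + A * Ksum i0 I a X + 1 := by
  obtain ⟨C, A, T0, hC, hA, hT0, H⟩ := coup_both
  refine ⟨C, A, T0, hC, hA, hT0, fun a b X c i0 I k hT hX hXI hc => ?_⟩
  obtain ⟨h1, h2⟩ := H a b X i0 I k hT hX hXI
  have hL0 := Real.log_nonneg hX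
  constructor
  · have : GG (a - (2 ^ i0 + C * k)) (b + (2 ^ i0 + C * k)) k [0] (Real.log X) ≤ hL (a - c) (b + c) (Real.log X) :=
      (GG_mono_ab (by linarith) (by linarith) k _ _).trans (GG_le_hL _ _ _ k)
    have := mul_le_mul_of_nonneg_left this (show 0 ≤ X by linarith)
    linarith
  · have h3 := hL_trunc (a + c) (b - c) (Real.log X) hL0 k
    have e1 : a + c - 1 = a + (2 ^ i0 + C * k) := by rw [hc]; ring
    have e2 : b - c + 1 = b - (2 ^ i0 + C * k) := by rw [hc]; ring
    rw [e1, e2] at h3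
    have h4 : (1/2:ℝ)^k ≤ (3/4)^k := pow_le_pow_left₀ (by norm_num) (by norm_num) k
    have h5 := mul_le_mul_of_nonneg_right h4 hL0
    rw [cnt_not] at h2
    have h6 := Nat.lt_floor_add_one X
    have h7 := mul_le_mul_of_nonneg_left (h3.trans (add_le_add_right h5 _)) (show 0 ≤ X by linarith)
    nlinarith

lemma sandwich : ∃ C A T0 : ℝ, 1 ≤ C ∧ 0 < A ∧ 1 ≤ T0 ∧ ∀ (a b X c : ℝ) (i0 I k : ℕ), T0 ≤ 2 ^ i0 → 1 ≤ X → Real.log X < 2 ^ I →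
    c = 2 ^ i0 + C * k + 1 →
    |cnt (Sab a b) X - X * hL a b (Real.log X)| ≤ cnt (EdgeL a c) X + cnt (EdgeL (b - c) c) X + cnt (EdgeL (a - c) c) X + cnt (EdgeL b c) X
      + A * (Ksum i0 I (a + c) X + Ksum i0 I (a - c) X) + 2 * (X * (3/4) ^ k * Real.log X) + 1 := by
  obtain ⟨C, A, T0, hC, hA, hT0, H⟩ := coup_h
  refine ⟨C, A, T0, hC, hA, hT0, fun a b X c i0 I k hT hX hXI hc => ?_⟩
  have hL0 := Real.log_nonneg hX
  have h1 := (H (a + c) (b - c) X c i0 I k hT hX hXI hc).1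
  have h2 := (H (a - c) (b + c) X c i0 I k hT hX hXI hc).2
  rw [add_sub_cancel_right, sub_add_cancel] at h1
  rw [add_sub_cancel_right, sub_add_cancel] at h2
  have s1 : cnt (Sab a b) X ≤ cnt (Sab (a + c) (b - c)) X + (cnt (EdgeL a c) X + cnt (EdgeL (b - c) c) X) := by
    refine le_trans (cnt_mono ?_) ((cnt_or_le _ _ X).trans (add_le_add_right (cnt_or_le _ _ X) _))
    rintro m _ _ ⟨d, hd, d1, d2⟩
    by_cases q1 : Real.log d ≤ a + c
    · exact Or.inr (Or.inl ⟨d, hd, d1.le, q1⟩)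
    · by_cases q2 : b - c ≤ Real.log d
      · exact Or.inr (Or.inr ⟨d, hd, q2, by linarith⟩)
      · push Not at q1 q2
        exact Or.inl ⟨d, hd, q1, q2⟩
  have s2 : cnt (Sab (a - c) (b + c)) X ≤ cnt (Sab a b) X + (cnt (EdgeL (a - c) c) X + cnt (EdgeL b c) X) := by
    refine le_trans (cnt_mono ?_) ((cnt_or_le _ _ X).trans (add_le_add_right (cnt_or_le _ _ X) _))
    rintro m _ _ ⟨d, hd, d1, d2⟩
    by_cases q1 : Real.log d ≤ a
    · exact Or.inr (Or.inl ⟨d, hd, d1.le, by linarith⟩)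
    · by_cases q2 : b ≤ Real.log d
      · exact Or.inr (Or.inr ⟨d, hd, q2, by linarith⟩)
      · push Not at q1 q2
        exact Or.inl ⟨d, hd, q1, q2⟩
  have K0 : ∀ a', 0 ≤ A * Ksum i0 I a' X := by
    intro a'
    apply mul_nonneg hA.le
    apply Finset.sum_nonneg
    intro i _
    have := cnt_nonneg (Eg a' (2 ^ i)) X
    have : 0 ≤ min (Real.log X) (2 ^ i) := le_min hL0 (by positivity)
    positivity
  have k1 := K0 (a + c)
  have k2 := K0 (a - c)
  have e0 : 0 ≤ X * (3/4) ^ k * Real.log X := by positivity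
  have c1 := cnt_nonneg (EdgeL a c) X
  have c2 := cnt_nonneg (EdgeL (b - c) c) X
  have c3 := cnt_nonneg (EdgeL (a - c) c) X
  have c4 := cnt_nonneg (EdgeL b c) X
  rw [abs_le]
  constructor <;> nlinarith

noncomputable def Er (l : ℝ) : ℝ := (Real.log l / l) ^ erdosDelta / Real.log l ^ ((3:ℝ)/2)

lemma Er_pos {l : ℝ} (hl : 3 ≤ l) : 0 < Er l := by
  have : 0 < Real.log l := Real.log_pos (by linarith)
  unfold Er; positivity

lemma one_le_log {l : ℝ} (hl : 3 ≤ l) : 1 ≤ Real.log l := by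
  rw [Real.le_log_iff_exp_le (by linarith)]
  have := Real.exp_one_lt_three
  linarith

lemma quarter_le {l : ℝ} (hl : 3 ≤ l) : l ^ (-(1:ℝ)/4) ≤ 64 * ((1 / l) ^ erdosDelta / Real.log l ^ ((3:ℝ)/2)) := by
  have hlog := one_le_log hl
  have hl0 : 0 < l := by linarith
  have hp : 0 < Real.log l ^ ((3:ℝ)/2) := by positivity
  rw [← mul_div_assoc, le_div_iff₀ hp]
  have h1 := Real.log_le_rpow_div (x := l) (by linarith) (ε := 1/15) (by norm_num)
  have h2 : Real.log l ^ ((3:ℝ)/2) ≤ (16 * l ^ ((1:ℝ)/15)) ^ ((3:ℝ)/2) := by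
    apply Real.rpow_le_rpow (by linarith) _ (by norm_num)
    have : 0 < l ^ ((1:ℝ)/15) := by positivity
    calc _ ≤ _ := h1
      _ = 15 * l ^ ((1:ℝ)/15) := by ring
      _ ≤ _ := by linarith
  rw [Real.mul_rpow (by norm_num) (by positivity), ← Real.rpow_mul (by linarith)] at h2
  have h3 : (16:ℝ) ^ ((3:ℝ)/2) = 64 := by
    rw [show (16:ℝ) = 4 ^ (2:ℝ) by norm_num, ← Real.rpow_mul (by norm_num)]; norm_num
  rw [h3] at h2
  have hd := del_lt
  calc l ^ (-(1:ℝ)/4) * Real.log l ^ ((3:ℝ)/2) ≤ l ^ (-(1:ℝ)/4) * (64 * l ^ ((1:ℝ)/15 * (3/2))) := by gcongr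
    _ = 64 * (l ^ (-(1:ℝ)/4) * l ^ ((1:ℝ)/15 * (3/2))) := by ring
    _ = 64 * (l ^ (-(1:ℝ)/4 + (1:ℝ)/15 * (3/2))) := by rw [← Real.rpow_add hl0]
    _ ≤ 64 * l ^ (-erdosDelta) := by
      gcongr
      · linarith
      · norm_num; linarith
    _ = _ := by rw [one_div, Real.inv_rpow hl0.le, Real.rpow_neg hl0.le]

lemma delE_le {l : ℝ} (hl : 3 ≤ l) : (1 / l) ^ erdosDelta / Real.log l ^ ((3:ℝ)/2) ≤ Er l := by
  have hlog := one_le_log hl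
  have := del_pos
  unfold Er
  gcongr

lemma quarter_Er {l : ℝ} (hl : 3 ≤ l) : l ^ (-(1:ℝ)/4) ≤ 64 * Er l := by
  have h1 := quarter_le hl
  have h2 := delE_le hl
  linarith

lemma inv_le_quarter {l : ℝ} (hl : 3 ≤ l) : 1 / l ≤ l ^ (-(1:ℝ)/4) := by
  rw [one_div, ← Real.rpow_neg_one]
  exact Real.rpow_le_rpow_of_exponent_le (by linarith) (by norm_num)

lemma inv_Er {l : ℝ} (hl : 3 ≤ l) : 1 / l ≤ 64 * Er l := (inv_le_quarter hl).trans (quarter_Er hl)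

lemma Ksum_bound : ∃ C : ℝ, 0 < C ∧ ∀ (l a X : ℝ) (i0 I : ℕ), 100 ≤ l → Real.log l ≤ 2 ^ i0 → l + Real.sqrt l ≤ a →
    a + l ≤ Real.log X → 1 ≤ X → Ksum i0 I a X ≤ C * X * Er l := by
  obtain ⟨C, hC, h⟩ := edge_bound
  refine ⟨4 * (C + 64), by positivity, fun l a X i0 I hl hi0 ha haX hX => ?_⟩
  have hEr := Er_pos (l := l) (by linarith)
  have hq := quarter_Er (l := l) (by linarith)
  have hE := delE_le (l := l) (by linarith)
  have hL0 := Real.log_nonneg hX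
  have hl0 : 0 < l := by linarith
  have term : ∀ i ∈ Ico i0 (I + 1), (1/4:ℝ) ^ i * (min (Real.log X) (2 ^ i) * cnt (Eg a (2 ^ i)) X) ≤ (3/4)^i * ((C + 64) * X * Er l) := by
    intro i hi
    rw [Finset.mem_Ico] at hi
    have c0 := cnt_nonneg (Eg a (2 ^ i)) X
    have t1 : (1/4:ℝ) ^ i * (min (Real.log X) (2 ^ i) * cnt (Eg a (2 ^ i)) X) ≤ (1/2) ^ i * cnt (Eg a (2 ^ i)) X := by
      calc _ ≤ (1/4:ℝ) ^ i * (2 ^ i * cnt (Eg a (2 ^ i)) X) := by gcongr; exact min_le_right _ _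
        _ = (1/4 * 2:ℝ)^i * cnt (Eg a (2 ^ i)) X := by rw [mul_pow]; ring
        _ = _ := by norm_num
    refine t1.trans ?_
    have hmono : cnt (Eg a (2 ^ i)) X ≤ cnt (EdgeL (a - 2^i) (2^i)) X := by
      apply cnt_mono
      rintro m _ _ ⟨d, hd, h1, h2⟩
      exact ⟨d, hd, h1.le, by linarith⟩
    by_cases hs : (2:ℝ)^i ≤ Real.sqrt l
    · have h1 := h l (2^i) (a - 2^i) X hl (hi0.trans (pow_le_pow_right₀ (by norm_num) hi.1)) hs (by linarith)
        (by have : (0:ℝ) < 2^i := by positivity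
            linarith) (by linarith)
      have h2 : ((2:ℝ)^i / l) ^ erdosDelta = ((2:ℝ)^i) ^ erdosDelta * (1 / l) ^ erdosDelta := by
        rw [← Real.mul_rpow (by positivity) (by positivity)]; ring_nf
      have h3 : ((2:ℝ)^i) ^ erdosDelta ≤ (3/2)^i := by
        have r := rho_pow i
        rw [Real.rpow_neg (by positivity)] at r
        have hr := rho_lo
        have : ((2:ℝ)^i) ^ erdosDelta = (1/rho)^i := by
          rw [one_div, inv_pow, r, inv_inv]
        rw [this]
        have hrp : 0 < rho := by linarith
        refine pow_le_pow_left₀ (by positivity) ?_ i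
        rw [div_le_iff₀ hrp]; linarith
      calc (1/2) ^ i * cnt (Eg a (2 ^ i)) X ≤ (1/2)^i * (C * X * ((3/2)^i * (1 / l) ^ erdosDelta / Real.log l ^ ((3:ℝ)/2))) := by
            gcongr
            refine (hmono.trans h1).trans ?_
            rw [h2]
            have : 0 < Real.log l := by linarith [one_le_log (l := l) (by linarith)]
            gcongr
        _ = (1/2 * (3/2):ℝ)^i * (C * X * ((1 / l) ^ erdosDelta / Real.log l ^ ((3:ℝ)/2))) := by rw [mul_pow]; ring
        _ ≤ (3/4)^i * (C * X * Er l) := by norm_num; gcongr; simpa using hE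
        _ ≤ _ := by gcongr; linarith
    · push Not at hs
      have h2 : (2/3:ℝ)^i ≤ l ^ (-(1:ℝ)/4) := by
        apply le_of_sq_le_sq _ (by positivity)
        rw [← Real.rpow_natCast (l ^ _), ← Real.rpow_mul hl0.le, ← pow_mul, mul_comm i 2, pow_mul]
        calc ((2/3:ℝ)^2)^i ≤ (1/2)^i := by gcongr; norm_num
          _ = 1 / 2^i := by rw [div_pow, one_pow]
          _ ≤ 1 / Real.sqrt l := by
            have : 0 < Real.sqrt l := Real.sqrt_pos.2 hl0
            gcongr
          _ = _ := by
            rw [Real.sqrt_eq_rpow, one_div, ← Real.rpow_neg hl0.le]; norm_num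
      have h3 := cnt_le (Eg a (2 ^ i)) (X := X) (by linarith)
      calc (1/2) ^ i * cnt (Eg a (2 ^ i)) X ≤ (1/2)^i * X := by gcongr
        _ = (3/4)^i * (X * (2/3)^i) := by rw [show (1/2:ℝ) = 3/4 * (2/3) by norm_num, mul_pow]; ring
        _ ≤ (3/4)^i * (X * (64 * Er l)) := by gcongr; exact h2.trans hq
        _ ≤ _ := by
          refine mul_le_mul_of_nonneg_left ?_ (by positivity)
          have : 0 ≤ C * X * Er l := by positivity
          nlinarith
  unfold Ksum
  refine (Finset.sum_le_sum term).trans ?_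
  rw [← Finset.sum_mul]
  have geo : ∑ i ∈ Ico i0 (I + 1), (3/4:ℝ)^i ≤ 4 := by
    calc _ ≤ ∑ i ∈ Finset.range (I + 1), (3/4:ℝ)^i := by
          apply Finset.sum_le_sum_of_subset_of_nonneg
          · intro i hi; rw [Finset.mem_Ico] at hi; rw [Finset.mem_range]; exact hi.2
          · intros; positivity
      _ ≤ _ := by
          rw [geom_sum_eq (by norm_num)]
          have : (0:ℝ) ≤ (3/4)^(I+1) := by positivity
          rw [div_le_iff_of_neg (by norm_num)]
          linarith
  calc _ ≤ 4 * ((C + 64) * X * Er l) := by gcongr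
    _ = _ := by ring

end Erd

namespace Erd
open Finset

lemma ev_log_sqrt (D : ℝ) : ∃ l0 : ℝ, ∀ l, l0 ≤ l → D * Real.log l ≤ Real.sqrt l := by
  have h := (isLittleO_log_rpow_atTop (show (0:ℝ) < 1/2 by norm_num)).bound (show 0 < 1 / (|D| + 1) by positivity)
  obtain ⟨l0, h⟩ := eventually_atTop.1 h
  refine ⟨max l0 1, fun l hl => ?_⟩
  have h1 := h l ((le_max_left _ _).trans hl)
  have hl1 : 1 ≤ l := (le_max_right _ _).trans hl
  have hlog := Real.log_nonneg hl1
  rw [Real.norm_of_nonneg hlog, Real.norm_of_nonneg (by positivity), ← Real.sqrt_eq_rpow, div_mul_eq_mul_div, one_mul, le_div_iff₀ (by positivity)] at h1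
  have := le_abs_self D
  nlinarith

lemma main_thm : ∃ C l0 : ℝ, 0 < C ∧ 100 ≤ l0 ∧ ∀ l a b X : ℝ, l0 ≤ l → 2 * l ≤ a → a ≤ b → b + 2 * l ≤ Real.log X →
    Real.log X ≤ l ^ 4 → 1 ≤ X → |cnt (Sab a b) X - X * hL a b (Real.log X)| ≤ C * X * Er l := by
  obtain ⟨C, A, T0, hC, hA, hT0, H⟩ := sandwich
  obtain ⟨C1, hC1, h1⟩ := Ksum_bound
  obtain ⟨C2, hC2, h2⟩ := edge_bound
  set D := 3 + 21 * C with hD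
  obtain ⟨l1, hl1⟩ := ev_log_sqrt D
  refine ⟨4 * (C2 * D) + 2 * (A * C1) + 200, max (max 100 l1) (Real.exp T0), by positivity, (le_max_left _ _).trans (le_max_left _ _), ?_⟩
  intro l a b X hl ha hab hbX hX4 hX
  have hl100 : 100 ≤ l := (le_max_left _ _).trans ((le_max_left _ _).trans hl)
  have hll1 : l1 ≤ l := (le_max_right _ _).trans ((le_max_left _ _).trans hl)
  have hlT : T0 ≤ Real.log l := by
    rw [Real.le_log_iff_exp_le (by linarith)]; exact (le_max_right _ _).trans hl
  have hlog1 := one_le_log (l := l) (by linarith)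
  have hEr := Er_pos (l := l) (by linarith)
  have hl0 : 0 < l := by linarith
  have hsq := Real.mul_self_sqrt hl0.le
  have hs10 : 10 ≤ Real.sqrt l := by
    rw [Real.le_sqrt (by norm_num) (by linarith)]; norm_num; linarith
  have hsl : 2 * Real.sqrt l ≤ l := by nlinarith
  have hds := hl1 l hll1
  obtain ⟨n, hn1, hn2⟩ := exists_nat_pow_near (x := Real.log l) (y := (2:ℝ)) hlog1 (by norm_num)
  obtain ⟨I, hI⟩ := pow_unbounded_of_one_lt (Real.log X) (one_lt_two : (1:ℝ) < 2)
  set k := ⌈20 * Real.log l⌉₊ with hk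
  have hk1 : 20 * Real.log l ≤ k := Nat.le_ceil _
  have hk2 : (k:ℝ) ≤ 21 * Real.log l := by
    have := Nat.ceil_lt_add_one (show 0 ≤ 20 * Real.log l by linarith)
    linarith
  have hi2 : (2:ℝ)^(n+1) ≤ 2 * Real.log l := by rw [pow_succ]; linarith
  obtain ⟨c, hc⟩ : ∃ c : ℝ, c = 2 ^ (n+1) + C * k + 1 := ⟨_, rfl⟩
  have hcl : Real.log l ≤ c := by
    have : 0 ≤ C * k := by positivity
    linarith
  have hcD : c ≤ D * Real.log l := by
    have : C * k ≤ C * (21 * Real.log l) := by gcongr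
    rw [hD]; nlinarith
  have hcs : c ≤ Real.sqrt l := hcD.trans hds
  have hM := H a b X c (n+1) I k (by linarith) hX hI hc
  have hX0 : 0 < X := by linarith
  have edge : ∀ a', l ≤ a' → a' + l ≤ Real.log X → cnt (EdgeL a' c) X ≤ C2 * D * X * Er l := by
    intro a' h3 h4
    refine (h2 l c a' X hl100 hcl hcs h3 h4 hX0).trans ?_
    have hD1 : 1 ≤ D := by rw [hD]; linarith
    have e1 : (c / l) ^ erdosDelta ≤ D * (Real.log l / l) ^ erdosDelta := by
      calc (c / l) ^ erdosDelta ≤ (D * (Real.log l / l)) ^ erdosDelta := by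
            apply Real.rpow_le_rpow (by apply div_nonneg _ hl0.le; linarith) _ del_pos.le
            rw [← mul_div_assoc]; gcongr
        _ = D ^ erdosDelta * (Real.log l / l) ^ erdosDelta := Real.mul_rpow (by linarith) (by positivity)
        _ ≤ D ^ (1:ℝ) * (Real.log l / l) ^ erdosDelta := by
            gcongr
            have := del_lt; linarith
        _ = _ := by rw [Real.rpow_one]
    calc C2 * X * ((c / l) ^ erdosDelta / Real.log l ^ ((3:ℝ)/2)) ≤ C2 * X * (D * (Real.log l / l) ^ erdosDelta / Real.log l ^ ((3:ℝ)/2)) := by gcongr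
      _ = _ := by unfold Er; ring
  have e1 := edge a (by linarith) (by linarith)
  have e2 := edge (b - c) (by linarith) (by linarith)
  have e3 := edge (a - c) (by linarith) (by linarith)
  have e4 := edge b (by linarith) (by linarith)
  have k1 := h1 l (a + c) X (n+1) I hl100 hn2.le (by linarith) (by linarith) hX
  have k2 := h1 l (a - c) X (n+1) I hl100 hn2.le (by linarith) (by linarith) hX
  have iE := inv_Er (l := l) (by linarith)
  have p1 : (3/4:ℝ)^k * Real.log X ≤ 64 * Er l := by
    refine le_trans ?_ iE
    have q1 : (3/4:ℝ) ≤ Real.exp (-(1/4)) := by have := Real.add_one_le_exp (-(1/4):ℝ); linarith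
    calc (3/4:ℝ)^k * Real.log X ≤ Real.exp (-(1/4)) ^ k * l^4 := by
          have := Real.log_nonneg hX
          gcongr
      _ = Real.exp (k * (-(1/4))) * l^4 := by rw [Real.exp_nat_mul]
      _ ≤ Real.exp (-(5 * Real.log l)) * l^4 := by gcongr; linarith
      _ = 1 / l := by
        have : Real.exp (5 * Real.log l) = l^5 := by
          have := Real.exp_nat_mul (Real.log l) 5
          rw [Real.exp_log hl0] at this
          exact_mod_cast this
        rw [Real.exp_neg, this]; field_simp
  have p2 : (1:ℝ) ≤ X * (64 * Er l) := by
    have q1 : l ≤ X := by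
      have : Real.log l ≤ Real.log X := by
        have := Real.log_le_self hl0.le
        linarith
      exact (Real.log_le_log_iff hl0 hX0).1 this
    have := mul_le_mul_of_nonneg_left iE hX0.le
    refine le_trans ?_ this
    rw [mul_one_div, le_div_iff₀ hl0]; linarith
  have m1 := mul_le_mul_of_nonneg_left (add_le_add k1 k2) hA.le
  have m2 := mul_le_mul_of_nonneg_left p1 hX0.le
  refine hM.trans ?_
  nlinarith

end Erd

namespace Erd
open Finset

def Sm (b : ℝ) (n : ℕ) : Prop := ∀ p : ℕ, p.Prime → p ∣ n → (p : ℝ) ≤ Real.exp b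

lemma sab_smooth {a b : ℝ} {s m : ℕ} (h0 : s * m ≠ 0) (hm : ∀ p : ℕ, p.Prime → p ∣ m → ¬ (p : ℝ) ≤ Real.exp b) :
    Sab a b (s * m) ↔ Sab a b s := by
  constructor
  · rintro ⟨D, hD, h1, h2⟩
    refine ⟨D, ?_, h1, h2⟩
    have hD0 : D ≠ 0 := fun h => h0 (by rw [h] at hD; exact Nat.eq_zero_of_zero_dvd hD)
    refine Nat.Coprime.dvd_of_dvd_mul_right ?_ hD
    refine Nat.Coprime.symm (Nat.coprime_of_dvd ?_)
    intro p hp hpm hpD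
    apply hm p hp hpm
    have : p ≤ D := Nat.le_of_dvd (Nat.pos_of_ne_zero hD0) hpD
    have h3 : (D : ℝ) ≤ Real.exp b := by
      rw [← Real.log_le_iff_le_exp (by positivity)]; exact h2.le
    exact le_trans (by exact_mod_cast this) h3
  · rintro ⟨D, hD, h⟩
    exact ⟨D, hD.mul_right m, h⟩

open Classical in
noncomputable def iS (a b : ℝ) (n : ℕ) : ℝ := if Sab a b n then 1 else 0

noncomputable def fS (a b : ℝ) (d : ℕ) : ℝ := ∑ q ∈ d.divisorsAntidiagonal, (ArithmeticFunction.moebius q.1 : ℝ) * iS a b q.2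

lemma fS_sum (a b : ℝ) {n : ℕ} (hn : 0 < n) : ∑ d ∈ n.divisors, fS a b d = iS a b n :=
  (ArithmeticFunction.sum_eq_iff_sum_mul_moebius_eq (f := fS a b) (g := iS a b)).2 (fun _ _ => rfl) n hn

lemma iS_abs (a b : ℝ) (n : ℕ) : |iS a b n| ≤ 1 := by
  unfold iS; split_ifs <;> simp

lemma fS_abs (a b : ℝ) (d : ℕ) : |fS a b d| ≤ ∑ _q ∈ d.divisorsAntidiagonal, (1:ℝ) := by
  unfold fS
  refine (Finset.abs_sum_le_sum_abs _ _).trans (Finset.sum_le_sum fun q _ => ?_)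
  rw [abs_mul]
  have h1 : |(ArithmeticFunction.moebius q.1 : ℝ)| ≤ 1 := by
    have := ArithmeticFunction.abs_moebius_le_one (n := q.1)
    exact_mod_cast this
  have := iS_abs a b q.2
  nlinarith [abs_nonneg (iS a b q.2), abs_nonneg (ArithmeticFunction.moebius q.1 : ℝ)]

open Classical in
noncomputable def FS (b : ℝ) (N : ℕ) : Finset ℕ := (Icc 1 N).filter (Sm b)

lemma mem_FS {b : ℝ} {N d : ℕ} : d ∈ FS b N ↔ (1 ≤ d ∧ d ≤ N) ∧ Sm b d := by
  simp [FS]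

lemma iS_eq (a b : ℝ) {n N : ℕ} (hn : 1 ≤ n) (hN : n ≤ N) :
    iS a b n = ∑ d ∈ FS b N, if d ∣ n then fS a b d else 0 := by
  obtain ⟨s, m, hsm, hs, hm⟩ := split_part (fun p => (p : ℝ) ≤ Real.exp b) n (by omega)
  have h0 : s * m ≠ 0 := by omega
  have hs0 : s ≠ 0 := left_ne_zero_of_mul h0
  have h1 : iS a b n = iS a b s := by
    have hiff := sab_smooth (a := a) h0 hm
    rw [← hsm] at hiff
    unfold iS
    by_cases hc : Sab a b s
    · rw [if_pos hc, if_pos (hiff.2 hc)]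
    · rw [if_neg hc, if_neg (fun h => hc (hiff.1 h))]
  rw [h1, ← fS_sum a b (Nat.pos_of_ne_zero hs0), ← Finset.sum_filter]
  apply Finset.sum_congr _ (fun _ _ => rfl)
  ext d
  rw [Nat.mem_divisors, Finset.mem_filter, mem_FS]
  constructor
  · rintro ⟨hd, -⟩
    have hdn : d ∣ n := hsm ▸ hd.mul_right m
    refine ⟨⟨⟨?_, ?_⟩, ?_⟩, hdn⟩
    · exact Nat.pos_of_dvd_of_pos hdn hn
    · exact (Nat.le_of_dvd hn hdn).trans hN
    · exact fun p hp hpd => hs p hp (hpd.trans hd)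
  · rintro ⟨⟨-, hd⟩, hdn⟩
    refine ⟨?_, hs0⟩
    rw [hsm] at hdn
    refine Nat.Coprime.dvd_of_dvd_mul_right ?_ hdn
    refine Nat.Coprime.symm (Nat.coprime_of_dvd ?_)
    intro p hp hpm hpD
    exact hm p hp hpm (hd p hp hpD)

lemma cnt_fS (a b X : ℝ) : cnt (Sab a b) X = ∑ d ∈ FS b ⌊X⌋₊, fS a b d * ((⌊X⌋₊ / d : ℕ) : ℝ) := by
  classical
  rw [cnt_eq_sum]
  have : ∀ m ∈ Icc 1 ⌊X⌋₊, (if Sab a b m then (1:ℝ) else 0) = ∑ d ∈ FS b ⌊X⌋₊, if d ∣ m then fS a b d else 0 := by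
    intro m hm
    rw [Finset.mem_Icc] at hm
    rw [← iS_eq a b hm.1 hm.2]; unfold iS; congr!
  rw [Finset.sum_congr rfl this, Finset.sum_comm]
  apply Finset.sum_congr rfl
  intro d _
  rw [← Finset.sum_filter, Finset.sum_const, nsmul_eq_mul, mul_comm, ← Nat.Ioc_filter_dvd_card_eq_div]
  rfl

lemma cnt_fS_err (a b : ℝ) {X : ℝ} (hX : 1 ≤ X) :
    |cnt (Sab a b) X - X * ∑ d ∈ FS b ⌊X⌋₊, fS a b d / d| ≤ ∑ d ∈ FS b ⌊X⌋₊, |fS a b d| := by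
  rw [cnt_fS, Finset.mul_sum, ← Finset.sum_sub_distrib]
  refine (Finset.abs_sum_le_sum_abs _ _).trans (Finset.sum_le_sum fun d hd => ?_)
  have hd0 : (0:ℝ) < d := by exact_mod_cast (mem_FS.1 hd).1.1
  have e : fS a b d * ((⌊X⌋₊ / d : ℕ) : ℝ) - X * (fS a b d / d) = fS a b d * (((⌊X⌋₊ / d : ℕ) : ℝ) - X / d) := by ring
  rw [e, abs_mul]
  refine mul_le_of_le_one_right (abs_nonneg _) ?_
  rw [← Nat.floor_div_natCast, abs_le]
  have h1 := Nat.floor_le (show 0 ≤ X / d by positivity)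
  have h2 := Nat.lt_floor_add_one (X / d)
  constructor <;> linarith

lemma fS_rankin : ∃ C : ℝ, 0 < C ∧ ∀ a b : ℝ, 2 ≤ b → ∀ N, ∑ d ∈ FS b N, |fS a b d| * (d:ℝ) ^ (-(1 - 1/b)) ≤ C * b ^ 2 := by
  obtain ⟨C, hC, h⟩ := smooth_rankin
  refine ⟨C ^ 2, by positivity, fun a b hb N => ?_⟩
  have hh := h b hb (FS b N) (fun m hm => (mem_FS.1 hm).2)
  set w : ℕ → ℝ := fun m => (m:ℝ) ^ (-(1 - 1/b)) with hw
  have hw0 : ∀ m, 0 ≤ w m := fun m => Real.rpow_nonneg (Nat.cast_nonneg _) _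
  have hs0 : 0 ≤ ∑ m ∈ FS b N, w m := Finset.sum_nonneg fun m _ => hw0 m
  calc ∑ d ∈ FS b N, |fS a b d| * w d ≤ ∑ d ∈ FS b N, ∑ q ∈ d.divisorsAntidiagonal, w q.1 * w q.2 := by
        apply Finset.sum_le_sum
        intro d _
        refine (mul_le_mul_of_nonneg_right (fS_abs a b d) (hw0 d)).trans (le_of_eq ?_)
        rw [Finset.sum_mul]
        apply Finset.sum_congr rfl
        intro q hq
        have := (Nat.mem_divisorsAntidiagonal.1 hq).1
        simp only [hw, one_mul]
        rw [← Real.mul_rpow (by positivity) (by positivity), ← this]; push_cast; rfl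
    _ = ∑ x ∈ (FS b N).sigma (fun d => d.divisorsAntidiagonal), w x.2.1 * w x.2.2 := by
        rw [Finset.sum_sigma]
    _ = ∑ q ∈ ((FS b N).sigma (fun d => d.divisorsAntidiagonal)).image (fun x => x.2), w q.1 * w q.2 := by
        rw [Finset.sum_image]
        rintro ⟨d, q⟩ h1 ⟨d', q'⟩ h2 h3
        simp only at h3
        subst h3
        simp only [Finset.coe_sigma, Set.mem_sigma_iff, Finset.mem_coe, Nat.mem_divisorsAntidiagonal] at h1 h2
        have : d = d' := h1.2.1.symm.trans h2.2.1
        subst this; rfl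
    _ ≤ ∑ q ∈ FS b N ×ˢ FS b N, w q.1 * w q.2 := by
        apply Finset.sum_le_sum_of_subset_of_nonneg
        · intro q hq
          simp only [Finset.mem_image, Finset.mem_sigma, Nat.mem_divisorsAntidiagonal] at hq
          obtain ⟨⟨d, q'⟩, ⟨h1, h2, h3⟩, rfl⟩ := hq
          simp only at h1 h2 h3 ⊢
          rw [mem_FS] at h1
          rw [Finset.mem_product, mem_FS, mem_FS]
          have d1 : q'.1 ∣ d := ⟨_, h2.symm⟩
          have d2 : q'.2 ∣ d := ⟨q'.1, by rw [← h2, mul_comm]⟩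
          exact ⟨⟨⟨Nat.pos_of_dvd_of_pos d1 h1.1.1, (Nat.le_of_dvd h1.1.1 d1).trans h1.1.2⟩, fun p hp hpd => h1.2 p hp (hpd.trans d1)⟩,
            ⟨⟨Nat.pos_of_dvd_of_pos d2 h1.1.1, (Nat.le_of_dvd h1.1.1 d2).trans h1.1.2⟩, fun p hp hpd => h1.2 p hp (hpd.trans d2)⟩⟩
        · intro q _ _; exact mul_nonneg (hw0 _) (hw0 _)
    _ = (∑ m ∈ FS b N, w m) ^ 2 := by rw [sq, Finset.sum_mul_sum, Finset.sum_product]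
    _ ≤ (C * b) ^ 2 := pow_le_pow_left₀ hs0 hh 2
    _ = C ^ 2 * b ^ 2 := by ring

lemma rankin_cmp : ∃ C : ℝ, 0 < C ∧ ∀ a b x x' : ℝ, 2 ≤ b → 1 ≤ x' → x' ≤ x →
    |cnt (Sab a b) x / x - cnt (Sab a b) x' / x'| ≤ C * b ^ 2 * Real.exp (-(Real.log x' / b)) := by
  obtain ⟨C, hC, h⟩ := fS_rankin
  refine ⟨3 * C, by positivity, fun a b x x' hb hx' hxx => ?_⟩
  have hx : 1 ≤ x := hx'.trans hxx
  have hb0 : 0 < b := by linarith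
  have hh := h a b hb ⌊x⌋₊
  set w : ℕ → ℝ := fun m => (m:ℝ) ^ (-(1 - 1/b)) with hw
  have hw0 : ∀ m, 0 ≤ w m := fun m => Real.rpow_nonneg (Nat.cast_nonneg _) _
  set E := Real.exp (-(Real.log x' / b)) with hE
  have hE0 : 0 < E := Real.exp_pos _
  -- pointwise bounds
  have hinv : 1 / b ≤ 1 := by rw [div_le_one hb0]; linarith
  have key : ∀ d : ℕ, 1 ≤ d → ∀ y : ℝ, x' ≤ y → (d : ℝ) ≤ y → 1 / y ≤ E * w d := by
    intro d hd y hy hdy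
    have hd0 : (0:ℝ) < d := by exact_mod_cast hd
    have hx0 : 0 < x' := by linarith
    have hy0 : 0 < y := by linarith
    have l1 : Real.log x' ≤ Real.log y := Real.log_le_log hx0 hy
    have l2 : Real.log d ≤ Real.log y := Real.log_le_log hd0 hdy
    simp only [hw, hE]
    have ey : 1 / y = Real.exp (-Real.log y) := by rw [Real.exp_neg, Real.exp_log hy0, one_div]
    rw [Real.rpow_def_of_pos hd0, ← Real.exp_add, ey]
    apply Real.exp_le_exp.2
    have t1 : Real.log x' / b ≤ Real.log y * (1/b) := by rw [mul_one_div]; gcongr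
    have t2 : Real.log d * (1 - 1/b) ≤ Real.log y * (1 - 1/b) := mul_le_mul_of_nonneg_right l2 (by linarith)
    linarith
  have key2 : ∀ d : ℕ, 1 ≤ d → x' ≤ (d:ℝ) → 1 / (d:ℝ) ≤ E * w d := fun d hd h => key d hd d h le_rfl
  have sub : FS b ⌊x'⌋₊ ⊆ FS b ⌊x⌋₊ := by
    intro d hd
    rw [mem_FS] at hd ⊢
    exact ⟨⟨hd.1.1, hd.1.2.trans (Nat.floor_le_floor hxx)⟩, hd.2⟩
  set T := ∑ d ∈ FS b ⌊x⌋₊, |fS a b d| * w d with hT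
  have s1 : ∀ y, x' ≤ y → y ≤ x → 1 / y * (∑ d ∈ FS b ⌊y⌋₊, |fS a b d|) ≤ E * T := by
    intro y hy hyx
    rw [Finset.mul_sum, hT, Finset.mul_sum]
    have sub' : FS b ⌊y⌋₊ ⊆ FS b ⌊x⌋₊ := by
      intro d hd
      rw [mem_FS] at hd ⊢
      exact ⟨⟨hd.1.1, hd.1.2.trans (Nat.floor_le_floor hyx)⟩, hd.2⟩
    refine le_trans (Finset.sum_le_sum (g := fun d => E * (|fS a b d| * w d)) fun d hd => ?_)
      (Finset.sum_le_sum_of_subset_of_nonneg sub' fun d _ _ => by have := hw0 d; positivity)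
    rw [mem_FS] at hd
    have := key d hd.1.1 y hy ((Nat.le_floor_iff (by linarith)).1 hd.1.2)
    nlinarith [abs_nonneg (fS a b d)]
  have s2 : |∑ d ∈ FS b ⌊x⌋₊, fS a b d / d - ∑ d ∈ FS b ⌊x'⌋₊, fS a b d / d| ≤ E * T := by
    rw [← Finset.sum_sdiff sub, add_sub_cancel_right]
    refine (Finset.abs_sum_le_sum_abs _ _).trans ?_
    rw [hT, Finset.mul_sum]
    refine le_trans (Finset.sum_le_sum (g := fun d => E * (|fS a b d| * w d)) fun d hd => ?_)
      (Finset.sum_le_sum_of_subset_of_nonneg Finset.sdiff_subset fun d _ _ => by have := hw0 d; positivity)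
    rw [Finset.mem_sdiff, mem_FS, mem_FS] at hd
    have hd1 := hd.1.1.1
    have hlt : x' ≤ d := by
      by_contra hcon
      exact hd.2 ⟨⟨hd1, (Nat.le_floor_iff (by linarith)).2 (le_of_lt (not_le.1 hcon))⟩, hd.1.2⟩
    have := key2 d hd1 hlt
    rw [abs_div, Nat.abs_cast, div_eq_mul_one_div]
    nlinarith [abs_nonneg (fS a b d)]
  have q : ∀ y, x' ≤ y → y ≤ x → |cnt (Sab a b) y / y - ∑ d ∈ FS b ⌊y⌋₊, fS a b d / d| ≤ E * T := by
    intro y hy hyx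
    have hy0 : 0 < y := by linarith
    have := cnt_fS_err a b (X := y) (by linarith)
    refine le_trans ?_ (s1 y hy hyx)
    have e : cnt (Sab a b) y / y - ∑ d ∈ FS b ⌊y⌋₊, fS a b d / d = 1 / y * (cnt (Sab a b) y - y * ∑ d ∈ FS b ⌊y⌋₊, fS a b d / d) := by
      field_simp
    rw [e, abs_mul, abs_of_pos (show 0 < 1 / y by positivity)]
    gcongr
  have q1 := abs_le.1 (q x hxx le_rfl)
  have q2 := abs_le.1 (q x' le_rfl hxx)
  have q3 := abs_le.1 s2
  have : E * T ≤ E * (C * b ^ 2) := mul_le_mul_of_nonneg_left hh hE0.le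
  rw [abs_le]; constructor <;> nlinarith

end Erd

namespace Erd
open Finset

lemma GG_irr (a b : ℝ) (k : ℕ) : ∀ (S S' : List ℝ) (L : ℝ), 0 ≤ L → (∀ σ ∈ S', σ ∈ S ∨ b ≤ σ) →
    GG a b k S' L ≤ GG a b k S L := by
  induction k with
  | zero =>
    intro S S' L _ h
    simp only [GG]
    by_cases h' : ∃ σ ∈ S', a < σ ∧ σ < b
    · rw [if_pos h', if_pos]
      obtain ⟨σ, hσ, h1, h2⟩ := h'
      rcases h σ hσ with h3 | h3
      · exact ⟨σ, h3, h1, h2⟩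
      · linarith
    · rw [if_neg h']; split_ifs <;> norm_num
  | succ k ih =>
    intro S S' L hL h
    simp only [GG]
    apply intervalIntegral.integral_mono_on (by norm_num) (GG_ii a b k S' L 0 1) (GG_ii a b k S L 0 1)
    intro U hU
    apply ih
    · exact mul_nonneg (by linarith [hU.2]) hL
    · intro σ hσ
      rw [List.mem_append, List.mem_map] at hσ
      rw [List.mem_append, List.mem_map]
      rcases hσ with h1 | ⟨σ', h1, rfl⟩
      · rcases h σ h1 with h2 | h2
        · exact Or.inl (Or.inl h2)
        · exact Or.inr h2
      · rcases h σ' h1 with h2 | h2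
        · exact Or.inl (Or.inr ⟨σ', h2, rfl⟩)
        · exact Or.inr (by have := mul_nonneg hU.1 hL; linarith)

lemma GG_meas0 (a b : ℝ) (k : ℕ) : Measurable (fun L => GG a b k [0] L) := by
  have := GG_meas a b k (α := ℝ) [fun _ => 0] (by simp) (fun L => L) measurable_id
  simpa using this

lemma GG_ii0 (a b : ℝ) (k : ℕ) (u v : ℝ) : IntervalIntegrable (fun L => GG a b k [0] L) MeasureTheory.volume u v :=
  ii_of_bdd (GG_meas0 a b k) (fun U => (GG_mem a b k _ _).1) (fun U => (GG_mem a b k _ _).2) u v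

lemma avg_k (a b L : ℝ) (k : ℕ) (hb : 0 ≤ b) (hbL : b ≤ L) :
    |L * GG a b (k+1) [0] L - ∫ u in (0:ℝ)..L, GG a b k [0] u| ≤ b := by
  have e : ∫ u in (0:ℝ)..L, GG a b k [0] u = ∫ t in (0:ℝ)..L, GG a b k [0] (L - t) := by
    rw [intervalIntegral.integral_comp_sub_left (fun u => GG a b k [0] u) L]; simp
  have i2 : ∀ u v, IntervalIntegrable (fun t => GG a b k [0] (L - t)) MeasureTheory.volume u v := fun u v =>
    ii_of_bdd ((GG_meas0 a b k).comp (measurable_const.sub measurable_id)) (fun U => (GG_mem a b k _ _).1) (fun U => (GG_mem a b k _ _).2) u v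
  have i1 := GG_ii2 a b k [0] L
  rw [GG_int, e, ← intervalIntegral.integral_sub (i1 _ _) (i2 _ _)]
  set g : ℝ → ℝ := fun t => GG a b k ([0] ++ [0].map (fun σ => σ + t)) (L - t) - GG a b k [0] (L - t) with hg
  have ig : ∀ u v, IntervalIntegrable g MeasureTheory.volume u v := fun u v => (i1 u v).sub (i2 u v)
  have g0 : ∀ t, 0 ≤ g t := by
    intro t
    simp only [hg, sub_nonneg]
    exact GG_stab k a b a b 0 0 _ _ _ _ le_rfl (by simp) (by simp) (by linarith) (by linarith)
  have g1 : ∀ t, g t ≤ 1 := by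
    intro t
    have := (GG_mem a b k ([0] ++ [0].map (fun σ => σ + t)) (L - t)).2
    have := (GG_mem a b k [0] (L - t)).1
    simp only [hg]; linarith
  have gz : ∀ t ∈ Set.Icc b L, g t ≤ 0 := by
    intro t ht
    have := GG_irr a b k [0] ([0] ++ [0].map (fun σ => σ + t)) (L - t) (by linarith [ht.2]) (by
      intro σ hσ
      simp only [List.map_cons, List.map_nil, List.cons_append, List.nil_append, List.mem_cons, List.not_mem_nil, or_false, zero_add] at hσ ⊢
      rcases hσ with h | h
      · exact Or.inl h
      · exact Or.inr (by rw [h]; exact ht.1))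
    simp only [hg]; linarith
  change |∫ t in (0:ℝ)..L, g t| ≤ b
  rw [abs_of_nonneg (intervalIntegral.integral_nonneg (by linarith) fun t _ => g0 t),
    ← intervalIntegral.integral_add_adjacent_intervals (ig 0 b) (ig b L)]
  have h1 : ∫ t in (0:ℝ)..b, g t ≤ ∫ t in (0:ℝ)..b, (1:ℝ) :=
    intervalIntegral.integral_mono_on hb (ig _ _) (by simp) fun t _ => g1 t
  have h2 : ∫ t in b..L, g t ≤ ∫ t in b..L, (0:ℝ) :=
    intervalIntegral.integral_mono_on hbL (ig _ _) (by simp) gz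
  simp at h1 h2
  linarith

lemma GG_tend (a b L : ℝ) : Tendsto (fun k => GG a b k [0] L) atTop (nhds (hL a b L)) :=
  tendsto_atTop_ciSup (fun _ _ h => GG_mono_k' a b [0] L h) (hL_bdd a b L)

lemma hL_meas (a b : ℝ) : Measurable (fun L => hL a b L) :=
  measurable_of_tendsto_metrizable (f := fun k L => GG a b k [0] L) (fun k => GG_meas0 a b k)
    (tendsto_pi_nhds.2 fun L => GG_tend a b L)

lemma hL_ii (a b u v : ℝ) : IntervalIntegrable (fun L => hL a b L) MeasureTheory.volume u v :=
  ii_of_bdd (hL_meas a b) (fun L => hL_nonneg a b L) (fun L => hL_le_one a b L) u v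

lemma avg_hL (a b L : ℝ) (hb : 0 ≤ b) (hbL : b ≤ L) :
    |L * hL a b L - ∫ u in (0:ℝ)..L, hL a b u| ≤ b := by
  have t1 : Tendsto (fun k => ∫ u in (0:ℝ)..L, GG a b k [0] u) atTop (nhds (∫ u in (0:ℝ)..L, hL a b u)) := by
    apply intervalIntegral.tendsto_integral_filter_of_dominated_convergence (fun _ => (1:ℝ))
    · exact Filter.Eventually.of_forall fun k => (GG_meas0 a b k).aestronglyMeasurable
    · refine Filter.Eventually.of_forall fun k => Filter.Eventually.of_forall fun u _ => ?_
      rw [Real.norm_of_nonneg (GG_mem a b k _ _).1]; exact (GG_mem a b k _ _).2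
    · simp
    · exact Filter.Eventually.of_forall fun u _ => GG_tend a b u
  have t2 : Tendsto (fun k => GG a b (k+1) [0] L) atTop (nhds (hL a b L)) := (GG_tend a b L).comp (tendsto_add_atTop_nat 1)
  exact le_of_tendsto (((t2.const_mul L).sub t1).abs) (Filter.Eventually.of_forall fun k => avg_k a b L k hb hbL)

lemma hL_slow (a b L L' : ℝ) (hb : 0 ≤ b) (hL0 : 0 < L) (hbL : b ≤ L) (hLL : L ≤ L') :
    |hL a b L - hL a b L'| ≤ 4 * b / L := by
  set H : ℝ → ℝ := fun L => hL a b L with hH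
  set A : ℝ → ℝ := fun L => (∫ u in (0:ℝ)..L, H u) / L with hA
  have iH : ∀ u v, IntervalIntegrable H MeasureTheory.volume u v := fun u v => hL_ii a b u v
  have A01 : ∀ r, 0 < r → 0 ≤ A r ∧ A r ≤ 1 := by
    intro r hr
    simp only [hA]
    constructor
    · exact div_nonneg (intervalIntegral.integral_nonneg hr.le fun t _ => hL_nonneg a b t) hr.le
    · rw [div_le_one hr]
      calc _ ≤ ∫ u in (0:ℝ)..r, (1:ℝ) := intervalIntegral.integral_mono_on hr.le (iH _ _) (by simp) fun t _ => hL_le_one a b t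
        _ = r := by simp
  have HA : ∀ r, 0 < r → b ≤ r → |H r - A r| ≤ b / r := by
    intro r hr hbr
    have := avg_hL a b r hb hbr
    have e : H r - A r = (r * hL a b r - ∫ u in (0:ℝ)..r, hL a b u) / r := by
      simp only [hA, hH]; field_simp
    rw [e, abs_div, abs_of_pos hr]
    gcongr
  have step : ∀ n : ℕ, ∀ L, 0 < L → b ≤ L → ∀ r, L ≤ r → r ≤ 2 * L → |A r - A L| ≤ b / L + (1/2:ℝ)^n := by
    intro n
    induction n with
    | zero =>
      intro L h0 h1 r h2 h3
      have q1 := A01 L h0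
      have q2 := A01 r (by linarith)
      have : 0 ≤ b / L := by positivity
      rw [abs_le]; constructor <;> simp <;> linarith
    | succ n ih =>
      intro L h0 h1 r h2 h3
      have hr : 0 < r := by linarith
      have e : A r - A L = (∫ t in L..r, (H t - A L)) / r := by
        rw [intervalIntegral.integral_sub (iH _ _) (by simp)]
        have : ∫ t in (0:ℝ)..r, H t = (∫ t in (0:ℝ)..L, H t) + ∫ t in L..r, H t :=
          (intervalIntegral.integral_add_adjacent_intervals (iH _ _) (iH _ _)).symm
        simp only [hA, this]
        simp
        field_simp
        ring
      have bd : ‖∫ t in L..r, (H t - A L)‖ ≤ (b / L + (b / L + (1/2:ℝ)^n)) * |r - L| := by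
        apply intervalIntegral.norm_integral_le_of_norm_le_const
        intro t ht
        rw [Set.uIoc_of_le h2] at ht
        have q1 := HA t (by linarith [ht.1]) (by linarith [ht.1])
        have q2 := ih L h0 h1 t ht.1.le (by linarith [ht.2])
        have q3 : b / t ≤ b / L := div_le_div_of_nonneg_left hb h0 ht.1.le
        rw [Real.norm_eq_abs]
        calc |H t - A L| ≤ |H t - A t| + |A t - A L| := abs_sub_le _ _ _
          _ ≤ _ := by linarith
      rw [e, abs_div, abs_of_pos hr, div_le_iff₀ hr]
      rw [Real.norm_eq_abs, abs_of_nonneg (show 0 ≤ r - L by linarith)] at bd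
      refine bd.trans ?_
      have hM : 0 ≤ b / L + (1/2:ℝ)^(n+1) := by positivity
      have e2 : b / L + (b / L + (1/2:ℝ)^n) = 2 * (b / L + (1/2:ℝ)^(n+1)) := by rw [pow_succ]; ring
      rw [e2]
      nlinarith
  have step2 : ∀ L, 0 < L → b ≤ L → ∀ r, L ≤ r → r ≤ 2 * L → |A r - A L| ≤ b / L := by
    intro L h0 h1 r h2 h3
    have t : Tendsto (fun n : ℕ => b / L + (1/2:ℝ)^n) atTop (nhds (b / L + 0)) :=
      tendsto_const_nhds.add (tendsto_pow_atTop_nhds_zero_of_lt_one (by norm_num) (by norm_num))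
    rw [add_zero] at t
    exact ge_of_tendsto t (Filter.Eventually.of_forall fun n => step n L h0 h1 r h2 h3)
  have step3 : ∀ n : ℕ, ∀ L, 0 < L → b ≤ L → ∀ r, L ≤ r → r ≤ 2 ^ n * L → |A r - A L| ≤ 2 * (b / L) := by
    intro n
    induction n with
    | zero =>
      intro L h0 h1 r h2 h3
      have : r = L := by simp at h3; linarith
      rw [this]; simp; positivity
    | succ n ih =>
      intro L h0 h1 r h2 h3
      have hp : 0 ≤ b / L := by positivity
      by_cases h4 : r ≤ 2 * L
      · have := step2 L h0 h1 r h2 h4; linarith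
      · have q1 := step2 L h0 h1 (2 * L) (by linarith) le_rfl
        have q2 := ih (2 * L) (by linarith) (by linarith) r (by linarith) (by rw [pow_succ] at h3; linarith)
        have e : 2 * (b / (2 * L)) = b / L := by field_simp
        calc |A r - A L| ≤ |A r - A (2 * L)| + |A (2 * L) - A L| := abs_sub_le _ _ _
          _ ≤ _ := by linarith
  obtain ⟨n, hn⟩ := pow_unbounded_of_one_lt (L' / L) (show (1:ℝ) < 2 by norm_num)
  rw [div_lt_iff₀ hL0] at hn
  have q1 := abs_le.1 (step3 n L hL0 hbL L' hLL hn.le)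
  have q2 := abs_le.1 (HA L hL0 hbL)
  have q3 := abs_le.1 (HA L' (by linarith) (by linarith))
  have q4 : b / L' ≤ b / L := div_le_div_of_nonneg_left hb hL0 hLL
  have e : 4 * b / L = 4 * (b / L) := by ring
  change |H L - H L'| ≤ _
  rw [e, abs_le]; constructor <;> linarith

end Erd

namespace Erd
open Finset

lemma Hcnt_eq {x y z : ℝ} (hx : 0 ≤ x) (hy : 0 < y) (hz : 0 < z) : (Hcnt x y z : ℝ) = cnt (Sab (Real.log y) (Real.log z)) x := by
  classical
  unfold Hcnt cnt
  rw [← Set.ncard_coe_finset]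
  congr 2
  ext n
  simp only [Set.mem_setOf_eq, Finset.coe_filter, Finset.mem_Icc, Nat.le_floor_iff hx, and_assoc, Sab]
  refine and_congr_right fun hn => and_congr_right fun _ => exists_congr fun d => and_congr_right fun hd => ?_
  have hd0 : (0:ℝ) < d := by exact_mod_cast Nat.pos_of_dvd_of_pos hd hn
  rw [Real.log_lt_log_iff hy hd0, Real.log_lt_log_iff hd0 hz]

lemma Er_le {l : ℝ} (hl : 3 ≤ l) : Er l ≤ 1 / Real.log l := by
  have h1 := one_le_log hl
  have h2 : Real.log l ≤ l := (Real.log_le_sub_one_of_pos (by linarith)).trans (by linarith)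
  have h3 : (Real.log l / l) ^ erdosDelta ≤ 1 := Real.rpow_le_one (by positivity) ((div_le_one (by linarith)).2 h2) del_pos.le
  have h4 : Real.log l ≤ Real.log l ^ ((3:ℝ)/2) := by
    calc Real.log l = Real.log l ^ (1:ℝ) := (Real.rpow_one _).symm
      _ ≤ _ := Real.rpow_le_rpow_of_exponent_le h1 (by norm_num)
  unfold Er
  exact div_le_div₀ zero_le_one h3 (by linarith) h4

lemma Er_eq {l : ℝ} (hl : 3 ≤ l) : Er l = 1 / (Real.log l ^ ((3:ℝ)/2 - erdosDelta) * l ^ erdosDelta) := by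
  have h1 := one_le_log hl
  unfold Er
  rw [Real.div_rpow (by linarith) (by linarith), Real.rpow_sub (by linarith)]
  have : 0 < Real.log l ^ erdosDelta := Real.rpow_pos_of_pos (by linarith) _
  have : 0 < Real.log l ^ ((3:ℝ)/2) := Real.rpow_pos_of_pos (by linarith) _
  have : 0 < l ^ erdosDelta := Real.rpow_pos_of_pos (by linarith) _
  field_simp

lemma Er_half {l : ℝ} (hl : 3 ≤ l) : Er l ≤ 8 * Er (2 * l) := by
  have h1 := one_le_log hl
  have h1' := one_le_log (show 3 ≤ 2 * l by linarith)
  have e : Real.log (2 * l) = Real.log 2 + Real.log l := Real.log_mul (by norm_num) (by linarith)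
  have h2 : Real.log (2 * l) ≤ 2 * Real.log l := by
    rw [e]
    have := Real.log_le_log (by norm_num) (show (2:ℝ) ≤ l by linarith)
    linarith
  have h3 : Real.log (2 * l) ^ ((3:ℝ)/2 - erdosDelta) ≤ 4 * Real.log l ^ ((3:ℝ)/2 - erdosDelta) := by
    have hd := del_pos
    have hd' := del_lt
    calc _ ≤ (2 * Real.log l) ^ ((3:ℝ)/2 - erdosDelta) := Real.rpow_le_rpow (by linarith) h2 (by linarith)
      _ = 2 ^ ((3:ℝ)/2 - erdosDelta) * Real.log l ^ ((3:ℝ)/2 - erdosDelta) := Real.mul_rpow (by norm_num) (by linarith)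
      _ ≤ _ := by
        apply mul_le_mul_of_nonneg_right _ (Real.rpow_nonneg (by linarith) _)
        calc (2:ℝ) ^ ((3:ℝ)/2 - erdosDelta) ≤ 2 ^ (2:ℝ) := Real.rpow_le_rpow_of_exponent_le (by norm_num) (by linarith)
          _ = 4 := by norm_num
  have h4 : (2 * l) ^ erdosDelta ≤ 2 * l ^ erdosDelta := by
    have hd := del_pos
    have hd' := del_lt
    rw [Real.mul_rpow (by norm_num) (by linarith)]
    apply mul_le_mul_of_nonneg_right _ (Real.rpow_nonneg (by linarith) _)
    calc (2:ℝ) ^ erdosDelta ≤ 2 ^ (1:ℝ) := Real.rpow_le_rpow_of_exponent_le (by norm_num) (by linarith)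
      _ = 2 := by norm_num
  rw [Er_eq hl, Er_eq (show 3 ≤ 2 * l by linarith)]
  have p1 : 0 < Real.log l ^ ((3:ℝ)/2 - erdosDelta) := Real.rpow_pos_of_pos (by linarith) _
  have p2 : 0 < l ^ erdosDelta := Real.rpow_pos_of_pos (by linarith) _
  have p3 : 0 < Real.log (2 * l) ^ ((3:ℝ)/2 - erdosDelta) := Real.rpow_pos_of_pos (by linarith) _
  have p4 : 0 < (2 * l) ^ erdosDelta := Real.rpow_pos_of_pos (by linarith) _
  rw [mul_one_div, div_le_div_iff₀ (by positivity) (by positivity)]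
  have := mul_le_mul h3 h4 p4.le (by positivity)
  nlinarith

lemma cnt_ge (P : ℕ → Prop) {X : ℝ} : X - 1 - cnt (fun m => ¬ P m) X ≤ cnt P X := by
  rw [cnt_not]
  have := Nat.lt_floor_add_one X
  linarith

/-- convergence in the interior range -/
lemma hlim {u v : ℝ} (hu : 0 < u) (huv : u < v) (hv : v < 1) :
    Tendsto (fun x : ℝ => cnt (Sab (u * Real.log x) (v * Real.log x)) x / x) atTop (nhds (hL u v 1)) := by
  obtain ⟨C, l0, hC, hl0, H⟩ := main_thm
  set κ := min u (1 - v) / 2 with hκ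
  have hκ0 : 0 < κ := by
    have : 0 < min u (1 - v) := lt_min hu (by linarith)
    positivity
  have k1 : 2 * κ ≤ u := by have := min_le_left u (1 - v); rw [hκ]; linarith
  have k2 : 2 * κ ≤ 1 - v := by have := min_le_right u (1 - v); rw [hκ]; linarith
  have tl : Tendsto (fun x : ℝ => κ * Real.log x) atTop atTop := Real.tendsto_log_atTop.const_mul_atTop hκ0
  have tE : Tendsto (fun x : ℝ => C * (1 / Real.log (κ * Real.log x))) atTop (nhds 0) := by
    have := (tendsto_const_nhds (x := (1:ℝ))).div_atTop (Real.tendsto_log_atTop.comp tl)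
    have := this.const_mul C
    simpa using this
  rw [tendsto_iff_norm_sub_tendsto_zero]
  refine squeeze_zero' (Filter.Eventually.of_forall fun x => norm_nonneg _) ?_ tE
  have e1 : ∀ᶠ x : ℝ in atTop, l0 ≤ κ * Real.log x := tl.eventually_ge_atTop l0
  have e2 : ∀ᶠ x : ℝ in atTop, 1 / κ ^ 4 ≤ Real.log x := Real.tendsto_log_atTop.eventually_ge_atTop _
  filter_upwards [e1, e2, eventually_ge_atTop 1, Real.tendsto_log_atTop.eventually_ge_atTop 1] with x h1 h2 h3 h4
  set L := Real.log x with hLd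
  have hx0 : 0 < x := by linarith
  have hL4 : L ≤ (κ * L) ^ 4 := by
    rw [div_le_iff₀ (by positivity)] at h2
    have : 1 ≤ L ^ 2 := one_le_pow₀ h4
    have e : (κ * L) ^ 4 = (L * κ ^ 4) * (L * L ^ 2) := by ring
    rw [e]
    have : L ≤ L * L ^ 2 := by nlinarith
    nlinarith
  have := H (κ * L) (u * L) (v * L) x h1 (by nlinarith) (by nlinarith) (by nlinarith) hL4 h3
  have es : hL (u * L) (v * L) L = hL u v 1 := by
    have := hL_scale (show 0 < L by linarith) u v 1
    rw [mul_one, mul_comm L u, mul_comm L v] at this; exact this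
  rw [← hLd, es] at this
  have eq : cnt (Sab (u * L) (v * L)) x / x - hL u v 1 = (cnt (Sab (u * L) (v * L)) x - x * hL u v 1) / x := by
    field_simp
  rw [Real.norm_eq_abs, eq, abs_div, abs_of_pos hx0, div_le_iff₀ hx0]
  have hE := Er_le (show 3 ≤ κ * L by linarith)
  have := mul_le_mul_of_nonneg_left hE (show 0 ≤ C * x by positivity)
  linarith

lemma gap_S : ∃ C : ℝ, 0 < C ∧ ∀ a b X : ℝ, Real.log 2 ≤ a → 2 * a ≤ b → b ≤ Real.log X → 1 ≤ X →
    X - 1 - C * X * (a / b) ≤ cnt (Sab a b) X := by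
  obtain ⟨C, hC, h⟩ := gap_cnt
  refine ⟨2 * C, by positivity, fun a b X ha hab hb hX => ?_⟩
  have hl2 := Real.log_pos (show (1:ℝ) < 2 by norm_num)
  have g := h (Real.exp a) (Real.exp (b/2)) X ((Real.log_le_iff_le_exp (by norm_num)).1 ha) (Real.exp_le_exp.2 (by linarith))
    ((Real.le_log_iff_exp_le (by linarith)).1 (by linarith))
  rw [Real.log_exp, Real.log_exp] at g
  refine le_trans ?_ (cnt_ge (Sab a b))
  have m : cnt (fun m => ¬ Sab a b m) X ≤ cnt (fun n => ∀ p : ℕ, p.Prime → (Real.exp a < p ∧ (p:ℝ) ≤ Real.exp (b/2)) → ¬ p ∣ n) X := by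
    apply cnt_mono
    intro n _ _ hn p hp ⟨h1, h2⟩ hd
    have hp0 : (0:ℝ) < p := by exact_mod_cast hp.pos
    apply hn
    refine ⟨p, hd, (Real.lt_log_iff_exp_lt hp0).2 h1, ?_⟩
    have := (Real.log_le_iff_le_exp hp0).2 h2
    linarith
  have e : C * X * (a / (b/2)) = 2 * C * X * (a / b) := by
    have : b ≠ 0 := by linarith
    field_simp
  rw [e] at g
  linarith

lemma hL_gap : ∃ C : ℝ, 0 < C ∧ ∀ a b L : ℝ, 0 < a → 2 * a ≤ b → b < L → 1 - C * (a / b) ≤ hL a b L := by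
  obtain ⟨C, hC, h⟩ := gap_S
  refine ⟨C, hC, fun a b L ha hab hbL => ?_⟩
  have hL0 : 0 < L := by linarith
  have hb0 : 0 < b := by linarith
  have es : hL a b L = hL (a / L) (b / L) 1 := by
    have := hL_scale hL0 (a / L) (b / L) 1
    rw [← this]; congr 1 <;> field_simp
  rw [es]
  have t := hlim (u := a / L) (v := b / L) (by positivity) (by gcongr; linarith) (by rw [div_lt_one hL0]; exact hbL)
  have t2 : Tendsto (fun x : ℝ => 1 - 1 / x - C * (a / b)) atTop (nhds (1 - C * (a / b))) := by
    have : Tendsto (fun x : ℝ => 1 / x) atTop (nhds 0) := by simpa using tendsto_inv_atTop_zero (𝕜 := ℝ)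
    have := (this.const_sub 1).sub_const (C * (a / b))
    simpa using this
  refine le_of_tendsto_of_tendsto t2 t ?_
  have e1 : ∀ᶠ x : ℝ in atTop, Real.log 2 / (a / L) ≤ Real.log x := Real.tendsto_log_atTop.eventually_ge_atTop _
  filter_upwards [e1, eventually_ge_atTop 1, Real.tendsto_log_atTop.eventually_ge_atTop 1] with x h1 h2 h3
  rw [div_le_iff₀ (by positivity), mul_comm] at h1
  have hx0 : 0 < x := by linarith
  have hl0 : 0 < Real.log x := by linarith
  have := h (a / L * Real.log x) (b / L * Real.log x) x h1 (by
    have : 2 * (a / L) ≤ b / L := by rw [← mul_div_assoc]; gcongr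
    nlinarith) (by
    have : b / L ≤ 1 := (div_le_one hL0).2 hbL.le
    nlinarith) h2
  rw [le_div_iff₀ hx0]
  have e : a / L * Real.log x / (b / L * Real.log x) = a / b := by field_simp
  rw [e] at this
  have e2 : (1 - 1 / x - C * (a / b)) * x = x - 1 - C * x * (a / b) := by field_simp
  rw [e2]; exact this

lemma big : ∃ K l0 : ℝ, 0 < K ∧ 100 ≤ l0 ∧ ∀ l b x : ℝ, l0 ≤ l → 2 * l < b → 2 * b ≤ Real.log x → 1 ≤ x →
    |cnt (Sab (2 * l) b) x - x * hL (2 * l) b (Real.log x)| ≤ K * x * Er l := by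
  obtain ⟨C, l0, hC, hl0, H⟩ := main_thm
  obtain ⟨C1, hC1, H1⟩ := gap_S
  obtain ⟨C2, hC2, H2⟩ := hL_gap
  obtain ⟨C3, hC3, H3⟩ := rankin_cmp
  refine ⟨C + 64 * (1 + 2 * C1 + 2 * C2) + 64 * (6 * C3 + 4), l0, by positivity, hl0, fun l b x hl hb hbx hx => ?_⟩
  have hl100 : 100 ≤ l := hl0.trans hl
  have hEr : 0 < Er l := Er_pos (by linarith)
  have hi := inv_Er (show 3 ≤ l by linarith)
  have hx0 : 0 < x := by linarith
  have hlp : 0 < l := by linarith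
  have hli : 0 < 1 / l := by positivity
  set a := 2 * l with ha
  set L := Real.log x with hLd
  -- reduce to normalised form
  suffices hs : |cnt (Sab a b) x / x - hL a b L| ≤ (C + 64 * (1 + 2 * C1 + 2 * C2) + 64 * (6 * C3 + 4)) * Er l by
    have eq : cnt (Sab a b) x - x * hL a b L = x * (cnt (Sab a b) x / x - hL a b L) := by field_simp
    rw [eq, abs_mul, abs_of_pos hx0]
    calc _ ≤ x * ((C + 64 * (1 + 2 * C1 + 2 * C2) + 64 * (6 * C3 + 4)) * Er l) := mul_le_mul_of_nonneg_left hs hx0.le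
      _ = _ := by ring
  have norm : ∀ y, 0 < y → ∀ D, |cnt (Sab a b) y - y * hL a b (Real.log y)| ≤ C * y * D → |cnt (Sab a b) y / y - hL a b (Real.log y)| ≤ C * D := by
    intro y hy D hh
    have eq : cnt (Sab a b) y / y - hL a b (Real.log y) = (cnt (Sab a b) y - y * hL a b (Real.log y)) / y := by field_simp
    rw [eq, abs_div, abs_of_pos hy, div_le_iff₀ hy]; linarith
  have w1 : 0 ≤ 64 * (1 + 2 * C1 + 2 * C2) * Er l := by positivity
  have w2 : 0 ≤ 64 * (6 * C3 + 4) * Er l := by positivity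
  have w3 : 0 ≤ C * Er l := by positivity
  have hc01 : cnt (Sab a b) x / x ≤ 1 := by rw [div_le_one hx0]; exact cnt_le _ hx0.le
  have hh1 := hL_le_one a b L
  have hl2 : l * 100 ≤ l ^ 2 := by nlinarith
  by_cases hc : L ≤ l ^ 4
  · have := norm x hx0 _ (H l a b x hl le_rfl hb.le (by linarith) hc hx)
    rw [← hLd] at this
    linarith
  push Not at hc
  have hl4 : l ^ 4 = l ^ 2 * l ^ 2 := by ring
  have hl24 : l ^ 2 * 100 ≤ l ^ 4 := by rw [hl4]; nlinarith
  by_cases hbl : l ^ 2 ≤ b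
  · have hab : 2 * a ≤ b := by linarith
    have hlog2 : Real.log 2 ≤ 2 := (Real.log_le_sub_one_of_pos (by norm_num)).trans (by norm_num)
    have g1 := H1 a b x (by linarith) hab (by linarith) hx
    have g2 := H2 a b L (by linarith) hab (by linarith)
    have hb0 : 0 < b := by linarith
    have hq : a / b ≤ 2 * (1 / l) := by
      rw [div_le_iff₀ hb0, ha]
      have : 2 * (1 / l) * b ≥ 2 * (1 / l) * l ^ 2 := by gcongr
      have e : 2 * (1 / l) * l ^ 2 = 2 * l := by field_simp
      linarith
    have hxl : 1 / x ≤ 1 / l := by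
      apply one_div_le_one_div_of_le hlp
      have := Real.log_le_sub_one_of_pos hx0
      linarith
    have g3 : 1 - 1 / x - C1 * (a / b) ≤ cnt (Sab a b) x / x := by
      rw [le_div_iff₀ hx0]
      have e2 : (1 - 1 / x - C1 * (a / b)) * x = x - 1 - C1 * x * (a / b) := by field_simp
      rw [e2]; exact g1
    have q1 := mul_le_mul_of_nonneg_left hq hC1.le
    have q2 := mul_le_mul_of_nonneg_left hq hC2.le
    have q3 := mul_le_mul_of_nonneg_left hi (show 0 ≤ 1 + 2 * C1 + 2 * C2 by positivity)
    have p1 := mul_nonneg hC1.le hli.le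
    have p2 := mul_nonneg hC2.le hli.le
    rw [abs_le]; constructor <;> linarith
  · push Not at hbl
    set x' := Real.exp (l ^ 4) with hx'
    have lx' : Real.log x' = l ^ 4 := Real.log_exp _
    have hx'1 : 1 ≤ x' := Real.one_le_exp (by positivity)
    have hxx : x' ≤ x := by rw [hx', ← Real.le_log_iff_exp_le hx0]; exact hc.le
    have m := norm x' (by linarith) _ (H l a b x' hl le_rfl hb.le (by rw [lx']; linarith) lx'.le hx'1)
    have r := H3 a b x x' (by linarith) hx'1 hxx
    rw [lx'] at m r
    have s := hL_slow a b (l ^ 4) L (by linarith) (by positivity) (by linarith) hc.le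
    have hb0 : 0 < b := by linarith
    have r2 : C3 * b ^ 2 * Real.exp (-(l ^ 4 / b)) ≤ 6 * C3 * (1 / l) := by
      have t1 : Real.exp (-(l ^ 4 / b)) ≤ Real.exp (-(l ^ 2)) := by
        apply Real.exp_le_exp.2
        have : l ^ 2 ≤ l ^ 4 / b := by rw [le_div_iff₀ hb0, hl4]; gcongr
        linarith
      have t2 : Real.exp (-(l^2)) ≤ 6 / (l ^ 2) ^ 3 := by
        have := Real.pow_div_factorial_le_exp (l ^ 2) (by positivity) 3
        rw [Real.exp_neg, ← one_div, div_le_div_iff₀ (Real.exp_pos _) (by positivity)]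
        have e : (Nat.factorial 3 : ℝ) = 6 := by norm_num [Nat.factorial]
        rw [e, div_le_iff₀ (by norm_num)] at this
        linarith
      have t3 : b ^ 2 ≤ (l ^ 2) ^ 2 := pow_le_pow_left₀ hb0.le hbl.le 2
      calc C3 * b ^ 2 * Real.exp (-(l ^ 4 / b)) ≤ C3 * (l ^ 2) ^ 2 * (6 / (l ^ 2) ^ 3) := by
            apply mul_le_mul (mul_le_mul_of_nonneg_left t3 hC3.le) (t1.trans t2) (Real.exp_pos _).le (by positivity)
        _ = 6 * C3 * (1 / l) * (1 / l) := by field_simp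
        _ ≤ 6 * C3 * (1 / l) := by
            apply mul_le_of_le_one_right (by positivity)
            rw [div_le_one hlp]; linarith
    have s2 : 4 * b / l ^ 4 ≤ 4 * (1 / l) := by
      rw [div_le_iff₀ (by positivity)]
      have e : 4 * (1 / l) * l ^ 4 = 4 * (l * l ^ 2) := by field_simp
      rw [e]; nlinarith
    have q3 := mul_le_mul_of_nonneg_left hi (show 0 ≤ 6 * C3 + 4 by positivity)
    have m' := abs_le.1 m
    have r' := abs_le.1 r
    have s' := abs_le.1 s
    rw [abs_le]; constructor <;> linarith

open Classical in
noncomputable def hfin (u v : ℝ) : ℝ := if u ≤ 0 ∨ 1 ≤ v then 1 else hL u v 1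

lemma part_one (u v : ℝ) (hu : 0 ≤ u) (huv : u < v) (hv : v ≤ 1) :
    Tendsto (fun x : ℝ => (Hcnt x (x ^ u) (x ^ v) : ℝ) / x) atTop (nhds (hfin u v)) := by
  have heq : ∀ᶠ x : ℝ in atTop, (Hcnt x (x ^ u) (x ^ v) : ℝ) / x = cnt (Sab (u * Real.log x) (v * Real.log x)) x / x := by
    filter_upwards [eventually_gt_atTop 0] with x hx
    rw [Hcnt_eq hx.le (Real.rpow_pos_of_pos hx _) (Real.rpow_pos_of_pos hx _), Real.log_rpow hx, Real.log_rpow hx]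
  rw [tendsto_congr' heq]
  have hle : ∀ᶠ x : ℝ in atTop, cnt (Sab (u * Real.log x) (v * Real.log x)) x / x ≤ 1 := by
    filter_upwards [eventually_gt_atTop 0] with x hx
    rw [div_le_one hx]; exact cnt_le _ hx.le
  have tinv : Tendsto (fun x : ℝ => 1 / x) atTop (nhds 0) := by simpa using tendsto_inv_atTop_zero (𝕜 := ℝ)
  unfold hfin
  split_ifs with hc
  · by_cases h0 : u ≤ 0
    · have hu0 : u = 0 := le_antisymm h0 hu
      subst hu0
      obtain ⟨C, hC, h⟩ := rough_cnt
      have t : Tendsto (fun x : ℝ => 1 - 1 / x - C * (1 / (v / 2 * Real.log x))) atTop (nhds 1) := by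
        have t2 : Tendsto (fun x : ℝ => 1 / (v / 2 * Real.log x)) atTop (nhds 0) :=
          (tendsto_const_nhds (x := (1:ℝ))).div_atTop (Real.tendsto_log_atTop.const_mul_atTop (by linarith))
        have := (tinv.const_sub 1).sub (t2.const_mul C)
        simpa using this
      refine tendsto_of_tendsto_of_tendsto_of_le_of_le' t tendsto_const_nhds ?_ hle
      filter_upwards [eventually_ge_atTop 1, (Real.tendsto_log_atTop.const_mul_atTop (show 0 < v / 2 by linarith)).eventually_ge_atTop 1] with x hx hvl
      have hx0 : 0 < x := by linarith
      have hl0 : 0 ≤ Real.log x := Real.log_nonneg hx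
      have g := h (Real.exp (v / 2 * Real.log x)) x (by have := Real.add_one_le_exp (v / 2 * Real.log x); linarith)
        (by rw [← Real.le_log_iff_exp_le hx0]; nlinarith)
      rw [Real.log_exp] at g
      rw [le_div_iff₀ hx0]
      refine le_trans ?_ (cnt_ge _)
      have m : cnt (fun n => ¬ Sab (0 * Real.log x) (v * Real.log x) n) x ≤ cnt (fun n => ∀ p : ℕ, p.Prime → (p:ℝ) ≤ Real.exp (v / 2 * Real.log x) → ¬ p ∣ n) x := by
        apply cnt_mono
        intro n _ _ hn p hp h1 hd
        have hp0 : (0:ℝ) < p := by exact_mod_cast hp.pos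
        apply hn
        refine ⟨p, hd, ?_, ?_⟩
        · rw [zero_mul]; exact Real.log_pos (by exact_mod_cast hp.one_lt)
        · have := (Real.log_le_iff_le_exp hp0).2 h1
          linarith
      have e : (1 - 1 / x - C * (1 / (v / 2 * Real.log x))) * x = x - 1 - C * (x / (v / 2 * Real.log x)) := by
        field_simp
      rw [e]; linarith
    · have hv1 : v = 1 := le_antisymm hv (hc.resolve_left h0)
      subst hv1
      have t : Tendsto (fun x : ℝ => 1 - 2 * (1 / x) - x ^ (-(1 - u))) atTop (nhds 1) := by
        have t2 := tendsto_rpow_neg_atTop (show 0 < 1 - u by linarith)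
        have := ((tinv.const_mul 2).const_sub 1).sub t2
        simpa using this
      refine tendsto_of_tendsto_of_tendsto_of_le_of_le' t tendsto_const_nhds ?_ hle
      filter_upwards [eventually_ge_atTop 1] with x hx
      have hx0 : 0 < x := by linarith
      rw [le_div_iff₀ hx0]
      refine le_trans ?_ (cnt_ge _)
      have m : cnt (fun n => ¬ Sab (u * Real.log x) (1 * Real.log x) n) x ≤ cnt (fun n => (n:ℝ) ≤ x ^ u ∨ x ≤ (n:ℝ)) x := by
        apply cnt_mono
        intro n hn1 _ hn
        have hn0 : (0:ℝ) < n := by exact_mod_cast hn1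
        by_contra hcon
        push Not at hcon
        apply hn
        refine ⟨n, dvd_rfl, ?_, ?_⟩
        · rw [← Real.log_rpow hx0]; exact Real.log_lt_log (Real.rpow_pos_of_pos hx0 _) hcon.1
        · rw [one_mul]; exact Real.log_lt_log hn0 hcon.2
      have m2 := cnt_or_le (fun n => (n:ℝ) ≤ x ^ u) (fun n => x ≤ (n:ℝ)) x
      have m3 : cnt (fun n => (n:ℝ) ≤ x ^ u) x ≤ x ^ u := by
        have hp : 0 ≤ x ^ u := Real.rpow_nonneg hx0.le _
        refine le_trans ?_ (Nat.floor_le hp)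
        unfold cnt
        have : (⌊x ^ u⌋₊ : ℝ) = ((Icc 1 ⌊x ^ u⌋₊).card : ℝ) := by simp
        rw [this]
        norm_cast
        apply Finset.card_le_card
        intro n hn
        rw [Finset.mem_filter, Finset.mem_Icc] at hn
        rw [Finset.mem_Icc]
        exact ⟨hn.1.1, Nat.le_floor hn.2⟩
      have m4 : cnt (fun n => x ≤ (n:ℝ)) x ≤ 1 := by
        unfold cnt
        norm_cast
        rw [Finset.card_le_one]
        intro i hi j hj
        rw [Finset.mem_filter, Finset.mem_Icc, Nat.le_floor_iff hx0.le] at hi hj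
        have : (i:ℝ) = j := by linarith [hi.1.2, hi.2, hj.1.2, hj.2]
        exact_mod_cast this
      have e : (1 - 2 * (1 / x) - x ^ (-(1 - u))) * x = x - 1 - 1 - x ^ u := by
        have : x ^ (-(1 - u)) * x = x ^ u := by
          rw [← Real.rpow_add_one hx0.ne']; congr 1; ring
        rw [sub_mul, this]; field_simp; ring
      rw [e]; linarith
  · push Not at hc
    exact hlim hc.1 huv hc.2

lemma part_two : ∃ C : ℝ, 0 < C ∧ ∀ x y z : ℝ, 3 ≤ y → y < z → z ≤ Real.sqrt x →
    |(Hcnt x y z : ℝ) - x * hfin (Real.log y / Real.log x) (Real.log z / Real.log x)|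
      ≤ C * x / (Real.log y ^ erdosDelta * Real.log (Real.log y) ^ ((3:ℝ)/2 - erdosDelta)) := by
  obtain ⟨K, l0, hK, hl0, H⟩ := big
  refine ⟨8 * K + (2 * l0) ^ 3, by positivity, fun x y z hy hyz hz => ?_⟩
  have hs0 : 0 < Real.sqrt x := by linarith
  have hx0 : 0 < x := Real.sqrt_pos.1 hs0
  have hzx : z ^ 2 ≤ x := by
    calc z ^ 2 ≤ Real.sqrt x ^ 2 := pow_le_pow_left₀ (by linarith) hz 2
      _ = x := Real.sq_sqrt hx0.le
  have hx1 : 1 ≤ x := by nlinarith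
  set a := Real.log y with ha
  set b := Real.log z with hb
  set L := Real.log x with hLd
  have ha1 : 1 < a := by
    rw [ha, Real.lt_log_iff_exp_lt (by linarith)]
    linarith [Real.exp_one_lt_d9]
  have hab : a < b := Real.log_lt_log (by linarith) hyz
  have hbL : 2 * b ≤ L := by
    have := Real.log_le_log (by nlinarith) hzx
    rw [Real.log_pow] at this
    exact_mod_cast this
  have hL0 : 0 < L := by linarith
  have hfe : hfin (a / L) (b / L) = hL a b L := by
    have n : ¬ (a / L ≤ 0 ∨ 1 ≤ b / L) := by
      rintro (h | h)
      · have : 0 < a / L := by positivity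
        linarith
      · rw [le_div_iff₀ hL0] at h; linarith
    have := hL_scale hL0 (a / L) (b / L) 1
    unfold hfin
    rw [if_neg n, ← this]; congr 1 <;> field_simp
  rw [hfe, Hcnt_eq hx0.le (by linarith) (by linarith), ← ha, ← hb]
  have hla : 0 < Real.log a := Real.log_pos ha1
  have hd := del_pos
  have hd' := del_lt
  have p1 : 0 < a ^ erdosDelta := Real.rpow_pos_of_pos (by linarith) _
  have p2 : 0 < Real.log a ^ ((3:ℝ)/2 - erdosDelta) := Real.rpow_pos_of_pos hla _
  by_cases hc : l0 ≤ a / 2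
  · have h := H (a / 2) b x hc (by linarith) hbL hx1
    have e : 2 * (a / 2) = a := by ring
    rw [e, ← hLd] at h
    have h2 := Er_half (show 3 ≤ a / 2 by linarith)
    rw [e, Er_eq (show 3 ≤ a by linarith)] at h2
    refine h.trans ?_
    have h3 := mul_le_mul_of_nonneg_left h2 (show 0 ≤ K * x by positivity)
    refine h3.trans ?_
    rw [mul_comm (a ^ erdosDelta)]
    have e3 : K * x * (8 * (1 / (Real.log a ^ ((3:ℝ)/2 - erdosDelta) * a ^ erdosDelta))) = 8 * K * x / (Real.log a ^ ((3:ℝ)/2 - erdosDelta) * a ^ erdosDelta) := by ring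
    rw [e3]
    apply div_le_div_of_nonneg_right _ (by positivity)
    have : 0 ≤ (2 * l0) ^ 3 := by positivity
    nlinarith
  · push Not at hc
    have b1 : |cnt (Sab a b) x - x * hL a b L| ≤ x := by
      have q1 := cnt_le (Sab a b) hx0.le
      have q2 := cnt_nonneg (Sab a b) x
      have q3 := mul_le_mul_of_nonneg_left (hL_le_one a b L) hx0.le
      have q4 := mul_nonneg hx0.le (hL_nonneg a b L)
      rw [abs_le]; constructor <;> linarith
    refine b1.trans ?_
    rw [le_div_iff₀ (by positivity)]
    have u1 : a ^ erdosDelta ≤ a := by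
      calc a ^ erdosDelta ≤ a ^ (1:ℝ) := Real.rpow_le_rpow_of_exponent_le ha1.le (by linarith)
        _ = a := Real.rpow_one _
    have u2 : Real.log a ^ ((3:ℝ)/2 - erdosDelta) ≤ a ^ 2 := by
      calc Real.log a ^ ((3:ℝ)/2 - erdosDelta) ≤ a ^ ((3:ℝ)/2 - erdosDelta) :=
            Real.rpow_le_rpow hla.le ((Real.log_le_sub_one_of_pos (by linarith)).trans (by linarith)) (by linarith)
        _ ≤ a ^ (2:ℝ) := Real.rpow_le_rpow_of_exponent_le ha1.le (by linarith)
        _ = a ^ 2 := Real.rpow_two _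
    have u3 : a ^ erdosDelta * Real.log a ^ ((3:ℝ)/2 - erdosDelta) ≤ (2 * l0) ^ 3 := by
      calc _ ≤ a * a ^ 2 := mul_le_mul u1 u2 p2.le (by linarith)
        _ = a ^ 3 := by ring
        _ ≤ _ := pow_le_pow_left₀ (by linarith) (by linarith) 3
    have := mul_le_mul_of_nonneg_left u3 hx0.le
    have : 0 ≤ 8 * K * x := by positivity
    nlinarith

end Erd

theorem stmt_16 :
    ∃ h : ℝ → ℝ → ℝ,
      (∀ u v : ℝ, 0 ≤ u → u < v → v ≤ 1 →
        Tendsto (fun x : ℝ => (Hcnt x (x ^ u) (x ^ v) : ℝ) / x) atTop (nhds (h u v))) ∧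
      (∃ C : ℝ, 0 < C ∧ ∀ x y z : ℝ, 3 ≤ y → y < z → z ≤ Real.sqrt x →
        |(Hcnt x y z : ℝ) - x * h (Real.log y / Real.log x) (Real.log z / Real.log x)| ≤
          C * x / (Real.log y ^ erdosDelta * Real.log (Real.log y) ^ ((3 : ℝ) / 2 - erdosDelta))) := by
  exact ⟨Erd.hfin, Erd.part_one, Erd.part_two⟩
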